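/- Let T be NSOP_3, and let p₁, p₂, p₃ be internally NSOP_1 types over M. Let a₁ ≡_M a₁' be tuples of realizations of p₁, a₂ a tuple of realizations of p₂, and a₃ a tuple of realizations of p₃. If a₁ ⫝^{K*}_M a₂, a₁' ⫝^{K*}_M a₃, and a₂ ⫝^{K*}_M a₃, then there is a₁'' with a₁'' ⊨ tp(a₁/Ma₂) ∪ tp(a₁'/Ma₃). Moreover, a₁'' can be chosen with a₂a₃ ⫝^{K*}_M a₁'', a₂a₁'' ⫝^{K*}_M a₃, and a₃a₁'' ⫝^{K*}_M a₂. -/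

import Mathlib

namespace NSOP3Paper

open FirstOrder Language

universe u v w w' w₂ x y z

/-- Consistency (equivalently, by compactness over the monster model, finite
satisfiability) of a family of conditions on tuples. -/
def FamConsistent {ι : Type*} {X : Type*} (C : ι → X → Prop) : Prop :=
  ∀ s : Finset ι, ∃ xx : X, ∀ i ∈ s, C i xx

/-- `k`-inconsistency of a family of conditions: any `k` of them (with pairwise
distinct indices) are jointly unsatisfiable. -/
def FamKInconsistent {ι : Type*} {X : Type*} (k : ℕ) (C : ι → X → Prop) : Prop :=
  ∀ s : Finset ι, s.card = k → ¬∃ xx : X, ∀ i ∈ s, C i xx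

/-- Flattening of a family of tuples into a single tuple. -/
def flat {𝕄 : Type w} {ι : Type*} {β : Type*} (a : ι → β → 𝕄) : ι × β → 𝕄 :=
  fun q => a q.1 q.2

/-- A first-order `L`-formula in free variables `α`, together with a tuple of
parameters from `𝕄`; this represents an instance `φ(x̄, b̄)`. -/
structure ParamFormula (L : FirstOrder.Language.{u, v}) (𝕄 : Type w) [L.Structure 𝕄]
    (α : Type w') where
  Params : Type
  toFormula : L.Formula (α ⊕ Params)
  params : Params → 𝕄

namespace ParamFormula

variable {L : FirstOrder.Language.{u, v}} {𝕄 : Type w} [L.Structure 𝕄] {α : Type w'}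

/-- Realization of `φ(x̄, b̄)` at a tuple from `𝕄`. -/
def Realize (φ : ParamFormula L 𝕄 α) (xx : α → 𝕄) : Prop :=
  φ.toFormula.Realize (Sum.elim xx φ.params)

/-- All parameters of `φ` lie in `A`; i.e. `φ ∈ L(A)`. -/
def ParamsIn (φ : ParamFormula L 𝕄 α) (A : Set 𝕄) : Prop :=
  ∀ i, φ.params i ∈ A

/-- Negation of a formula with parameters. -/
protected def not (φ : ParamFormula L 𝕄 α) : ParamFormula L 𝕄 α :=
  ⟨φ.Params, BoundedFormula.not φ.toFormula, φ.params⟩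

/-- Substitute a tuple of elements of `𝕄` for the second group of free variables,
obtaining the instance `φ(x̄, c̄)` as a formula with parameters. -/
def subst {γ : Type} (φ : ParamFormula L 𝕄 (α ⊕ γ)) (c : γ → 𝕄) : ParamFormula L 𝕄 α :=
  ⟨γ ⊕ φ.Params,
    (φ.toFormula).relabel (Sum.elim (Sum.map id Sum.inl) (Sum.inr ∘ Sum.inr)),
    Sum.elim c φ.params⟩

end ParamFormula

section TypesDefs

variable (L : FirstOrder.Language.{u, v}) (𝕄 : Type w) [L.Structure 𝕄]

/-- Two tuples have the same type over the parameter set `A` (written `b ≡_A b'`). -/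
def TpEq (A : Set 𝕄) {β : Type w'} (b b' : β → 𝕄) : Prop :=
  ∀ φ : ParamFormula L 𝕄 β, φ.ParamsIn A → (φ.Realize b ↔ φ.Realize b')

/-- A complete global type in variables `α`: a complete, consistent set of formulas
with parameters from the monster model `𝕄`. -/
structure GlobalType (α : Type w') where
  Mem : ParamFormula L 𝕄 α → Prop
  consistent : ∀ S : Finset (ParamFormula L 𝕄 α), (∀ φ ∈ S, Mem φ) →
    ∃ xx : α → 𝕄, ∀ φ ∈ S, φ.Realize xx
  complete : ∀ φ : ParamFormula L 𝕄 α, Mem φ ∨ Mem φ.not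

/-- A sequence of tuples is indiscernible over the parameter set `A`: any two finite
increasing subtuples of the same length have the same type over `A`. -/
def IndiscernibleOver (A : Set 𝕄) {β : Type w'} (b : ℕ → β → 𝕄) : Prop :=
  ∀ (n : ℕ) (f g : Fin n → ℕ), StrictMono f → StrictMono g →
    TpEq L 𝕄 A (fun q : Fin n × β => b (f q.1) q.2) (fun q : Fin n × β => b (g q.1) q.2)

end TypesDefs

namespace GlobalType

variable {L : FirstOrder.Language.{u, v}} {𝕄 : Type w} [L.Structure 𝕄] {α : Type w'}

/-- A global type is invariant over `A` if membership of `φ(x̄, b̄)` depends only on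
the type of `b̄` over `A`. -/
def InvariantOver (p : GlobalType L 𝕄 α) (A : Set 𝕄) : Prop :=
  ∀ (P : Type) (ψ : L.Formula (α ⊕ P)) (b b' : P → 𝕄),
    TpEq L 𝕄 A b b' → (p.Mem ⟨P, ψ, b⟩ ↔ p.Mem ⟨P, ψ, b'⟩)

/-- A global type is finitely satisfiable in `A` if each of its formulas is satisfied
by a tuple from `A`. -/
def FinSatIn (p : GlobalType L 𝕄 α) (A : Set 𝕄) : Prop :=
  ∀ φ : ParamFormula L 𝕄 α, p.Mem φ → ∃ xx : α → 𝕄, (∀ i, xx i ∈ A) ∧ φ.Realize xx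

/-- `a ⊨ p|_B` : the tuple `a` realizes the restriction of the global type `p` to the
parameter set `B`. -/
def RealizesOver (p : GlobalType L 𝕄 α) (B : Set 𝕄) (a : α → 𝕄) : Prop :=
  ∀ φ : ParamFormula L 𝕄 α, p.Mem φ → φ.ParamsIn B → φ.Realize a

/-- `(b i)` is a Morley sequence in `p` over `A`: each `b i ⊨ p|_{A b_{<i}}`. -/
def IsMorleyOver (p : GlobalType L 𝕄 α) (A : Set 𝕄) (b : ℕ → α → 𝕄) : Prop :=
  ∀ i : ℕ, p.RealizesOver (A ∪ ⋃ j ∈ Set.Iio i, Set.range (b j)) (b i)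

end GlobalType

section MorleyDefs

variable (L : FirstOrder.Language.{u, v}) (𝕄 : Type w) [L.Structure 𝕄]

/-- `(b i)` is an invariant Morley sequence over `A`: a Morley sequence in some global
type invariant over `A`. -/
def IsInvMorleyOver (A : Set 𝕄) {α : Type w'} (b : ℕ → α → 𝕄) : Prop :=
  ∃ p : GlobalType L 𝕄 α, p.InvariantOver A ∧ p.IsMorleyOver A b

/-- `(b i)` is a coheir Morley sequence over `A`: a Morley sequence in some global
type finitely satisfiable in `A`. -/
def IsCoheirMorleyOver (A : Set 𝕄) {α : Type w'} (b : ℕ → α → 𝕄) : Prop :=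
  ∃ p : GlobalType L 𝕄 α, p.FinSatIn A ∧ p.IsMorleyOver A b

end MorleyDefs

namespace ParamFormula

variable {L : FirstOrder.Language.{u, v}} {𝕄 : Type w} [L.Structure 𝕄] {α : Type w'}

/-- `φ(x̄, b̄)` Kim-divides over `A`: some invariant Morley sequence over `A` starting
with `b̄` makes the corresponding instances inconsistent. -/
def KimDividesOver (φ : ParamFormula L 𝕄 α) (A : Set 𝕄) : Prop :=
  ∃ b : ℕ → φ.Params → 𝕄, b 0 = φ.params ∧ IsInvMorleyOver L 𝕄 A b ∧
    ¬FamConsistent fun (i : ℕ) (xx : α → 𝕄) => φ.toFormula.Realize (Sum.elim xx (b i))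

/-- `φ(x̄, b̄)` Conant-divides over `A`: every invariant Morley sequence over `A`
starting with `b̄` makes the corresponding instances inconsistent. -/
def ConantDividesOver (φ : ParamFormula L 𝕄 α) (A : Set 𝕄) : Prop :=
  ∀ b : ℕ → φ.Params → 𝕄, b 0 = φ.params → IsInvMorleyOver L 𝕄 A b →
    ¬FamConsistent fun (i : ℕ) (xx : α → 𝕄) => φ.toFormula.Realize (Sum.elim xx (b i))

/-- `φ(x̄, b̄)` divides over `A`: some `A`-indiscernible sequence starting with `b̄`
makes the corresponding instances inconsistent. -/
def DividesOver (φ : ParamFormula L 𝕄 α) (A : Set 𝕄) : Prop :=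
  ∃ b : ℕ → φ.Params → 𝕄, b 0 = φ.params ∧ IndiscernibleOver L 𝕄 A b ∧
    ¬FamConsistent fun (i : ℕ) (xx : α → 𝕄) => φ.toFormula.Realize (Sum.elim xx (b i))

/-- `φ` Kim-forks over `A`: it implies a finite disjunction of formulas Kim-dividing
over `A`. -/
def KimForksOver (φ : ParamFormula L 𝕄 α) (A : Set 𝕄) : Prop :=
  ∃ (k : ℕ) (ψ : Fin k → ParamFormula L 𝕄 α), (∀ j, (ψ j).KimDividesOver A) ∧
    ∀ xx : α → 𝕄, φ.Realize xx → ∃ j, (ψ j).Realize xx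

/-- `φ` Conant-forks over `A`: it implies a finite disjunction of formulas
Conant-dividing over `A`. -/
def ConantForksOver (φ : ParamFormula L 𝕄 α) (A : Set 𝕄) : Prop :=
  ∃ (k : ℕ) (ψ : Fin k → ParamFormula L 𝕄 α), (∀ j, (ψ j).ConantDividesOver A) ∧
    ∀ xx : α → 𝕄, φ.Realize xx → ∃ j, (ψ j).Realize xx

/-- `φ` forks over `A`: it implies a finite disjunction of formulas dividing over `A`. -/
def ForksOver (φ : ParamFormula L 𝕄 α) (A : Set 𝕄) : Prop :=
  ∃ (k : ℕ) (ψ : Fin k → ParamFormula L 𝕄 α), (∀ j, (ψ j).DividesOver A) ∧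
    ∀ xx : α → 𝕄, φ.Realize xx → ∃ j, (ψ j).Realize xx

end ParamFormula

section IndDefs

variable (L : FirstOrder.Language.{u, v}) (𝕄 : Type w) [L.Structure 𝕄]

/-- `a ⫝^K_A B` : `tp(a/A ∪ B)` contains no formula Kim-forking over `A`. -/
def IndKim (A B : Set 𝕄) {γ : Type w'} (a : γ → 𝕄) : Prop :=
  ∀ φ : ParamFormula L 𝕄 γ, φ.ParamsIn (A ∪ B) → φ.Realize a → ¬φ.KimForksOver A

/-- `a ⫝^{Kd}_A B` : `tp(a/A ∪ B)` contains no formula Kim-dividing over `A`. -/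
def IndKd (A B : Set 𝕄) {γ : Type w'} (a : γ → 𝕄) : Prop :=
  ∀ φ : ParamFormula L 𝕄 γ, φ.ParamsIn (A ∪ B) → φ.Realize a → ¬φ.KimDividesOver A

/-- `a ⫝^{K*}_A B` : Conant-independence. -/
def IndConant (A B : Set 𝕄) {γ : Type w'} (a : γ → 𝕄) : Prop :=
  ∀ φ : ParamFormula L 𝕄 γ, φ.ParamsIn (A ∪ B) → φ.Realize a → ¬φ.ConantForksOver A

/-- `a ⫝^{K*d}_A B` : Conant-dividing independence. -/
def IndConantD (A B : Set 𝕄) {γ : Type w'} (a : γ → 𝕄) : Prop :=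
  ∀ φ : ParamFormula L 𝕄 γ, φ.ParamsIn (A ∪ B) → φ.Realize a → ¬φ.ConantDividesOver A

/-- `a ⫝^f_A B` : forking-independence. -/
def IndForking (A B : Set 𝕄) {γ : Type w'} (a : γ → 𝕄) : Prop :=
  ∀ φ : ParamFormula L 𝕄 γ, φ.ParamsIn (A ∪ B) → φ.Realize a → ¬φ.ForksOver A

/-- `a ⫝^i_A B` : `tp(a/A ∪ B)` extends to a global type invariant over `A`. -/
def IndInv (A B : Set 𝕄) {γ : Type w'} (a : γ → 𝕄) : Prop :=
  ∃ p : GlobalType L 𝕄 γ, p.InvariantOver A ∧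
    ∀ φ : ParamFormula L 𝕄 γ, φ.ParamsIn (A ∪ B) → φ.Realize a → p.Mem φ

/-- `a ⫝^u_A B` : `tp(a/A ∪ B)` extends to a global type finitely satisfiable in `A`. -/
def IndFinSat (A B : Set 𝕄) {γ : Type w'} (a : γ → 𝕄) : Prop :=
  ∃ p : GlobalType L 𝕄 γ, p.FinSatIn A ∧
    ∀ φ : ParamFormula L 𝕄 γ, φ.ParamsIn (A ∪ B) → φ.Realize a → p.Mem φ

/-- `a ⫝^{K+}_A b` : there is an invariant Morley sequence over `A` starting with `b`
that is indiscernible over `A ∪ a`. -/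
def IndKPlus (A : Set 𝕄) {δ : Type w'} {γ : Type w₂} (b : δ → 𝕄) (a : γ → 𝕄) : Prop :=
  ∃ bs : ℕ → δ → 𝕄, bs 0 = b ∧ IsInvMorleyOver L 𝕄 A bs ∧
    IndiscernibleOver L 𝕄 (A ∪ Set.range a) bs

/-- `a ⫝^{K+u}_A b` : there is a coheir Morley sequence over `A` starting with `b`
that is indiscernible over `A ∪ a`. -/
def IndKPlusU (A : Set 𝕄) {δ : Type w'} {γ : Type w₂} (b : δ → 𝕄) (a : γ → 𝕄) : Prop :=
  ∃ bs : ℕ → δ → 𝕄, bs 0 = b ∧ IsCoheirMorleyOver L 𝕄 A bs ∧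
    IndiscernibleOver L 𝕄 (A ∪ Set.range a) bs

/-- Conant-independence `⫝^{K*}` is symmetric (over every small model). -/
def ConantSymmetric : Prop :=
  ∀ (M : L.ElementarySubstructure 𝕄) (γ δ : Type w) (a : γ → 𝕄) (b : δ → 𝕄),
    IndConant L 𝕄 (M : Set 𝕄) (Set.range b) a → IndConant L 𝕄 (M : Set 𝕄) (Set.range a) b

/-- Conant-dividing independence `⫝^{K*d}` is symmetric. -/
def ConantDSymmetric : Prop :=
  ∀ (M : L.ElementarySubstructure 𝕄) (γ δ : Type w) (a : γ → 𝕄) (b : δ → 𝕄),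
    IndConantD L 𝕄 (M : Set 𝕄) (Set.range b) a → IndConantD L 𝕄 (M : Set 𝕄) (Set.range a) b

/-- The relation `⫝^{K+}` is symmetric. -/
def KPlusSymmetric : Prop :=
  ∀ (M : L.ElementarySubstructure 𝕄) (γ δ : Type w) (a : γ → 𝕄) (b : δ → 𝕄),
    IndKPlus L 𝕄 (M : Set 𝕄) b a → IndKPlus L 𝕄 (M : Set 𝕄) a b

/-- Forking-independence satisfies the chain condition with respect to invariant
Morley sequences. -/
def ChainConditionF : Prop :=
  ∀ (M : L.ElementarySubstructure 𝕄) (γ δ : Type w) (a : γ → 𝕄) (bs : ℕ → δ → 𝕄),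
    IsInvMorleyOver L 𝕄 (M : Set 𝕄) bs →
    IndForking L 𝕄 (M : Set 𝕄) (Set.range (bs 0)) a →
    ∃ bs' : ℕ → δ → 𝕄,
      TpEq L 𝕄 ((M : Set 𝕄) ∪ Set.range (bs 0)) (flat bs') (flat bs) ∧
      IndiscernibleOver L 𝕄 ((M : Set 𝕄) ∪ Set.range a) bs' ∧
      IndForking L 𝕄 (M : Set 𝕄) (Set.range (flat bs')) a

/-- Kim-independence satisfies the chain condition with respect to invariant Morley
sequences. -/
def ChainConditionK : Prop :=
  ∀ (M : L.ElementarySubstructure 𝕄) (γ δ : Type w) (a : γ → 𝕄) (bs : ℕ → δ → 𝕄),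
    IsInvMorleyOver L 𝕄 (M : Set 𝕄) bs →
    IndKim L 𝕄 (M : Set 𝕄) (Set.range (bs 0)) a →
    ∃ bs' : ℕ → δ → 𝕄,
      TpEq L 𝕄 ((M : Set 𝕄) ∪ Set.range (bs 0)) (flat bs') (flat bs) ∧
      IndiscernibleOver L 𝕄 ((M : Set 𝕄) ∪ Set.range a) bs' ∧
      IndKim L 𝕄 (M : Set 𝕄) (Set.range (flat bs')) a

/-- `T` is NSOP₃: there is no definable binary relation on tuples with no 3-cycles
containing an infinite chain. -/
def IsNSOP3 : Prop :=
  ¬∃ (m : ℕ) (R : ParamFormula L 𝕄 (Fin m ⊕ Fin m)) (a : ℕ → Fin m → 𝕄),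
    (∀ i j : ℕ, i < j → R.Realize (Sum.elim (a i) (a j))) ∧
    ¬∃ x1 x2 x3 : Fin m → 𝕄,
      R.Realize (Sum.elim x1 x2) ∧ R.Realize (Sum.elim x2 x3) ∧ R.Realize (Sum.elim x3 x1)

/-- `𝕄` is a `κ`-monster: every consistent type in fewer than `κ` variables over a
parameter set of size less than `κ` is realized. -/
class IsMonster (κ : Cardinal.{w}) : Prop where
  saturated : ∀ {α : Type w} (A : Set 𝕄) (S : Set (ParamFormula L 𝕄 α)),
    Cardinal.mk α < κ → Cardinal.mk A < κ → (∀ φ ∈ S, φ.ParamsIn A) →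
    (∀ S₀ : Finset (ParamFormula L 𝕄 α), (∀ φ ∈ S₀, φ ∈ S) →
      ∃ xx : α → 𝕄, ∀ φ ∈ S₀, φ.Realize xx) →
    ∃ xx : α → 𝕄, ∀ φ ∈ S, φ.Realize xx

/-- A tuple realizes the partial type `P`. -/
def RealizesPType {nv : ℕ} (P : Set (ParamFormula L 𝕄 (Fin nv))) (a : Fin nv → 𝕄) : Prop :=
  ∀ φ ∈ P, φ.Realize a

/-- `p(x̄)` is co-NSOP₁: no `L(M)`-formula `φ(x̄, ȳ)` and tree of tuples of
realizations of `p` witness SOP₁-style consistency/inconsistency. -/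
def CoNSOP1 (M : Set 𝕄) {nv : ℕ} (P : Set (ParamFormula L 𝕄 (Fin nv))) : Prop :=
  ¬∃ (k m : ℕ) (φ : ParamFormula L 𝕄 (Fin k ⊕ (Fin m × Fin nv)))
      (b : List Bool → Fin m → Fin nv → 𝕄),
    φ.ParamsIn M ∧
    (∀ η j, RealizesPType L 𝕄 P (b η j)) ∧
    (∀ σ : ℕ → Bool, FamConsistent fun (n : ℕ) (xx : Fin k → 𝕄) =>
      (φ.subst (flat (b (List.ofFn fun i : Fin n => σ i)))).Realize xx) ∧
    (∀ η₁ η₂ : List Bool, (η₁ ++ [false]) <+: η₂ →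
      ¬∃ xx : Fin k → 𝕄, (φ.subst (flat (b η₂))).Realize xx ∧
        (φ.subst (flat (b (η₁ ++ [true])))).Realize xx)

/-- The set of realizations of the partial type `P`. -/
def PRealizations {nv : ℕ} (P : Set (ParamFormula L 𝕄 (Fin nv))) : Type w :=
  { a : Fin nv → 𝕄 // RealizesPType L 𝕄 P a }

/-- The language `L_p` associated to a partial `nv`-type: an `m`-ary relation symbol
for each `L(M)`-formula in `m` groups of `nv` variables. -/
def pLang (M : Set 𝕄) (nv : ℕ) : Language :=
  ⟨fun _ => Empty, fun m => { φ : ParamFormula L 𝕄 (Fin m × Fin nv) // φ.ParamsIn M }⟩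

/-- The structure `M_p` on the set of realizations of `p`, with relations interpreted
by the corresponding formulas in `𝕄`. -/
instance pStruct (M : Set 𝕄) {nv : ℕ} (P : Set (ParamFormula L 𝕄 (Fin nv))) :
    (pLang L 𝕄 M nv).Structure (PRealizations L 𝕄 P) where
  funMap := fun {n} f _ => f.elim
  RelMap := fun {m} R xs => R.1.Realize fun q : Fin m × Fin nv => (xs q.1).1 q.2

end IndDefs

/-- An SOP₁ pattern witnessed inside the structure `W`. -/
def SOP1PatternIn (L' : FirstOrder.Language.{x, y}) (W : Type z) [L'.Structure W] : Prop :=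
  ∃ (k n : ℕ) (φ : L'.Formula (Fin k ⊕ Fin n)) (bt : List Bool → Fin n → W),
    (∀ σ : ℕ → Bool, FamConsistent fun (i : ℕ) (xx : Fin k → W) =>
      φ.Realize (Sum.elim xx (bt (List.ofFn fun j : Fin i => σ j)))) ∧
    (∀ η₁ η₂ : List Bool, (η₁ ++ [false]) <+: η₂ →
      ¬∃ xx : Fin k → W, φ.Realize (Sum.elim xx (bt η₂)) ∧
        φ.Realize (Sum.elim xx (bt (η₁ ++ [true]))))

/-- The complete theory of `N` is NSOP₁: no SOP₁ pattern in any elementarily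
equivalent structure. -/
def IsNSOP1Th (L' : FirstOrder.Language.{x, y}) (N : Type z) [L'.Structure N] : Prop :=
  ¬∃ (W : Type (max x y z)) (S : L'.Structure W),
    L'.completeTheory N = @Language.completeTheory L' W S ∧ @SOP1PatternIn L' W S

/-- The formula `φ(x̄, ȳ)` has the tree property, witnessed in `W`. -/
def FormulaTPIn (L' : FirstOrder.Language.{x, y}) (W : Type z) [L'.Structure W]
    {k n : ℕ} (φ : L'.Formula (Fin k ⊕ Fin n)) : Prop :=
  ∃ (kk : ℕ) (bt : List ℕ → Fin n → W),
    (∀ σ : ℕ → ℕ, FamConsistent fun (i : ℕ) (xx : Fin k → W) =>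
      φ.Realize (Sum.elim xx (bt (List.ofFn fun j : Fin i => σ j)))) ∧
    (∀ η : List ℕ, FamKInconsistent kk fun (j : ℕ) (xx : Fin k → W) =>
      φ.Realize (Sum.elim xx (bt (η ++ [j]))))

/-- The formula `φ(x̄, ȳ)` has SOP₁, witnessed in `W`. -/
def FormulaSOP1In (L' : FirstOrder.Language.{x, y}) (W : Type z) [L'.Structure W]
    {k n : ℕ} (φ : L'.Formula (Fin k ⊕ Fin n)) : Prop :=
  ∃ bt : List Bool → Fin n → W,
    (∀ σ : ℕ → Bool, FamConsistent fun (i : ℕ) (xx : Fin k → W) =>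
      φ.Realize (Sum.elim xx (bt (List.ofFn fun j : Fin i => σ j)))) ∧
    (∀ η₁ η₂ : List Bool, (η₁ ++ [false]) <+: η₂ →
      ¬∃ xx : Fin k → W, φ.Realize (Sum.elim xx (bt η₂)) ∧
        φ.Realize (Sum.elim xx (bt (η₁ ++ [true]))))

/-- Longest common prefix (meet in the tree `2^{<ω}`). -/
def meet : List Bool → List Bool → List Bool
  | a :: as, b :: bs => if a = b then a :: meet as bs else []
  | _, _ => []

/-- Strict tree order (strict prefix) on `2^{<ω}`. -/
def StrictPrefix (η ν : List Bool) : Prop := η <+: ν ∧ η ≠ ν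

/-- Lexicographic order on `2^{<ω}`. -/
def LexLt (η ν : List Bool) : Prop :=
  StrictPrefix η ν ∨ ((meet η ν ++ [false]) <+: η ∧ (meet η ν ++ [true]) <+: ν)

/-- The meet `c 0 ∧ … ∧ c k`. -/
def meetInit (c : ℕ → List Bool) : ℕ → List Bool
  | 0 => c 0
  | k + 1 => meet (meetInit c k) (c (k + 1))

/-- `c 0, …, c (l-1)` is a descending comb: a lexicographically increasing antichain
whose successive meets form a strictly descending chain in the tree order. -/
def IsDescendingComb (l : ℕ) (c : ℕ → List Bool) : Prop :=
  (∀ i j, i < l → j < l → i ≠ j → ¬(c i <+: c j)) ∧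
  (∀ i j, i < j → j < l → LexLt (c i) (c j)) ∧
  (∀ k, k + 1 < l → StrictPrefix (meetInit c (k + 1)) (meetInit c k))

section DCTP

variable (L : FirstOrder.Language.{u, v}) (𝕄 : Type w) [L.Structure 𝕄]

/-- `T` has `k`-DCTP₂. -/
def HasKDCTP2 (k : ℕ) : Prop :=
  ∃ (kx ny : ℕ) (φ : ParamFormula L 𝕄 (Fin kx ⊕ Fin ny)) (b : List Bool → Fin ny → 𝕄),
    (∀ σ : ℕ → Bool, FamKInconsistent k fun (n : ℕ) (xx : Fin kx → 𝕄) =>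
      (φ.subst (b (List.ofFn fun i : Fin n => σ i))).Realize xx) ∧
    (∀ (l : ℕ) (c : ℕ → List Bool), IsDescendingComb l c →
      ∃ xx : Fin kx → 𝕄, ∀ i < l, (φ.subst (b (c i))).Realize xx)

/-- `T` is N-ω-DCTP₂: it does not have `k`-DCTP₂ for any `k`. -/
def NOmegaDCTP2 : Prop := ∀ k : ℕ, ¬HasKDCTP2 L 𝕄 k

/-- A generic triple of sets of realizations of three partial types: the three sets
begin mutually indiscernible invariant Morley sequences over `M`. -/
def GenericTriple (M : Set 𝕄) {ι₁ ι₂ ι₃ : Type w} {nv₁ nv₂ nv₃ : ℕ}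
    (A : ι₁ → Fin nv₁ → 𝕄) (B : ι₂ → Fin nv₂ → 𝕄) (C : ι₃ → Fin nv₃ → 𝕄) : Prop :=
  ∃ (IA : ℕ → ι₁ → Fin nv₁ → 𝕄) (IB : ℕ → ι₂ → Fin nv₂ → 𝕄) (IC : ℕ → ι₃ → Fin nv₃ → 𝕄),
    IA 0 = A ∧ IB 0 = B ∧ IC 0 = C ∧
    IsInvMorleyOver L 𝕄 M (fun i => flat (IA i)) ∧
    IsInvMorleyOver L 𝕄 M (fun i => flat (IB i)) ∧
    IsInvMorleyOver L 𝕄 M (fun i => flat (IC i)) ∧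
    IndiscernibleOver L 𝕄
      (M ∪ Set.range (flat fun i => flat (IB i)) ∪ Set.range (flat fun i => flat (IC i)))
      (fun i => flat (IA i)) ∧
    IndiscernibleOver L 𝕄
      (M ∪ Set.range (flat fun i => flat (IA i)) ∪ Set.range (flat fun i => flat (IC i)))
      (fun i => flat (IB i)) ∧
    IndiscernibleOver L 𝕄
      (M ∪ Set.range (flat fun i => flat (IA i)) ∪ Set.range (flat fun i => flat (IB i)))
      (fun i => flat (IC i))

end DCTP

/-- The language of hypergraph sequences: one `n`-ary relation symbol for each `n`. -/
def hgLang : FirstOrder.Language.{0, 0} := ⟨fun _ => Empty, fun _ => PUnit⟩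

section Hypergraph

variable (V : Type z) [hgLang.Structure V]

/-- The `n`-ary edge relation of a hypergraph sequence. -/
def hgRel {n : ℕ} (v : Fin n → V) : Prop :=
  @Structure.RelMap hgLang V _ n PUnit.unit v

/-- A family of vertices is a clique: every tuple of its members is an edge. -/
def IsClique {ι : Type*} (a : ι → V) : Prop :=
  ∀ (n : ℕ) (f : Fin n → ι), hgRel V fun j => a (f j)

/-- A family of vertices is a `k`-anticlique: no `k`-tuple of its members (with
pairwise distinct indices) is an edge. -/
def IsAnticlique (k : ℕ) {ι : Type*} (a : ι → V) : Prop :=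
  ∀ f : Fin k → ι, Function.Injective f → ¬hgRel V fun j => a (f j)

/-- The hypergraph sequence has MTP. -/
def HasMTP : Prop :=
  ∃ (k : ℕ) (bt : List ℕ → V),
    (∀ σ : ℕ → ℕ, IsClique V fun n : ℕ => bt (List.ofFn fun j : Fin n => σ j)) ∧
    (∀ η : List ℕ, IsAnticlique V k fun n : ℕ => bt (η ++ [n]))

/-- The hypergraph sequence has an `(ω, ω, 1)`-array. -/
def HasOmegaArray : Prop :=
  ∃ (k : ℕ) (bt : ℕ → ℕ → V),
    (∀ i : ℕ, IsClique V (bt i)) ∧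
    (∀ σ : ℕ → ℕ, IsAnticlique V k fun i : ℕ => bt i (σ i))

/-- The hypergraph sequence has MSOP₁. -/
def HasMSOP1 : Prop :=
  ∃ bt : List Bool → V,
    (∀ σ : ℕ → Bool, IsClique V fun n : ℕ => bt (List.ofFn fun j : Fin n => σ j)) ∧
    (∀ η₁ η₂ : List Bool, (η₁ ++ [false]) <+: η₂ →
      IsAnticlique V 2 ![bt η₂, bt (η₁ ++ [true])])

/-- The hypergraph sequence has ω-MDCTP₂. -/
def HasOmegaMDCTP2 : Prop :=
  ∃ (k : ℕ) (bt : List Bool → V),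
    (∀ σ : ℕ → Bool, IsAnticlique V k fun n : ℕ => bt (List.ofFn fun j : Fin n => σ j)) ∧
    (∀ (l : ℕ) (c : ℕ → List Bool), IsDescendingComb l c →
      IsClique V fun i : Fin l => bt (c i))

/-- The hypergraph sequence has the compatible order property. -/
def HasCompatibleOrderProperty : Prop :=
  ∃ c d : ℕ → V,
    (∀ m n : ℕ, m < n →
      IsClique V fun i : Fin (n + 1) => if (i : ℕ) ≤ m then d i else c i) ∧
    (∀ m n : ℕ, m < n → ¬hgRel V ![c m, d n])

end Hypergraph

universe r

namespace Abs
open Filter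


/-- Abstract definable-set system: a saturated structure with a distinguished small model. -/
class DSys (𝕄 : Type w) where
  D : ∀ {α : Type}, Set (α → 𝕄) → Prop
  M : Set 𝕄
  univ : ∀ {α : Type}, D (Set.univ : Set (α → 𝕄))
  compl : ∀ {α : Type} {S : Set (α → 𝕄)}, D S → D Sᶜ
  inter : ∀ {α : Type} {S T : Set (α → 𝕄)}, D S → D T → D (S ∩ T)
  diag : ∀ {α : Type} (i j : α), D {x : α → 𝕄 | x i = x j}
  pre : ∀ {α β : Type} (f : α → β) {S : Set (α → 𝕄)}, D S → D {x : β → 𝕄 | x ∘ f ∈ S}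
  proj : ∀ {α β : Type} {S : Set (α ⊕ β → 𝕄)}, D S → D {x : α → 𝕄 | ∃ y, Sum.elim x y ∈ S}
  subst : ∀ {α β : Type} {S : Set (α ⊕ β → 𝕄)} (m : α → 𝕄), (∀ i, m i ∈ M) → D S →
    D {y : β → 𝕄 | Sum.elim m y ∈ S}
  model : ∀ {α : Type} {S : Set (α → 𝕄)}, D S → S.Nonempty → ∃ m ∈ S, ∀ i, m i ∈ M
  fs : ∀ {α : Type} {S : Set (α → 𝕄)}, D S →
    ∃ F : Finset α, ∀ x y : α → 𝕄, (∀ i ∈ F, x i = y i) → x ∈ S → y ∈ S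
  sat : ∀ {α β : Type} [Countable α] [Countable β] (c : β → 𝕄) (F : Set (Set (α ⊕ β → 𝕄))),
    (∀ S ∈ F, D S) →
    (∀ G : Finset (Set (α ⊕ β → 𝕄)), (∀ S ∈ G, S ∈ F) → ∃ x : α → 𝕄, ∀ S ∈ G, Sum.elim x c ∈ S) →
    ∃ x : α → 𝕄, ∀ S ∈ F, Sum.elim x c ∈ S

/-- Sorts: types identified with countable tuples. -/
class Srt (𝕄 : outParam (Type w)) (X : Type w) where
  idx : Type
  cnt : Countable idx
  eqv : X ≃ (idx → 𝕄)

attribute [instance] Srt.cnt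

variable {𝕄 : Type w}

/-- tuples as a sort -/
def Tup (𝕄 : Type w) (α : Type) : Type w := α → 𝕄

instance (α : Type) [Countable α] : Srt 𝕄 (Tup 𝕄 α) := ⟨α, inferInstance, Equiv.refl _⟩

/-- the trivial sort -/
abbrev Un (𝕄 : Type w) := Tup 𝕄 Empty

/-- the element of the trivial sort -/
def un : Un 𝕄 := fun e => e.elim

theorem un_eq (x y : Un 𝕄) : x = y := funext fun e => e.elim

instance instSrtProd {X Y : Type w} [Srt 𝕄 X] [Srt 𝕄 Y] : Srt 𝕄 (X × Y) :=
  ⟨Srt.idx X ⊕ Srt.idx Y, inferInstance,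
    ((Srt.eqv (X := X)).prodCongr (Srt.eqv (X := Y))).trans (Equiv.sumArrowEquivProdArrow _ _ _).symm⟩

instance instSrtPi {ι : Type} [Countable ι] {X : Type w} [Srt 𝕄 X] : Srt 𝕄 (ι → X) :=
  ⟨ι × Srt.idx X, inferInstance,
    (Equiv.arrowCongr (Equiv.refl ι) (Srt.eqv (X := X))).trans (Equiv.curry _ _ _).symm⟩

section basic
variable {X Y Z A B : Type w} [Srt 𝕄 X] [Srt 𝕄 Y] [Srt 𝕄 Z] [Srt 𝕄 A] [Srt 𝕄 B]

theorem eqv_pair_inl (x : X) (y : Y) (i) : Srt.eqv (x, y) (Sum.inl i) = Srt.eqv x i := rfl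
theorem eqv_pair_inr (x : X) (y : Y) (i) : Srt.eqv (x, y) (Sum.inr i) = Srt.eqv y i := rfl
theorem eqv_pair (x : X) (y : Y) : Srt.eqv (x, y) = Sum.elim (Srt.eqv x) (Srt.eqv y) := by
  funext i; cases i <;> rfl
theorem eqv_pi {ι : Type} [Countable ι] (x : ι → X) (i j) : Srt.eqv x (i, j) = Srt.eqv (x i) j := rfl

/-- coordinate maps -/
@[fun_prop]
def Co (f : X → Y) : Prop := ∃ r : Srt.idx Y → Srt.idx X, ∀ x j, Srt.eqv (f x) j = Srt.eqv x (r j)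

@[fun_prop] theorem Co.id : Co (fun x : X => x) := ⟨fun j => j, fun _ _ => rfl⟩
@[fun_prop] theorem Co.comp {g : Y → Z} {f : X → Y} (hg : Co g) (hf : Co f) :
    Co (fun x => g (f x)) := by
  obtain ⟨r, hr⟩ := hg; obtain ⟨s, hs⟩ := hf
  exact ⟨fun j => s (r j), fun x j => by rw [hr, hs]⟩
@[fun_prop] theorem Co.unit (c : Un 𝕄) : Co (fun _ : X => c) :=
  ⟨fun j => (j : Empty).elim, fun _ j => (j : Empty).elim⟩
@[fun_prop] theorem Co.fst' : Co (fun q : X × Y => q.1) := ⟨Sum.inl, fun _ _ => rfl⟩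
@[fun_prop] theorem Co.snd' : Co (fun q : X × Y => q.2) := ⟨Sum.inr, fun _ _ => rfl⟩
@[fun_prop] theorem Co.fst {f : Z → X × Y} (hf : Co f) : Co (fun q => (f q).1) := Co.comp Co.fst' hf
@[fun_prop] theorem Co.snd {f : Z → X × Y} (hf : Co f) : Co (fun q => (f q).2) := Co.comp Co.snd' hf
@[fun_prop] theorem Co.mk {f : Z → X} {g : Z → Y} (hf : Co f) (hg : Co g) :
    Co (fun q => (f q, g q)) := by
  obtain ⟨r, hr⟩ := hf; obtain ⟨s, hs⟩ := hg
  refine ⟨Sum.elim r s, fun x j => ?_⟩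
  cases j with
  | inl j => exact hr x j
  | inr j => exact hs x j
@[fun_prop] theorem Co.eval {ι : Type} [Countable ι] (i : ι) : Co (fun q : ι → X => q i) :=
  ⟨fun j => (i, j), fun _ _ => rfl⟩
@[fun_prop] theorem Co.pi {ι : Type} [Countable ι] {f : Z → ι → X} (hf : ∀ i, Co (fun z => f z i)) :
    Co f := by
  choose r hr using hf
  exact ⟨fun j => r j.1 j.2, fun x j => hr j.1 x j.2⟩

variable [DSys 𝕄]

/-- definable predicates -/
def Def (P : X → Prop) : Prop := DSys.D {v : Srt.idx X → 𝕄 | P (Srt.eqv.symm v)}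

theorem Def.congr {P Q : X → Prop} (h : Def P) (e : ∀ x, P x ↔ Q x) : Def Q := by
  have : P = Q := funext fun x => propext (e x)
  exact this ▸ h

theorem Def.not {P : X → Prop} (h : Def P) : Def (fun x => ¬ P x) := DSys.compl h
theorem Def.and {P Q : X → Prop} (h : Def P) (h' : Def Q) : Def (fun x => P x ∧ Q x) := DSys.inter h h'
theorem Def.true : Def (fun _ : X => True) := DSys.univ
theorem Def.false : Def (fun _ : X => False) := (Def.true.not).congr (by simp)
theorem Def.or {P Q : X → Prop} (h : Def P) (h' : Def Q) : Def (fun x => P x ∨ Q x) :=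
  ((h.not.and h'.not).not).congr fun x => by tauto
theorem Def.imp {P Q : X → Prop} (h : Def P) (h' : Def Q) : Def (fun x => P x → Q x) :=
  ((h.and h'.not).not).congr fun x => by tauto
theorem Def.iff {P Q : X → Prop} (h : Def P) (h' : Def Q) : Def (fun x => P x ↔ Q x) :=
  ((h.imp h').and (h'.imp h)).congr fun x => by tauto
theorem Def.comp {P : Y → Prop} (h : Def P) {f : X → Y} (hf : Co f) : Def (fun x => P (f x)) := by
  obtain ⟨r, hr⟩ := hf
  have := DSys.pre r h
  unfold Def
  convert this using 3 with v
  change P _ ↔ P _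
  have : f (Srt.eqv.symm v) = Srt.eqv.symm (v ∘ r) := by
    apply Srt.eqv.injective
    funext j
    rw [hr]; simp
  rw [this]
theorem Def.ex {P : X × Y → Prop} (h : Def P) : Def (fun x => ∃ y, P (x, y)) := by
  have := DSys.proj (𝕄 := 𝕄) (α := Srt.idx X) (β := Srt.idx Y) h
  unfold Def
  convert this using 3 with v
  constructor
  · rintro ⟨y, hy⟩
    refine ⟨Srt.eqv y, ?_⟩
    change P _
    convert hy using 1
    apply Srt.eqv.injective
    simp [eqv_pair]
  · rintro ⟨y, hy⟩
    refine ⟨Srt.eqv.symm y, ?_⟩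
    change P _ at hy
    convert hy using 1
    apply Srt.eqv.injective
    simp [eqv_pair]
theorem Def.ball {ι : Type r} (s : Finset ι) {P : ι → X → Prop} (h : ∀ i ∈ s, Def (P i)) :
    Def (fun x => ∀ i ∈ s, P i x) := by
  classical
  induction s using Finset.induction_on with
  | empty => simpa using Def.true
  | insert a s ha ih =>
    refine ((h a (by simp)).and (ih fun i hi => h i (by simp [hi]))).congr fun x => by simp
theorem Def.all {ι : Type r} [Finite ι] {P : ι → X → Prop} (h : ∀ i, Def (P i)) :
    Def (fun x => ∀ i, P i x) := by
  cases nonempty_fintype ι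
  refine (Def.ball Finset.univ (P := P) fun i _ => h i).congr fun x => by simp
theorem Def.const (p : Prop) : Def (fun _ : X => p) := by
  by_cases h : p
  · exact Def.true.congr (by simp [h])
  · exact Def.false.congr (by simp [h])

/-- M-points -/
def MP (x : X) : Prop := ∀ j, Srt.eqv x j ∈ DSys.M (𝕄 := 𝕄)

theorem MP.pair {x : X} {y : Y} (hx : MP x) (hy : MP y) : MP (x, y) := by
  rintro (j | j)
  · exact hx j
  · exact hy j

theorem Def.subst {P : X × Y → Prop} (h : Def P) {m : X} (hm : MP m) : Def (fun y => P (m, y)) := by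
  have := DSys.subst (𝕄 := 𝕄) (α := Srt.idx X) (β := Srt.idx Y) (Srt.eqv m) hm h
  unfold Def
  convert this using 3 with v
  change P _ ↔ P _
  have : (m, Srt.eqv.symm v) = Srt.eqv.symm (Sum.elim (Srt.eqv m) v) := by
    apply Srt.eqv.injective
    simp [eqv_pair]
  rw [this]

theorem Def.model {P : X → Prop} (h : Def P) (hne : ∃ x, P x) : ∃ m, MP m ∧ P m := by
  obtain ⟨x, hx⟩ := hne
  obtain ⟨m, hm, hm'⟩ := DSys.model (𝕄 := 𝕄) h ⟨Srt.eqv x, by simpa using hx⟩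
  exact ⟨Srt.eqv.symm m, fun j => by simpa using hm' j, hm⟩

/-- finite support in a sequence sort -/
theorem Def.fs {P : X → Prop} (h : Def P) : ∃ F : Finset (Srt.idx X), ∀ x y : X,
    (∀ i ∈ F, Srt.eqv x i = Srt.eqv y i) → P x → P y := by
  obtain ⟨F, hF⟩ := DSys.fs (𝕄 := 𝕄) h
  exact ⟨F, fun x y hxy hP => by
    have := hF (Srt.eqv x) (Srt.eqv y) hxy (by simpa using hP)
    simpa using this⟩

theorem satX {ι : Type r} (P : ι → X × Y → Prop) (hP : ∀ i, Def (P i)) (y : Y)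
    (hfin : ∀ s : Finset ι, ∃ x, ∀ i ∈ s, P i (x, y)) : ∃ x, ∀ i, P i (x, y) := by
  classical
  let S : ι → Set (Srt.idx X ⊕ Srt.idx Y → 𝕄) := fun i => {v | P i (Srt.eqv.symm v)}
  have key : ∀ (i : ι) (x : X), P i (x, y) ↔ Sum.elim (Srt.eqv x) (Srt.eqv y) ∈ S i := by
    intro i x
    change P i (x, y) ↔ P i _
    rw [← eqv_pair]
    rw [show Srt.eqv.symm (Srt.eqv (x, y)) = (x, y) from Equiv.symm_apply_apply _ _]
  obtain ⟨v, hv⟩ := DSys.sat (𝕄 := 𝕄) (α := Srt.idx X) (β := Srt.idx Y) (Srt.eqv y) (Set.range S)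
    (by rintro _ ⟨i, rfl⟩; exact hP i) (by
      intro G hG
      choose f hf using hG
      obtain ⟨x, hx⟩ := hfin (G.attach.image fun T : G => f T.1 T.2)
      refine ⟨Srt.eqv x, fun T hT => ?_⟩
      rw [← hf T hT, ← key]
      exact hx _ (Finset.mem_image_of_mem (fun T : G => f T.1 T.2) (Finset.mem_attach G ⟨T, hT⟩)))
  refine ⟨Srt.eqv.symm v, fun i => ?_⟩
  rw [key]
  simpa using hv (S i) ⟨i, rfl⟩

theorem sat0 {ι : Type r} (P : ι → X → Prop) (hP : ∀ i, Def (P i))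
    (hfin : ∀ s : Finset ι, ∃ x, ∀ i ∈ s, P i x) : ∃ x, ∀ i, P i x :=
  satX (Y := Un 𝕄) (fun i q => P i q.1) (fun i => (hP i).comp (by fun_prop)) un hfin

/-- equality of types over M -/
def E (x x' : X) : Prop := ∀ P : X → Prop, Def P → P x → P x'

theorem E.refl (x : X) : E x x := fun _ _ h => h
theorem E.symm {x y : X} (h : E x y) : E y x := fun P hP hy => by
  by_contra hx
  exact h _ hP.not hx hy
theorem E.trans {x y z : X} (h : E x y) (h' : E y z) : E x z := fun P hP hx => h' P hP (h P hP hx)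
theorem E.map {x y : X} (h : E x y) {f : X → Y} (hf : Co f) : E (f x) (f y) :=
  fun _ hP hx => h _ (hP.comp hf) hx
theorem E.iff {x y : X} (h : E x y) {P : X → Prop} (hP : Def P) : P x ↔ P y :=
  ⟨h P hP, h.symm P hP⟩

theorem E.eq_of {z z' : Z} (h : E z z') {f g : Z → X} (hf : Co f) (hg : Co g) (e : f z = g z) :
    f z' = g z' := by
  obtain ⟨r, hr⟩ := hf
  obtain ⟨s, hs⟩ := hg
  apply Srt.eqv.injective
  funext j
  rw [hr, hs]
  have hd : Def (fun z : Z => Srt.eqv z (r j) = Srt.eqv z (s j)) := by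
    unfold Def
    simpa using DSys.diag (𝕄 := 𝕄) (r j) (s j)
  refine h _ hd ?_
  rw [← hr, ← hs, e]

theorem homog {x x' : X} (h : E x x') (y : Y) : ∃ y', E (x, y) (x', y') := by
  classical
  obtain ⟨y', hy'⟩ := satX (X := Y) (Y := X) (ι := {P : X × Y → Prop // Def P ∧ P (x, y)})
    (fun P q => P.1 (q.2, q.1)) (fun P => P.2.1.comp (by fun_prop)) x' (by
      intro s
      have hd : Def (fun q : X × Y => ∀ P ∈ s, P.1 q) := Def.ball s fun P _ => P.2.1
      obtain ⟨y', hy'⟩ := h _ hd.ex ⟨y, fun P _ => P.2.2⟩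
      exact ⟨y', fun P hP => hy' P hP⟩)
  exact ⟨y', fun P hP hx => hy' ⟨P, hP, hx⟩⟩

theorem homog' {x x' : X} (h : E x x') (y : Y) : ∃ y', E (y, x) (y', x') := by
  obtain ⟨y', hy⟩ := homog h y
  exact ⟨y', hy.map (f := fun q => (q.2, q.1)) (by fun_prop)⟩

/-- equality of types of sequences is determined by finite parts -/
theorem E.of_fin {x x' : ℕ → X} {y y' : Y}
    (h : ∀ n, E ((fun j : Fin n => x j), y) ((fun j : Fin n => x' j), y')) :
    E (x, y) (x', y') := by
  classical
  intro P hP hx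
  obtain ⟨F, hF⟩ := hP.fs
  let bd : Srt.idx (ℕ → X) ⊕ Srt.idx Y → ℕ := Sum.elim (fun q => q.1 + 1) (fun _ => 0)
  let N := F.sup bd + 1
  have hN : 0 < N := Nat.succ_pos _
  let g : (Fin N → X) × Y → (ℕ → X) × Y := fun q => (fun j => q.1 ⟨j % N, Nat.mod_lt _ hN⟩, q.2)
  have hg : Co g := by fun_prop
  have hb : ∀ (j : ℕ) (i), (Sum.inl (j, i) : Srt.idx (ℕ → X) ⊕ Srt.idx Y) ∈ F → j % N = j := by
    intro j i hi
    apply Nat.mod_eq_of_lt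
    have h1 : j + 1 ≤ F.sup bd := Finset.le_sup (f := bd) hi
    omega
  have key := (h N) _ (hP.comp hg)
  have h1 : P (g ((fun j : Fin N => x j), y)) := by
    refine hF _ _ ?_ hx
    rintro (⟨j, i⟩ | i) hi
    · change Srt.eqv (x j) i = Srt.eqv (x (j % N)) i
      rw [hb j i hi]
    · rfl
  refine hF _ _ ?_ (key h1)
  rintro (⟨j, i⟩ | i) hi
  · change Srt.eqv (x' (j % N)) i = Srt.eqv (x' j) i
    rw [hb j i hi]
  · rfl

end basic
end Abs

namespace Abs
open Filter

variable {𝕄 : Type w} [DSys 𝕄]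

/-- Invariant types, as a stationary realization relation `R x y`: x realizes q|My. -/
structure IT (X : Type w) [Srt 𝕄 X] where
  R : ∀ {Y : Type w} [Srt 𝕄 Y], X → Y → Prop
  ex : ∀ {Y : Type w} [Srt 𝕄 Y] (y : Y), ∃ x, R x y
  uniq : ∀ {Y : Type w} [Srt 𝕄 Y] {x x' : X} {y y' : Y}, R x y → R x' y' → E y y' → E (x, y) (x', y')
  closed : ∀ {Y : Type w} [Srt 𝕄 Y] {x x' : X} {y y' : Y}, R x y → E (x, y) (x', y') → R x' y'
  mono : ∀ {Y Z : Type w} [Srt 𝕄 Y] [Srt 𝕄 Z] {x : X} {y : Y} {f : Y → Z}, R x y → Co f → R x (f y)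

section seq
/-- strong recursion for sequences -/
noncomputable def seqRec {X : Type w} (f : ∀ i : ℕ, (Fin i → X) → X) : ℕ → X
  | n => f n (fun j => seqRec f j.1)
  termination_by n => n
  decreasing_by exact j.2

theorem exists_seq {X : Type w} (Q : ∀ i : ℕ, (Fin i → X) → X → Prop) (h : ∀ i v, ∃ x, Q i v x) :
    ∃ u : ℕ → X, ∀ i, Q i (fun j => u j) (u i) := by
  choose f hf using h
  refine ⟨seqRec f, fun i => ?_⟩
  rw [seqRec]
  exact hf _ _
end seq

section IT
variable {X Y Z A B : Type w} [Srt 𝕄 X] [Srt 𝕄 Y] [Srt 𝕄 Z] [Srt 𝕄 A] [Srt 𝕄 B]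

/-- q extends tp(b/M) -/
def IT.Ext (p : IT X) (b : X) : Prop := p.R b (un : Un 𝕄)

theorem IT.R.ext {p : IT X} {x : X} {y : Y} (h : p.R x y) : p.Ext x := p.mono h (f := fun _ => un) (by fun_prop)

theorem IT.Ext.E {p : IT X} {x x' : X} (h : p.Ext x) (h' : p.Ext x') : E x x' :=
  (p.uniq h h' (E.refl _)).map (f := fun q => q.1) (by fun_prop)

theorem IT.Ext.of_E {p : IT X} {x x' : X} (h : p.Ext x) (h' : Abs.E x x') : p.Ext x' :=
  p.closed h (h'.map (f := fun q => (q, un)) (by fun_prop))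

/-- Morley sequence over `y` -/
def Mor (p : IT X) (y : Y) (u : ℕ → X) : Prop := ∀ i : ℕ, p.R (u i) ((fun j : Fin i => u j), y)

/-- finite Morley sequence over `y` -/
def MorF (p : IT X) (y : Y) {n : ℕ} (u : Fin n → X) : Prop :=
  ∀ i : Fin n, p.R (u i) ((fun j : Fin i => u ⟨j, j.2.trans i.2⟩), y)

theorem Mor.fin {p : IT X} {y : Y} {u : ℕ → X} (h : Mor p y u) (n : ℕ) :
    MorF p y (fun j : Fin n => u j) := fun i => h i

theorem MorF.uniq {p : IT X} {n : ℕ} {y y' : Y} {u u' : Fin n → X} (h : MorF p y u)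
    (h' : MorF p y' u') (e : E y y') : E (u, y) (u', y') := by
  induction n with
  | zero =>
    have hu : u' = u := funext fun i => i.elim0
    subst hu
    exact e.map (f := fun q => (u', q)) (Co.mk (Co.pi fun i => i.elim0) Co.id)
  | succ n ih =>
    have := ih (u := fun j => u j.castSucc) (u' := fun j => u' j.castSucc)
      (fun i => h i.castSucc) (fun i => h' i.castSucc)
    have key := p.uniq (h (Fin.last n)) (h' (Fin.last n)) this
    have hco : Co (fun q : X × (Fin n → X) × Y =>
        ((fun i : Fin (n+1) => if hi : i.1 < n then q.2.1 ⟨i, hi⟩ else q.1), q.2.2)) := by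
      refine Co.mk (Co.pi fun i => ?_) (by fun_prop)
      by_cases hi : i.1 < n
      · simp only [hi, dite_true]; fun_prop
      · simp only [hi, dite_false]; fun_prop
    have key2 := key.map hco
    have e1 : ∀ v : Fin (n+1) → X, (fun i : Fin (n+1) => if hi : i.1 < n then v (Fin.castSucc ⟨i, hi⟩) else v (Fin.last n)) = v := by
      intro v; funext i
      split_ifs with hi
      · rfl
      · congr 1; ext; simp; omega
    convert key2 using 2
    · exact (e1 u).symm
    · exact (e1 u').symm

theorem Mor.uniq {p : IT X} {y y' : Y} {u u' : ℕ → X} (h : Mor p y u) (h' : Mor p y' u') (e : E y y') :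
    E (u, y) (u', y') := E.of_fin fun n => (h.fin n).uniq (h'.fin n) e

theorem Mor.closed {p : IT X} {y y' : Y} {u u' : ℕ → X} (h : Mor p y u) (e : E (u, y) (u', y')) :
    Mor p y' u' := fun i =>
  p.closed (h i) (e.map (f := fun q : (ℕ → X) × Y => (q.1 i, (fun j : Fin i => q.1 j), q.2)) (by fun_prop))

theorem MorF.closed {p : IT X} {n : ℕ} {y y' : Y} {u u' : Fin n → X} (h : MorF p y u)
    (e : E (u, y) (u', y')) : MorF p y' u' := fun i =>
  p.closed (h i) (e.map (f := fun q : (Fin n → X) × Y =>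
    (q.1 i, (fun j : Fin i => q.1 ⟨j, j.2.trans i.2⟩), q.2)) (by fun_prop))

theorem Mor.mono {p : IT X} {y : Y} {u : ℕ → X} (h : Mor p y u) {f : Y → Z} (hf : Co f) :
    Mor p (f y) u := fun i => p.mono (h i) (f := fun q => (q.1, f q.2)) (by fun_prop)

theorem Mor.exists (p : IT X) (y : Y) : ∃ u, Mor p y u :=
  exists_seq (fun _ v x => p.R x (v, y)) fun _ v => p.ex (v, y)

theorem Mor.sub {p : IT X} {y : Y} {u : ℕ → X} (h : Mor p y u) {f : ℕ → ℕ} (hf : StrictMono f) :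
    Mor p y (fun i => u (f i)) := fun i =>
  p.mono (h (f i)) (f := fun q : (Fin (f i) → X) × Y => ((fun j : Fin i => q.1 ⟨f j, hf j.2⟩), q.2))
    (by fun_prop)

theorem Mor.ext {p : IT X} {y : Y} {u : ℕ → X} (h : Mor p y u) (i : ℕ) : p.Ext (u i) := (h i).ext

theorem Mor.extE {p : IT X} {y : Y} {u : ℕ → X} (h : Mor p y u) (i : ℕ) {b : X} (hb : p.Ext b) :
    E (u i) b := (h.ext i).E hb

theorem Mor.E {p : IT X} {u u' : ℕ → X} (h : Mor p (un : Un 𝕄) u) (h' : Mor p (un : Un 𝕄) u') : E u u' :=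
  (h.uniq h' (E.refl _)).map (f := fun q => q.1) (by fun_prop)

/-- infinite power -/
def IT.pw (p : IT X) : IT (ℕ → X) where
  R u y := Mor p y u
  ex y := Mor.exists p y
  uniq h h' e := h.uniq h' e
  closed h e := h.closed e
  mono h hf := h.mono hf

/-- tensor product -/
def IT.tensor (p : IT X) (q : IT Y) : IT (X × Y) where
  R a z := p.R a.1 (a.2, z) ∧ q.R a.2 z
  ex z := by
    obtain ⟨y, hy⟩ := q.ex z
    obtain ⟨x, hx⟩ := p.ex (y, z)
    exact ⟨(x, y), hx, hy⟩
  uniq h h' e := by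
    have := p.uniq h.1 h'.1 (q.uniq h.2 h'.2 e)
    exact this.map (f := fun q => ((q.1, q.2.1), q.2.2)) (by fun_prop)
  closed h e := ⟨p.closed h.1 (e.map (f := fun q => (q.1.1, q.1.2, q.2)) (by fun_prop)),
    q.closed h.2 (e.map (f := fun q => (q.1.2, q.2)) (by fun_prop))⟩
  mono := by
    intro _ _ _ _ x y f h hf
    exact ⟨p.mono h.1 (f := fun q => (q.1, f q.2)) (by fun_prop), q.mono h.2 hf⟩

/-- pushforward along a coordinate map -/
def IT.map (p : IT X) (g : X → Y) (hg : Co g) : IT Y where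
  R y z := ∃ x, E (g x, z) (y, z) ∧ p.R x z
  ex z := by
    obtain ⟨x, hx⟩ := p.ex z
    exact ⟨g x, x, E.refl _, hx⟩
  uniq := by
    rintro W _ y y' z z' ⟨x, hx, hx'⟩ ⟨v, hv, hv'⟩ e
    have := (p.uniq hx' hv' e).map (f := fun q => (g q.1, q.2)) (by fun_prop)
    exact hx.symm.trans (this.trans hv)
  closed := by
    rintro W _ y y' z z' ⟨x, hx, hx'⟩ e
    have e' : E z z' := e.map (f := fun q => q.2) (by fun_prop)
    obtain ⟨v, hv⟩ := homog' e' x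
    refine ⟨v, ?_, p.closed hx' hv⟩
    have := hv.map (f := fun q => (g q.1, q.2)) (by fun_prop)
    exact this.symm.trans (hx.trans e)
  mono := by
    rintro W V _ _ y z f ⟨x, hx, hx'⟩ hf
    exact ⟨x, hx.map (f := fun q => (q.1, f q.2)) (by fun_prop), p.mono hx' hf⟩

theorem IT.R.map {p : IT X} {x : X} {z : Z} (h : p.R x z) {g : X → Y} (hg : Co g) :
    (p.map g hg).R (g x) z := ⟨x, E.refl _, h⟩

theorem Mor.map {p : IT X} {z : Z} {u : ℕ → X} (h : Mor p z u) {g : X → Y} (hg : Co g) :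
    Mor (p.map g hg) z (fun i => g (u i)) := fun i =>
  IT.mono _ ((h i).map hg) (f := fun q : (Fin i → X) × Z => ((fun j : Fin i => g (q.1 j)), q.2)) (by fun_prop)

/-- Independence of `a` from `b` with respect to `p`. -/
def Ind (p : IT X) (a : A) (b : X) : Prop :=
  p.Ext b ∧ ∀ u, Mor p (un : Un 𝕄) u → ∃ a', ∀ i, E (a', u i) (a, b)

theorem Ind.of_ex {p : IT X} {a : A} {b : X} {u : ℕ → X} (hu : Mor p (un : Un 𝕄) u)
    {a' : A} (h : ∀ i, E (a', u i) (a, b)) : Ind p a b := by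
  refine ⟨(hu.ext 0).of_E ((h 0).map (f := fun q => q.2) (by fun_prop)), fun v hv => ?_⟩
  obtain ⟨a'', h'⟩ := homog' (hu.E hv) a'
  exact ⟨a'', fun i => ((h'.map (f := fun q : A × (ℕ → X) => (q.1, q.2 i)) (by fun_prop)).symm).trans (h i)⟩

theorem Ind.E {p : IT X} {a a' : A} {b b' : X} (h : Ind p a b) (e : E (a, b) (a', b')) : Ind p a' b' :=
  ⟨h.1.of_E (e.map (f := fun q => q.2) (by fun_prop)), fun u hu => by
    obtain ⟨v, hv⟩ := h.2 u hu
    exact ⟨v, fun i => (hv i).trans e⟩⟩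

theorem Ind.mapl {p : IT X} {a : A} {b : X} (h : Ind p a b) {g : A → B} (hg : Co g) : Ind p (g a) b :=
  ⟨h.1, fun u hu => by
    obtain ⟨v, hv⟩ := h.2 u hu
    exact ⟨g v, fun i => (hv i).map (f := fun q => (g q.1, q.2)) (by fun_prop)⟩⟩

theorem Ind.mapr {p : IT X} {a : A} {b : X} (h : Ind p a b) {g : X → Y} (hg : Co g) :
    Ind (p.map g hg) a (g b) := by
  obtain ⟨u, hu⟩ := Mor.exists p (un : Un 𝕄)
  obtain ⟨v, hv⟩ := h.2 u hu
  exact Ind.of_ex (hu.map hg) fun i => (hv i).map (f := fun q => (q.1, g q.2)) (by fun_prop)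

/-- A formula dividing along `p`. -/
def Dv (p : IT X) (P : A × X → Prop) : Prop :=
  ∀ u, Mor p (un : Un 𝕄) u → ¬ ∃ a, ∀ i, P (a, u i)

theorem Dv.not {p : IT X} {P : A × X → Prop} (hP : Def P) (h : ¬ Dv p P) {u : ℕ → X}
    (hu : Mor p (un : Un 𝕄) u) : ∃ a, ∀ i, P (a, u i) := by
  unfold Dv at h
  push Not at h
  obtain ⟨v, hv, a, ha⟩ := h
  obtain ⟨a', h'⟩ := homog' (hv.E hu) a
  exact ⟨a', fun i => h'.map (f := fun q : A × (ℕ → X) => (q.1, q.2 i)) (by fun_prop) _ hP (ha i)⟩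

/-- `Ind` from absence of dividing formulas. -/
theorem Ind.of_not_Dv {p : IT X} {a : A} {b : X} (hb : p.Ext b)
    (h : ∀ P, Def P → P (a, b) → ¬ Dv p P) : Ind p a b := by
  classical
  obtain ⟨u, hu⟩ := Mor.exists p (un : Un 𝕄)
  obtain ⟨a', ha'⟩ := satX (X := A) (Y := ℕ → X) (ι := {P : A × X → Prop // Def P ∧ P (a, b)} × ℕ)
    (fun P q => P.1.1 (q.1, q.2 P.2)) (fun P => P.1.2.1.comp (f := fun q : A × (ℕ → X) => (q.1, q.2 P.2)) (by fun_prop)) u (by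
      intro s
      obtain ⟨a', ha'⟩ := Dv.not (P := fun q => ∀ P ∈ s, P.1.1 q) (Def.ball s fun P _ => P.1.2.1)
        (h _ (Def.ball s fun P _ => P.1.2.1) fun P _ => P.1.2.2) hu
      exact ⟨a', fun P hP => ha' P.2 P hP⟩)
  refine Ind.of_ex hu (a' := a') fun i => E.symm fun P hP h => ha' (⟨P, hP, h⟩, i)

theorem Ind.not_Dv {p : IT X} {a : A} {b : X} (h : Ind p a b) {P : A × X → Prop} (hP : Def P)
    (hab : P (a, b)) : ¬ Dv p P := fun hd => by
  obtain ⟨u, hu⟩ := Mor.exists p (un : Un 𝕄)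
  obtain ⟨a', ha'⟩ := h.2 u hu
  exact hd u hu ⟨a', fun i => (ha' i).symm P hP hab⟩

theorem exists_Dv {p : IT X} {a : A} {b : X} (hb : p.Ext b) (h : ¬ Ind p a b) :
    ∃ P : A × X → Prop, Def P ∧ P (a, b) ∧ Dv p P := by
  by_contra hc
  push Not at hc
  exact h (Ind.of_not_Dv hb hc)

/-- dividing is witnessed by a finite number -/
theorem Dv.fin {p : IT X} {P : A × X → Prop} (hP : Def P) (h : Dv p P) :
    ∃ k, ∀ u, Mor p (un : Un 𝕄) u → ¬ ∃ a, ∀ i < k, P (a, u i) := by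
  by_contra hc
  push Not at hc
  obtain ⟨u, hu⟩ := Mor.exists p (un : Un 𝕄)
  have key : ∀ k, ∃ a, ∀ i < k, P (a, u i) := by
    intro k
    obtain ⟨v, hv, a, ha⟩ := hc k
    obtain ⟨a', h'⟩ := homog' (hv.E hu) a
    exact ⟨a', fun i hi => h'.map (f := fun q : A × (ℕ → X) => (q.1, q.2 i)) (by fun_prop) _ hP (ha i hi)⟩
  obtain ⟨a, ha⟩ := satX (X := A) (Y := ℕ → X) (ι := ℕ) (fun i q => P (q.1, q.2 i))
    (fun i => hP.comp (f := fun q : A × (ℕ → X) => (q.1, q.2 i)) (by fun_prop)) u (by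
      intro s
      obtain ⟨a, ha⟩ := key (s.sup (fun i => i + 1))
      exact ⟨a, fun i hi => ha i (Finset.le_sup (f := fun i => i + 1) hi)⟩)
  exact h u hu ⟨a, ha⟩

/-- core extension lemma -/
theorem core {s : IT X} {w : ℕ → X} (hw : Mor s (un : Un 𝕄) w) {b : X} (hb : s.Ext b) (a0 : A) :
    ∃ a, Ind s a b ∧ ∀ P : A × X → Prop, Def P → (∀ i, P (a0, w i)) → P (a, b) := by
  classical
  let U : Ultrafilter ℕ := hyperfilter ℕ
  obtain ⟨a, ha⟩ := satX (X := A) (Y := X) (ι := {P : A × X → Prop // Def P ∧ ∀ᶠ i in U, P (a0, w i)})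
    (fun P => P.1) (fun P => P.2.1) b (by
      intro t
      have : ∀ᶠ i in (U : Filter ℕ), ∀ P ∈ t, P.1 (a0, w i) := by
        rw [Filter.eventually_all_finset]
        exact fun P _ => P.2.2
      obtain ⟨i, hi⟩ := this.exists
      obtain ⟨a, ha⟩ := homog' (hw.extE i hb) a0
      exact ⟨a, fun P hP => ha _ P.2.1 (hi P hP)⟩)
  refine ⟨a, Ind.of_not_Dv hb fun P hP hab hd => ?_, fun P hP h => ha ⟨P, hP, .of_forall h⟩⟩
  have hev : ∀ᶠ i in (U : Filter ℕ), P (a0, w i) := by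
    by_contra hc
    have : ∀ᶠ i in (U : Filter ℕ), ¬ P (a0, w i) := Ultrafilter.eventually_not.2 hc
    exact ha ⟨fun q => ¬ P q, hP.not, this⟩ hab
  have hfr : ∃ᶠ i in atTop, P (a0, w i) := by
    rw [← Nat.cofinite_eq_atTop]
    exact hev.frequently.filter_mono (hyperfilter_le_cofinite)
  obtain ⟨f, hf, hf'⟩ := extraction_of_frequently_atTop hfr
  exact hd _ (hw.sub hf) ⟨a0, hf'⟩

/-- chain lemma -/
theorem chain {r : IT X} {a : A} {g : X} (h : Ind r a g) {u : ℕ → X} (hu : Mor r (un : Un 𝕄) u) :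
    ∃ a', Ind r.pw a' u ∧ ∀ i, E (a', u i) (a, g) := by
  classical
  obtain ⟨U, hU⟩ := Mor.exists r.pw (un : Un 𝕄)
  have hblock : ∀ N, 0 < N → Mor r (un : Un 𝕄) (fun m => U (m / N) (m % N)) := by
    intro N hN m
    have h1 := hU (m / N) (m % N)
    have hdm : ∀ j : Fin m, ¬ j.1 / N < m / N → j.1 / N = m / N ∧ j.1 % N < m % N := by
      intro j hj
      have h5 : j.1 / N = m / N := le_antisymm (Nat.div_le_div_right j.2.le) (not_lt.1 hj)
      refine ⟨h5, ?_⟩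
      have h3 := Nat.div_add_mod j.1 N
      have h4 := Nat.div_add_mod m N
      have := j.2
      rw [h5] at h3
      omega
    have hco : Co (fun q : (Fin (m % N) → X) × (Fin (m / N) → ℕ → X) × Un 𝕄 =>
        ((fun j : Fin m => if hj : j.1 / N < m / N then q.2.1 ⟨j.1 / N, hj⟩ (j.1 % N) else
          q.1 ⟨j.1 % N, (hdm j hj).2⟩), q.2.2)) := by
      refine Co.mk (Co.pi fun j => ?_) (by fun_prop)
      by_cases hj : j.1 / N < m / N
      · simp only [hj, dite_true]; fun_prop
      · simp only [hj, dite_false]; fun_prop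
    have h2 := r.mono h1 hco
    convert h2 using 2
    funext j
    dsimp only
    by_cases hj : j.1 / N < m / N
    · simp only [hj, dite_true]
    · simp only [hj, dite_false]
      rw [(hdm j hj).1]
  have hcons : ∃ a0 : A, ∀ k i, E (a0, U k i) (a, g) := by
    obtain ⟨a', ha'⟩ := satX (X := A) (Y := ℕ → ℕ → X)
      (ι := {P : A × X → Prop // Def P ∧ P (a, g)} × ℕ × ℕ)
      (fun P q => P.1.1 (q.1, q.2 P.2.1 P.2.2))
      (fun P => P.1.2.1.comp (f := fun q : A × (ℕ → ℕ → X) => (q.1, q.2 P.2.1 P.2.2)) (by fun_prop)) U (by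
        intro s
        let N := s.sup (fun P => P.2.2) + 1
        obtain ⟨a', ha'⟩ := h.2 _ (hblock N (Nat.succ_pos _))
        refine ⟨a', fun P hP => ?_⟩
        have hlt : P.2.2 < N := Nat.lt_succ_of_le (Finset.le_sup (f := fun P => P.2.2) hP)
        have := (ha' (P.2.2 + N * P.2.1)).symm P.1.1 P.1.2.1 P.1.2.2
        rwa [Nat.add_mul_div_left _ _ (Nat.succ_pos _), Nat.add_mul_mod_self_left, Nat.div_eq_of_lt hlt,
          Nat.mod_eq_of_lt hlt, Nat.zero_add] at this)
    exact ⟨a', fun k i => E.symm fun P hP h => ha' (⟨P, hP, h⟩, k, i)⟩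
  obtain ⟨a0, ha0⟩ := hcons
  obtain ⟨a', ha', ha''⟩ := core hU (b := u) hu a0
  refine ⟨a', ha', fun i => E.symm fun P hP h => ?_⟩
  exact ha'' (fun q => P (q.1, q.2 i)) (hP.comp (f := fun q : A × (ℕ → X) => (q.1, q.2 i)) (by fun_prop))
    fun k => (ha0 k i).symm P hP h

/-- join lemma -/
theorem join {p : IT X} {a : X} {b : A} {c : B} (hb : Ind p b a) (hc : Ind p c a) :
    ∃ b' c', E (b', a) (b, a) ∧ E (c', a) (c, a) ∧ Ind p (b', c') a := by
  obtain ⟨u, hu⟩ := Mor.exists p (un : Un 𝕄)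
  obtain ⟨b0, hb0⟩ := hb.2 u hu
  obtain ⟨c0, hc0⟩ := hc.2 u hu
  obtain ⟨⟨b', c'⟩, h, h'⟩ := core hu hb.1 (b0, c0)
  refine ⟨b', c', E.symm fun P hP hx => ?_, E.symm fun P hP hx => ?_, h⟩
  · exact h' (fun q => P (q.1.1, q.2)) (hP.comp (f := fun q : (A × B) × X => (q.1.1, q.2)) (by fun_prop))
      fun i => (hb0 i).symm P hP hx
  · exact h' (fun q => P (q.1.2, q.2)) (hP.comp (f := fun q : (A × B) × X => (q.1.2, q.2)) (by fun_prop))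
      fun i => (hc0 i).symm P hP hx

end IT
end Abs

namespace Abs
open Filter

set_option linter.unusedSectionVars false
variable {𝕄 : Type w} [DSys 𝕄]
variable {X Y Z A B : Type w} [Srt 𝕄 X] [Srt 𝕄 Y] [Srt 𝕄 Z] [Srt 𝕄 A] [Srt 𝕄 B]

theorem lim_exists (T : ℕ → X) : ∃ x, ∀ Q : X → Prop, Def Q → (∀ᶠ t in atTop, Q (T t)) → Q x := by
  classical
  obtain ⟨x, hx⟩ := sat0 (ι := {Q : X → Prop // Def Q ∧ ∀ᶠ t in atTop, Q (T t)}) (fun Q => Q.1)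
    (fun Q => Q.2.1) (by
      intro s
      have : ∀ᶠ t in atTop, ∀ Q ∈ s, Q.1 (T t) := by
        rw [Filter.eventually_all_finset]
        exact fun Q _ => Q.2.2
      obtain ⟨t, ht⟩ := this.exists
      exact ⟨T t, ht⟩)
  exact ⟨x, fun Q hQ h => hx ⟨Q, hQ, h⟩⟩

/-- An SOP1 tree of tuples of conjugates of `b`. -/
def Bad (b : X) : Prop := ∃ (ι : Type) (_ : Countable ι) (A : Type w) (_ : Srt 𝕄 A)
  (φ : A × (ι → X) → Prop) (T : List Bool → ι → X), Def φ ∧ (∀ η i, E (T η i) b) ∧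
  (∀ σ : List Bool, ∃ x, ∀ η, η <+: σ → φ (x, T η)) ∧
  (∀ η₁ η₂ : List Bool, (η₁ ++ [false]) <+: η₂ → ¬ ∃ x, φ (x, T η₂) ∧ φ (x, T (η₁ ++ [true])))

/-- no SOP1 tree -/
def Good (b : X) : Prop := ¬ Bad b

theorem Good.E {b b' : X} (h : Good b) (e : E b b') : Good b' := by
  rintro ⟨ι, i1, A, i2, φ, T, h1, h2, h3, h4⟩
  exact h ⟨ι, i1, A, i2, φ, T, h1, fun η i => (h2 η i).trans e.symm, h3, h4⟩

theorem Good.tuple {ι : Type} [Countable ι] {a : X} (h : Good a) {v : ι → X} (hv : ∀ i, Abs.E (v i) a)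
    {f : (ι → X) → Y} (hf : Co f) : Good (f v) := by
  rintro ⟨κ, i1, A, i2, φ, T, h1, h2, h3, h4⟩
  have key : ∀ η i, ∃ v' : ι → X, f v' = T η i ∧ ∀ j, Abs.E (v' j) a := by
    intro η i
    obtain ⟨v', hv'⟩ := homog (h2 η i).symm v
    refine ⟨v', ?_, fun j => ?_⟩
    · exact hv'.eq_of (f := fun q => f q.2) (g := fun q => q.1) (by fun_prop) (by fun_prop) rfl
    · exact (hv'.map (f := fun q : Y × (ι → X) => q.2 j) (by fun_prop)).symm.trans (hv j)
  choose T' hT' hT'' using key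
  let g : (κ × ι → X) → (κ → Y) := fun t i => f (fun j => t (i, j))
  have hg : Co g := Co.pi fun i => hf.comp (by fun_prop)
  have hgT : ∀ η, g (fun q => T' η q.1 q.2) = T η := fun η => funext fun i => hT' η i
  refine h ⟨κ × ι, inferInstance, A, i2, fun q => φ (q.1, g q.2), fun η q => T' η q.1 q.2,
    h1.comp (f := fun q : A × (κ × ι → X) => (q.1, g q.2)) (by fun_prop), fun η q => hT'' η q.1 q.2, ?_, ?_⟩
  · simpa only [hgT] using h3
  · simpa only [hgT] using h4

theorem Good.map {a : X} (h : Good a) {f : X → Y} (hf : Co f) : Good (f a) :=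
  Good.tuple (ι := Unit) h (v := fun _ => a) (fun _ => E.refl _) (f := fun t => f (t ())) (by fun_prop)

/-- arrays -/
def IsArr (a : X) (φ : A × X → Prop) (k h n : ℕ) (W : Fin h → X) (c : ℕ → X × X) : Prop :=
  (∀ i, E (W i) a) ∧ (∀ i < n, E (c i).1 a) ∧
  (∀ i < n, E ((W, fun j : Fin i => c j), (c i).1) ((W, fun j : Fin i => c j), (c i).2)) ∧
  (∃ x, (∀ j, φ (x, W j)) ∧ ∀ i < n, φ (x, (c i).1)) ∧
  ∀ s : Finset ℕ, (∀ i ∈ s, i < n) → s.card + h = k → ¬ ∃ x, (∀ j, φ (x, W j)) ∧ ∀ i ∈ s, φ (x, (c i).2)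

def Arr (a : X) (φ : A × X → Prop) (k h n : ℕ) : Prop := ∃ W c, IsArr a φ k h n W c

theorem Arr.mono {a : X} {φ : A × X → Prop} {k h n m : ℕ} (H : Arr a φ k h n) (hm : m ≤ n) : Arr a φ k h m := by
  obtain ⟨W, c, h1, h2, h3, ⟨x, hx, hx'⟩, h5⟩ := H
  exact ⟨W, c, h1, fun i hi => h2 i (by omega), fun i hi => h3 i (by omega),
    ⟨x, hx, fun i hi => hx' i (by omega)⟩, fun s hs => h5 s fun i hi => (hs i hi).trans_le hm⟩

theorem IsArr.neg {a : X} {φ : A × X → Prop} {k h n n0 : ℕ} {W : Fin h → X} {c : ℕ → X × X}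
    (H : IsArr a φ k h n W c) (H0 : ¬ Arr a φ k (h+1) n0) {i : ℕ} (hi : i < n) {G : Fin n0 → ℕ}
    (hG : StrictMono G) (hG' : ∀ q, i < G q ∧ G q < n) :
    ¬ ∃ x, (∀ j, φ (x, W j)) ∧ φ (x, (c i).2) ∧ ∀ q, φ (x, (c (G q)).1) := by
  classical
  rintro ⟨x, hx1, hx2, hx3⟩
  obtain ⟨h1, h2, h3, h4, h5⟩ := H
  let g : ℕ → ℕ := fun j => if hj : j < n0 then G ⟨j, hj⟩ else 0
  have gG : ∀ j (hj : j < n0), g j = G ⟨j, hj⟩ := fun j hj => by simp [g, hj]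
  refine H0 ⟨Fin.cons (c i).2 W, fun j => c (g j), ?_, ?_, ?_, ?_, ?_⟩
  · intro j
    refine Fin.cases ?_ (fun j => ?_) j
    · exact ((h3 i hi).map (f := fun q => q.2) (by fun_prop)).symm.trans (h2 i hi)
    · simpa using h1 j
  · intro j hj
    exact h2 _ (by rw [gG j hj]; exact (hG' _).2)
  · intro q hq
    have hgq : g q < n := by rw [gG q hq]; exact (hG' _).2
    have hiq : i < g q := by rw [gG q hq]; exact (hG' _).1
    have hlt : ∀ j : Fin q, g j < g q := fun j => by
      rw [gG q hq, gG j (j.2.trans hq)]; exact hG j.2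
    have hco : Co (fun t : ((Fin h → X) × (Fin (g q) → X × X)) × X =>
        (((Fin.cons (t.1.2 ⟨i, hiq⟩).2 t.1.1 : Fin (h+1) → X), fun j : Fin q => t.1.2 ⟨g j, hlt j⟩), t.2)) := by
      refine Co.mk (Co.mk (Co.pi fun j => ?_) (by fun_prop)) (by fun_prop)
      refine Fin.cases ?_ (fun j => ?_) j
      · simp only [Fin.cons_zero]; fun_prop
      · simp only [Fin.cons_succ]; fun_prop
    exact (h3 (g q) hgq).map hco
  · refine ⟨x, fun j => ?_, fun q hq => ?_⟩
    · refine Fin.cases ?_ (fun j => ?_) j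
      · simpa using hx2
      · simpa using hx1 j
    · dsimp only
      rw [gG q hq]
      exact hx3 _
  · rintro s hs hcard ⟨y, hy1, hy2⟩
    have hinj : Set.InjOn g s := by
      intro p hp q hq hpq
      rw [gG p (hs p hp), gG q (hs q hq)] at hpq
      simpa using hG.injective hpq
    have hni : i ∉ s.image g := by
      intro hmem
      obtain ⟨q, hq, hqi⟩ := Finset.mem_image.1 hmem
      rw [gG q (hs q hq)] at hqi
      have := (hG' ⟨q, hs q hq⟩).1
      omega
    refine h5 (insert i (s.image g)) ?_ ?_ ⟨y, fun j => by simpa using hy1 j.succ, ?_⟩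
    · intro j hj
      rcases Finset.mem_insert.1 hj with rfl | hj
      · exact hi
      · obtain ⟨q, hq, rfl⟩ := Finset.mem_image.1 hj
        rw [gG q (hs q hq)]; exact (hG' _).2
    · rw [Finset.card_insert_of_notMem hni, Finset.card_image_of_injOn hinj]; omega
    · intro j hj
      rcases Finset.mem_insert.1 hj with rfl | hj
      · simpa using hy1 0
      · obtain ⟨q, hq, rfl⟩ := Finset.mem_image.1 hj
        exact hy2 q hq

/-- tree gluing -/
def glue {V : Type*} (r : V) (l rr : List Bool → V) : List Bool → V
  | [] => r
  | false :: η => l η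
  | true :: η => rr η

theorem IsArr.tree {a : X} {φ : A × X → Prop} (hφ : Def φ) {k h n n0 : ℕ} (hn0 : 0 < n0) {W : Fin h → X}
    {c : ℕ → X × X} (H : IsArr a φ k h n W c) (H0 : ¬ Arr a φ k (h+1) n0) : ∀ t i : ℕ,
    i + (t+1) * (n0+1) ≤ n → ∃ T : List Bool → Fin n0 → X,
      (∀ q, T [] q = (c (i+q)).1) ∧
      (∀ σ : List Bool, ∃ G : ℕ → Fin n0 → ℕ, (∀ l, StrictMono (G l)) ∧ (∀ l q, i ≤ G l q ∧ G l q < n) ∧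
        E ((W, fun j : Fin i => c j), fun l : ℕ => T (σ.take l)) ((W, fun j : Fin i => c j), fun l q => (c (G l q)).1)) ∧
      (∀ η₁ η₂ : List Bool, (η₁ ++ [false]) <+: η₂ → η₂.length ≤ t →
        ¬ ∃ x, (∀ j, φ (x, W j)) ∧ (∀ q, φ (x, T η₂ q)) ∧ ∀ q, φ (x, T (η₁ ++ [true]) q)) := by
  intro t
  have hsm : ∀ i : ℕ, StrictMono (fun q : Fin n0 => i + q.1) := fun i p q hpq => by
    have : p.1 < q.1 := hpq
    dsimp only; omega
  induction t with
  | zero =>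
    intro i hi
    refine ⟨fun _ q => (c (i+q)).1, fun q => rfl, fun σ => ⟨fun _ q => i + q, fun _ => hsm i, fun l q => ?_, E.refl _⟩, ?_⟩
    · have := q.2; change i ≤ i + q.1 ∧ i + q.1 < n; constructor <;> omega
    · intro η₁ η₂ hp hl
      have := hp.length_le
      simp at this
      omega
  | succ t ih =>
    intro i hi
    have hexp : (t+1+1)*(n0+1) = (t+1)*(n0+1) + n0 + 1 := by ring
    have hpos : 0 < (t+1) * (n0+1) := by positivity
    obtain ⟨TL, hL1, hL2, hL3⟩ := ih (i+n0+1) (by omega)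
    obtain ⟨T0, hR1, hR2, hR3⟩ := ih (i+n0) (by omega)
    have hen : i + n0 < n := by omega
    obtain ⟨T', hT'⟩ := homog (H.2.2.1 (i+n0) hen) T0
    have hT'0 : T' [] ⟨0, hn0⟩ = (c (i+n0)).2 := by
      refine hT'.eq_of (f := fun q : (((Fin h → X) × (Fin (i+n0) → X × X)) × X) × (List Bool → Fin n0 → X) => q.2 [] ⟨0, hn0⟩)
        (g := fun q => q.1.2) (by fun_prop) (by fun_prop) ?_
      simpa using hR1 ⟨0, hn0⟩
    refine ⟨glue (fun q => (c (i+q)).1) TL T', fun q => rfl, ?_, ?_⟩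
    · intro σ
      match σ with
      | [] =>
        refine ⟨fun _ q => i + q, fun _ => hsm i, fun l q => ?_, ?_⟩
        · have := q.2; change i ≤ i + q.1 ∧ i + q.1 < n; constructor <;> omega
        · simp only [List.take_nil]; exact E.refl _
      | false :: σ' =>
        obtain ⟨G, hG1, hG2, hG3⟩ := hL2 σ'
        refine ⟨fun l => Nat.casesOn l (fun q => i + q) (fun l => G l), ?_, ?_, ?_⟩
        · rintro (_ | l)
          · exact hsm i
          · exact hG1 l
        · rintro (_ | l) q
          · have := q.2; change i ≤ i + q.1 ∧ i + q.1 < n; constructor <;> omega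
          · have := hG2 l q; change i ≤ G l q ∧ G l q < n; omega
        · have hco : Co (fun t : ((Fin h → X) × (Fin (i+n0+1) → X × X)) × (ℕ → Fin n0 → X) =>
              ((t.1.1, fun j : Fin i => t.1.2 ⟨j, by omega⟩),
               (fun (l : ℕ) (q : Fin n0) => (Nat.casesOn l (t.1.2 ⟨i+q, by omega⟩).1 (fun l => t.2 l q) : X)))) := by
            refine Co.mk (by fun_prop) (Co.pi fun l => Co.pi fun q => ?_)
            cases l <;> dsimp only <;> fun_prop
          have := hG3.map hco
          convert this using 2
          · funext l; cases l <;> rfl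
          · funext l q; cases l <;> rfl
      | true :: σ' =>
        obtain ⟨G, hG1, hG2, hG3⟩ := hR2 σ'
        refine ⟨fun l => Nat.casesOn l (fun q => i + q) (fun l => G l), ?_, ?_, ?_⟩
        · rintro (_ | l)
          · exact hsm i
          · exact hG1 l
        · rintro (_ | l) q
          · have := q.2; change i ≤ i + q.1 ∧ i + q.1 < n; constructor <;> omega
          · have := hG2 l q; change i ≤ G l q ∧ G l q < n; omega
        · have hco : Co (fun t : ((Fin h → X) × (Fin (i+n0) → X × X)) × (ℕ → Fin n0 → X) =>
              ((t.1.1, fun j : Fin i => t.1.2 ⟨j, by omega⟩),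
               (fun (l : ℕ) (q : Fin n0) => (Nat.casesOn l (t.1.2 ⟨i+q, by omega⟩).1 (fun l => t.2 l q) : X)))) := by
            refine Co.mk (by fun_prop) (Co.pi fun l => Co.pi fun q => ?_)
            cases l <;> dsimp only <;> fun_prop
          have hc2 := hT'.map (f := fun q : (((Fin h → X) × (Fin (i+n0) → X × X)) × X) × (List Bool → Fin n0 → X) =>
            (q.1.1, fun l : ℕ => q.2 (σ'.take l))) (by fun_prop)
          have := (hc2.symm.trans hG3).map hco
          convert this using 2
          · funext l; cases l <;> rfl
          · funext l q; cases l <;> rfl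
    · intro η₁ η₂ hp hl
      match η₁, η₂, hp with
      | [], b :: η, hp =>
        have hb : b = false := by
          have := (List.cons_prefix_cons.1 hp).1
          exact this.symm
        subst hb
        rintro ⟨x, hx1, hx2, hx3⟩
        obtain ⟨G, hG1, hG2, hG3⟩ := hL2 η
        have hx3' : φ (x, (c (i+n0)).2) := by
          rw [← hT'0]; exact hx3 ⟨0, hn0⟩
        have hdef : Def (fun t : ((Fin h → X) × (Fin (i+n0+1) → X × X)) × (ℕ → Fin n0 → X) =>
            ∃ x, (∀ j, φ (x, t.1.1 j)) ∧ φ (x, (t.1.2 ⟨i+n0, by omega⟩).2) ∧ ∀ q, φ (x, t.2 η.length q)) := by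
          refine Def.ex (P := fun z : (((Fin h → X) × (Fin (i+n0+1) → X × X)) × (ℕ → Fin n0 → X)) × A =>
            (∀ j, φ (z.2, z.1.1.1 j)) ∧ φ (z.2, (z.1.1.2 ⟨i+n0, by omega⟩).2) ∧ ∀ q, φ (z.2, z.1.2 η.length q)) ?_
          refine (Def.all fun j => ?_).and (Def.and ?_ (Def.all fun q => ?_))
          · exact hφ.comp (f := fun z : (((Fin h → X) × (Fin (i+n0+1) → X × X)) × (ℕ → Fin n0 → X)) × A => (z.2, z.1.1.1 j)) (by fun_prop)
          · exact hφ.comp (f := fun z : (((Fin h → X) × (Fin (i+n0+1) → X × X)) × (ℕ → Fin n0 → X)) × A => (z.2, (z.1.1.2 ⟨i+n0, by omega⟩).2)) (by fun_prop)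
          · exact hφ.comp (f := fun z : (((Fin h → X) × (Fin (i+n0+1) → X × X)) × (ℕ → Fin n0 → X)) × A => (z.2, z.1.2 η.length q)) (by fun_prop)
        have := hG3 _ hdef ⟨x, hx1, hx3', fun q => by
          simp only [List.take_length]; exact hx2 q⟩
        exact H.neg H0 hen (hG1 η.length) (fun q => ⟨by have := (hG2 η.length q).1; omega, (hG2 η.length q).2⟩) this
      | b :: η₁', b' :: η₂', hp =>
        obtain ⟨hb, hp'⟩ := List.cons_prefix_cons.1 hp
        subst hb
        have hl' : η₂'.length ≤ t := by simpa using hl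
        cases b with
        | false => exact hL3 η₁' η₂' hp' hl'
        | true =>
          have hdef : Def (fun t : (((Fin h → X) × (Fin (i+n0) → X × X)) × X) × (List Bool → Fin n0 → X) =>
            ∃ x, (∀ j, φ (x, t.1.1.1 j)) ∧ (∀ q, φ (x, t.2 η₂' q)) ∧ ∀ q, φ (x, t.2 (η₁' ++ [true]) q)) := by
            refine Def.ex (P := fun z : ((((Fin h → X) × (Fin (i+n0) → X × X)) × X) × (List Bool → Fin n0 → X)) × A =>
              (∀ j, φ (z.2, z.1.1.1.1 j)) ∧ (∀ q, φ (z.2, z.1.2 η₂' q)) ∧ ∀ q, φ (z.2, z.1.2 (η₁' ++ [true]) q)) ?_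
            refine (Def.all fun j => ?_).and (Def.and (Def.all fun q => ?_) (Def.all fun q => ?_))
            · exact hφ.comp (f := fun z : ((((Fin h → X) × (Fin (i+n0) → X × X)) × X) × (List Bool → Fin n0 → X)) × A => (z.2, z.1.1.1.1 j)) (by fun_prop)
            · exact hφ.comp (f := fun z : ((((Fin h → X) × (Fin (i+n0) → X × X)) × X) × (List Bool → Fin n0 → X)) × A => (z.2, z.1.2 η₂' q)) (by fun_prop)
            · exact hφ.comp (f := fun z : ((((Fin h → X) × (Fin (i+n0) → X × X)) × X) × (List Bool → Fin n0 → X)) × A => (z.2, z.1.2 (η₁' ++ [true]) q)) (by fun_prop)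
          intro hx
          exact hR3 η₁' η₂' hp' hl' (hT'.symm _ hdef hx)

/-- the array lemma -/
theorem AL {a : X} (ha : Good a) {φ : A × X → Prop} (hφ : Def φ) {k : ℕ} (H : ∀ n, Arr a φ k 0 n) : False := by
  classical
  have hk : ¬ ∀ n, Arr a φ k k n := by
    intro h
    obtain ⟨W, c, h1, h2, h3, ⟨x, hx, _⟩, h5⟩ := h 0
    exact h5 ∅ (by simp) (by simp) ⟨x, hx, by simp⟩
  obtain ⟨h, hh, hh'⟩ : ∃ h, (∀ n, Arr a φ k h n) ∧ ¬ ∀ n, Arr a φ k (h+1) n := by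
    by_contra hc
    push Not at hc
    refine hk ?_
    have : ∀ h, ∀ n, Arr a φ k h n := fun h => by
      induction h with
      | zero => exact H
      | succ h ih => exact hc h ih
    exact this k
  push Not at hh'
  obtain ⟨n1, hn1⟩ := hh'
  obtain ⟨n0, hn0, hA⟩ : ∃ n0, 0 < n0 ∧ ¬ Arr a φ k (h+1) n0 :=
    ⟨n1 + 1, by omega, fun h => hn1 (h.mono (by omega))⟩
  have key : ∀ t : ℕ, ∃ T : List Bool → Fin h ⊕ Fin n0 → X,
      (∀ η i, E (T η i) a) ∧ (∀ σ, ∃ x, ∀ η, η <+: σ → ∀ i, φ (x, T η i)) ∧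
      (∀ η₁ η₂ : List Bool, (η₁ ++ [false]) <+: η₂ → η₂.length ≤ t →
        ¬ ∃ x, (∀ q, φ (x, T η₂ q)) ∧ ∀ q, φ (x, T (η₁ ++ [true]) q)) := by
    intro t
    obtain ⟨W, c, hW⟩ := hh (0 + (t+1) * (n0+1))
    obtain ⟨T, -, h2, h3⟩ := hW.tree hφ hn0 hA t 0 le_rfl
    refine ⟨fun η => Sum.elim W (T η), ?_, ?_, ?_⟩
    · rintro η (i | q)
      · exact hW.1 i
      · obtain ⟨G, hG1, hG2, hG3⟩ := h2 η
        have := hG3.map (f := fun z : ((Fin h → X) × (Fin 0 → X × X)) × (ℕ → Fin n0 → X) => z.2 η.length q) (by fun_prop)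
        simp only [List.take_length] at this
        exact this.trans (hW.2.1 _ (hG2 _ _).2)
    · intro σ
      obtain ⟨G, hG1, hG2, hG3⟩ := h2 σ
      have hdef : Def (fun z : ((Fin h → X) × (Fin 0 → X × X)) × (ℕ → Fin n0 → X) =>
          ∃ x, (∀ j, φ (x, z.1.1 j)) ∧ ∀ l ∈ Finset.range (σ.length + 1), ∀ q, φ (x, z.2 l q)) := by
        refine Def.ex (P := fun z : (((Fin h → X) × (Fin 0 → X × X)) × (ℕ → Fin n0 → X)) × A =>
          (∀ j, φ (z.2, z.1.1.1 j)) ∧ ∀ l ∈ Finset.range (σ.length + 1), ∀ q, φ (z.2, z.1.2 l q)) ?_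
        refine (Def.all fun j => ?_).and (Def.ball _ fun l _ => Def.all fun q => ?_)
        · exact hφ.comp (f := fun z : (((Fin h → X) × (Fin 0 → X × X)) × (ℕ → Fin n0 → X)) × A => (z.2, z.1.1.1 j)) (by fun_prop)
        · exact hφ.comp (f := fun z : (((Fin h → X) × (Fin 0 → X × X)) × (ℕ → Fin n0 → X)) × A => (z.2, z.1.2 l q)) (by fun_prop)
      obtain ⟨x0, hx0, hx0'⟩ := hW.2.2.2.1
      obtain ⟨x, hx, hx'⟩ := hG3.symm _ hdef ⟨x0, hx0, fun l _ q => hx0' _ (hG2 l q).2⟩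
      refine ⟨x, fun η hη i => ?_⟩
      cases i with
      | inl i => exact hx i
      | inr q =>
        have := hx' η.length (by have := hη.length_le; simp; omega) q
        dsimp only at this
        rwa [← List.prefix_iff_eq_take.1 hη] at this
    · rintro η₁ η₂ hp hl ⟨x, hx1, hx2⟩
      exact h3 η₁ η₂ hp hl ⟨x, fun j => hx1 (Sum.inl j), fun q => hx1 (Sum.inr q), fun q => hx2 (Sum.inr q)⟩
  choose T hT1 hT2 hT3 using key
  obtain ⟨B, hB⟩ := lim_exists T
  refine ha ⟨Fin h ⊕ Fin n0, inferInstance, A, inferInstance, fun q => ∀ i, φ (q.1, q.2 i), B, ?_, ?_, ?_, ?_⟩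
  · exact Def.all fun i => hφ.comp (f := fun q : A × (Fin h ⊕ Fin n0 → X) => (q.1, q.2 i)) (by fun_prop)
  · intro η i
    refine E.symm fun P hP hpa => hB (fun B => P (B η i)) (hP.comp (f := fun B : List Bool → Fin h ⊕ Fin n0 → X => B η i) (by fun_prop)) ?_
    exact .of_forall fun t => (hT1 t η i).symm P hP hpa
  · intro σ
    have hdef : Def (fun B : List Bool → Fin h ⊕ Fin n0 → X => ∃ x, ∀ η ∈ σ.inits.toFinset, ∀ i, φ (x, B η i)) := by
      refine Def.ex (P := fun z : (List Bool → Fin h ⊕ Fin n0 → X) × A => ∀ η ∈ σ.inits.toFinset, ∀ i, φ (z.2, z.1 η i)) ?_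
      exact Def.ball _ fun η _ => Def.all fun i =>
        hφ.comp (f := fun z : (List Bool → Fin h ⊕ Fin n0 → X) × A => (z.2, z.1 η i)) (by fun_prop)
    obtain ⟨x, hx⟩ := hB _ hdef (.of_forall fun t => by
      obtain ⟨x, hx⟩ := hT2 t σ
      exact ⟨x, fun η hη => hx η (by simpa using hη)⟩)
    exact ⟨x, fun η hη => hx η (by simpa using hη)⟩
  · intro η₁ η₂ hp
    have hdef : Def (fun B : List Bool → Fin h ⊕ Fin n0 → X => ∃ x, (∀ i, φ (x, B η₂ i)) ∧ ∀ i, φ (x, B (η₁ ++ [true]) i)) := by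
      refine Def.ex (P := fun z : (List Bool → Fin h ⊕ Fin n0 → X) × A => (∀ i, φ (z.2, z.1 η₂ i)) ∧ ∀ i, φ (z.2, z.1 (η₁ ++ [true]) i)) ?_
      exact (Def.all fun i => hφ.comp (f := fun z : (List Bool → Fin h ⊕ Fin n0 → X) × A => (z.2, z.1 η₂ i)) (by fun_prop)).and
        (Def.all fun i => hφ.comp (f := fun z : (List Bool → Fin h ⊕ Fin n0 → X) × A => (z.2, z.1 (η₁ ++ [true]) i)) (by fun_prop))
    refine hB _ hdef.not ?_
    filter_upwards [eventually_ge_atTop η₂.length] with t ht using hT3 t η₁ η₂ hp ht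

end Abs

namespace Abs
open Filter

set_option linter.unusedSectionVars false
variable {𝕄 : Type w} [DSys 𝕄]
variable {X Y Z A B : Type w} [Srt 𝕄 X] [Srt 𝕄 Y] [Srt 𝕄 Z] [Srt 𝕄 A] [Srt 𝕄 B]

theorem Mor.shift {p : IT X} {y : Y} {u : ℕ → X} (h : Mor p y u) (m : ℕ) :
    Mor p ((fun j : Fin m => u j), y) (fun i => u (m + i)) := fun i =>
  p.mono (h (m+i)) (f := fun q : (Fin (m+i) → X) × Y =>
    ((fun j : Fin i => q.1 ⟨m + j, by omega⟩), (fun j : Fin m => q.1 ⟨j, by omega⟩), q.2)) (by fun_prop)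

/-- dividing for finite Morley sequences -/
theorem Dv.finF {p : IT X} {P : A × X → Prop} (hP : Def P) (h : Dv p P) :
    ∃ k, ∀ n (v : Fin n → X), MorF p (un : Un 𝕄) v → ∀ s : Finset (Fin n), k ≤ s.card →
      ¬ ∃ a, ∀ i ∈ s, P (a, v i) := by
  classical
  obtain ⟨k, hk⟩ := h.fin hP
  refine ⟨k, ?_⟩
  rintro n v hv s hs ⟨a, ha⟩
  obtain ⟨w, hw⟩ := Mor.exists p (un : Un 𝕄)
  have e := hv.uniq (hw.fin n) (E.refl _)
  obtain ⟨a', ha'⟩ := homog' e a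
  let f : ℕ → ℕ := fun i => if hi : i < s.card then (s.orderEmbOfFin rfl ⟨i, hi⟩).1 else n + i
  have hf : StrictMono f := by
    intro i j hij
    dsimp only [f]
    split_ifs with h1 h2 h2
    · exact (s.orderEmbOfFin rfl).strictMono (show (⟨i, h1⟩ : Fin s.card) < ⟨j, h2⟩ from hij)
    · have := (s.orderEmbOfFin rfl ⟨i, h1⟩).2; omega
    · omega
    · omega
  refine hk _ (hw.sub hf) ⟨a', fun i hi => ?_⟩
  have hi' : i < s.card := by omega
  have hfi : f i = (s.orderEmbOfFin rfl ⟨i, hi'⟩).1 := by simp [f, hi']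
  rw [hfi]
  exact ha'.map (f := fun q : A × (Fin n → X) × Un 𝕄 => (q.1, q.2.1 (s.orderEmbOfFin rfl ⟨i, hi'⟩)))
    (by fun_prop) P hP (ha _ (Finset.orderEmbOfFin_mem _ _ _))

/-- Kim lemma -/
theorem KL {a : A} {b : X} (hb : Good b) {p q : IT X} (h : Ind p a b) (hq : q.Ext b) : Ind q a b := by
  classical
  by_contra hc
  obtain ⟨P, hP, hab, hd⟩ := exists_Dv hq hc
  obtain ⟨k, hk⟩ := hd.finF hP
  obtain ⟨u, hu⟩ := Mor.exists (p.tensor q) (un : Un 𝕄)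
  have hu1 : Mor p (un : Un 𝕄) (fun i => (u i).1) := fun i => p.mono (hu i).1
    (f := fun z : X × (Fin i → X × X) × Un 𝕄 => ((fun j : Fin i => (z.2.1 j).1), z.2.2)) (by fun_prop)
  have hu2 : Mor q (un : Un 𝕄) (fun i => (u i).2) := fun i => q.mono (hu i).2
    (f := fun z : (Fin i → X × X) × Un 𝕄 => ((fun j : Fin i => (z.1 j).2), z.2)) (by fun_prop)
  refine AL hb hP (k := k) fun n => ⟨fun i => i.elim0, fun i => u (n - 1 - i), fun i => i.elim0,
    fun i _ => hu1.extE _ h.1, ?_, ?_, ?_⟩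
  · intro i hi
    have hm := (hu.shift (n - i)).fin i
    have hlt : n - 1 - i < n - i := by omega
    have h1 : MorF (p.tensor q) (u (n-1-i)).1 (fun j : Fin i => u (n - i + j)) := fun j =>
      IT.mono _ (hm j) (f := fun z : (Fin j → X × X) × (Fin (n-i) → X × X) × Un 𝕄 => (z.1, (z.2.1 ⟨n-1-i, hlt⟩).1)) (by fun_prop)
    have h2 : MorF (p.tensor q) (u (n-1-i)).2 (fun j : Fin i => u (n - i + j)) := fun j =>
      IT.mono _ (hm j) (f := fun z : (Fin j → X × X) × (Fin (n-i) → X × X) × Un 𝕄 => (z.1, (z.2.1 ⟨n-1-i, hlt⟩).2)) (by fun_prop)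
    have e := h1.uniq h2 ((hu1.extE _ h.1).trans (hu2.extE _ hq).symm)
    have := e.map (f := fun z : (Fin i → X × X) × X =>
      ((((fun j => j.elim0) : Fin 0 → X), fun j : Fin i => z.1 ⟨i - 1 - j, by omega⟩), z.2)) (by
        refine Co.mk (Co.mk (Co.pi fun j => j.elim0) (by fun_prop)) (by fun_prop))
    have hj : ∀ j : Fin i, n - 1 - j.1 = n - i + (i - 1 - j.1) := fun j => by omega
    simp only [hj]
    exact this
  · obtain ⟨a', ha'⟩ := h.2 _ hu1
    exact ⟨a', fun j => j.elim0, fun i _ => (ha' _).symm P hP hab⟩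
  · rintro s hs hcard ⟨x, -, hx⟩
    rcases Nat.eq_zero_or_pos n with rfl | hn
    · have : s = ∅ := Finset.eq_empty_of_forall_notMem fun i hi => by simpa using hs i hi
      subst this
      exact hk 0 _ (hu2.fin 0) ∅ (by simp at hcard ⊢; omega) ⟨x, by simp⟩
    refine hk n _ (hu2.fin n) (s.image fun i => ⟨n-1-i, by omega⟩) ?_ ⟨x, ?_⟩
    · rw [Finset.card_image_of_injOn]
      · omega
      · intro i hi j hj hij
        have h1 := hs i hi
        have h2 := hs j hj
        simp only [Fin.mk.injEq] at hij
        omega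
    · intro i hi
      obtain ⟨j, hj, rfl⟩ := Finset.mem_image.1 hi
      exact hx j hj

/-- independence -/
def I (a : A) (b : X) : Prop := ∀ p : IT X, p.Ext b → Ind p a b

theorem I.of {a : A} {b : X} (hb : Good b) {p : IT X} (h : Ind p a b) : I a b := fun _ hq => KL hb h hq

theorem I.E {a a' : A} {b b' : X} (h : I a b) (e : E (a, b) (a', b')) : I a' b' := fun p hp =>
  (h p (hp.of_E (e.map (f := fun q => q.2) (by fun_prop)).symm)).E e

theorem I.mapl {a : A} {b : X} (h : I a b) {g : A → B} (hg : Co g) : I (g a) b := fun p hp => (h p hp).mapl hg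

/-- coheirs -/
def coheir (U : Ultrafilter X) (hU : ∀ᶠ m in (U : Filter X), MP m) : IT X where
  R {Y} _ x y := ∀ P : X × Y → Prop, Def P → (∀ᶠ m in (U : Filter X), P (m, y)) → P (x, y)
  ex {Y} _ y := by
    classical
    obtain ⟨x, hx⟩ := satX (X := X) (Y := Y) (ι := {P : X × Y → Prop // Def P ∧ ∀ᶠ m in (U : Filter X), P (m, y)})
      (fun P => P.1) (fun P => P.2.1) y (by
        intro s
        have : ∀ᶠ m in (U : Filter X), ∀ P ∈ s, P.1 (m, y) := by
          rw [Filter.eventually_all_finset]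
          exact fun P _ => P.2.2
        exact this.exists)
    exact ⟨x, fun P hP h => hx ⟨P, hP, h⟩⟩
  uniq {Y} _ {x x' y y'} h h' e := by
    intro P hP hxy
    by_contra hc
    have h1 : ∀ᶠ m in (U : Filter X), P (m, y) := by
      by_contra hn
      exact h (fun q => ¬ P q) hP.not (Ultrafilter.eventually_not.2 hn) hxy
    refine hc (h' P hP ?_)
    filter_upwards [h1, hU] with m hm hm'
    exact e _ (hP.subst hm') hm
  closed {Y} _ {x x' y y'} h e := by
    intro P hP hev
    refine e P hP (h P hP ?_)
    have e' : E y y' := e.map (f := fun q => q.2) (by fun_prop)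
    filter_upwards [hev, hU] with m hm hm'
    exact e'.symm _ (hP.subst hm') hm
  mono := by
    intro Y Z _ _ x y f h hf P hP hev
    exact h (fun q => P (q.1, f q.2)) (hP.comp (f := fun q : X × Y => (q.1, f q.2)) (by fun_prop)) hev

/-- p is a coheir -/
def IsCoheir (p : IT X) : Prop := ∃ U hU, p = coheir U hU

theorem exists_coheir (b : X) : ∃ p : IT X, IsCoheir p ∧ p.Ext b := by
  let F : Filter X :=
    { sets := {S | ∃ P : X → Prop, Def P ∧ P b ∧ ∀ x, MP x → P x → x ∈ S}
      univ_sets := ⟨fun _ => True, Def.true, trivial, fun _ _ _ => trivial⟩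
      sets_of_superset := by
        rintro S T ⟨P, h1, h2, h3⟩ hST
        exact ⟨P, h1, h2, fun x hx hP => hST (h3 x hx hP)⟩
      inter_sets := by
        rintro S T ⟨P, h1, h2, h3⟩ ⟨Q, h4, h5, h6⟩
        exact ⟨_, h1.and h4, ⟨h2, h5⟩, fun x hx hP => ⟨h3 x hx hP.1, h6 x hx hP.2⟩⟩ }
  have : F.NeBot := by
    rw [neBot_iff]
    intro hF
    obtain ⟨P, h1, h2, h3⟩ : (∅ : Set X) ∈ F := by rw [hF]; exact mem_bot
    obtain ⟨m, hm, hm'⟩ := h1.model ⟨b, h2⟩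
    exact h3 m hm hm'
  have hle : ((Ultrafilter.of F : Ultrafilter X) : Filter X) ≤ F := Ultrafilter.of_le F
  have hU : ∀ᶠ m in (Ultrafilter.of F : Filter X), MP m := hle ⟨fun _ => True, Def.true, trivial, fun _ h _ => h⟩
  refine ⟨coheir (Ultrafilter.of F) hU, ⟨_, _, rfl⟩, fun P hP hev => ?_⟩
  by_contra hc
  have h1 : ∀ᶠ m in (Ultrafilter.of F : Filter X), ¬ P (m, un) := hle
    ⟨fun x => ¬ P (x, un), (hP.comp (f := fun x : X => (x, (un : Un 𝕄))) (by fun_prop)).not, hc, fun _ _ h => h⟩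
  obtain ⟨m, hm, hm'⟩ := (hev.and h1).exists
  exact hm' hm

theorem left_ext {p : IT X} (hp : IsCoheir p) {b : X} (hb : p.Ext b) (c : Z) :
    ∃ s : IT (X × Z), IsCoheir s ∧ s.Ext (b, c) ∧
      ∀ {Y : Type w} [Srt 𝕄 Y] (x : X) (z : Z) (y : Y), s.R (x, z) y → p.R x y := by
  obtain ⟨U, hU, rfl⟩ := hp
  let F : Filter (X × Z) :=
    { sets := {S | ∃ P : X × Z → Prop, Def P ∧ P (b, c) ∧ ∃ A ∈ U, ∀ x z, MP x → MP z → x ∈ A → P (x, z) → (x, z) ∈ S}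
      univ_sets := ⟨fun _ => True, Def.true, trivial, Set.univ, univ_mem, fun _ _ _ _ _ _ => trivial⟩
      sets_of_superset := by
        rintro S T ⟨P, h1, h2, A, hA, h3⟩ hST
        exact ⟨P, h1, h2, A, hA, fun x z hx hz hA hP => hST (h3 x z hx hz hA hP)⟩
      inter_sets := by
        rintro S T ⟨P, h1, h2, A, hA, h3⟩ ⟨Q, h4, h5, A', hA', h6⟩
        exact ⟨_, h1.and h4, ⟨h2, h5⟩, A ∩ A', inter_mem hA hA', fun x z hx hz hA hP =>
          ⟨h3 x z hx hz hA.1 hP.1, h6 x z hx hz hA.2 hP.2⟩⟩ }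
  have : F.NeBot := by
    rw [neBot_iff]
    intro hF
    obtain ⟨P, h1, h2, A, hA, h3⟩ : (∅ : Set (X × Z)) ∈ F := by rw [hF]; exact mem_bot
    have hev : ∀ᶠ m in (U : Filter X), ∃ z, P (m, z) := by
      by_contra hn
      have := hb (fun q => ¬ ∃ z, P (q.1, z)) (h1.ex.not.comp (f := fun q : X × Un 𝕄 => q.1) (by fun_prop))
        (Ultrafilter.eventually_not.2 hn)
      exact this ⟨c, h2⟩
    have hA' : ∀ᶠ m in (U : Filter X), m ∈ A := hA
    obtain ⟨m, ⟨hm1, hm2⟩, hm3⟩ := ((hev.and hU).and hA').exists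
    obtain ⟨z, hz, hz'⟩ := (h1.subst hm2).model hm1
    exact h3 m z hm2 hz hm3 hz'
  have hle : ((Ultrafilter.of F : Ultrafilter (X × Z)) : Filter (X × Z)) ≤ F := Ultrafilter.of_le F
  have hV : ∀ᶠ m in (Ultrafilter.of F : Filter (X × Z)), MP m := hle
    ⟨fun _ => True, Def.true, trivial, Set.univ, univ_mem, fun _ _ h h' _ _ => h.pair h'⟩
  refine ⟨coheir (Ultrafilter.of F) hV, ⟨_, _, rfl⟩, fun P hP hev => ?_, ?_⟩
  · by_contra hc
    have h1 : ∀ᶠ m in (Ultrafilter.of F : Filter (X × Z)), ¬ P (m, un) := hle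
      ⟨fun x => ¬ P (x, un), (hP.comp (f := fun x : X × Z => (x, (un : Un 𝕄))) (by fun_prop)).not, hc,
        Set.univ, univ_mem, fun _ _ _ _ _ h => h⟩
    obtain ⟨m, hm, hm'⟩ := (hev.and h1).exists
    exact hm' hm
  · intro Y _ x z y h P hP hev
    refine h (fun q => P (q.1.1, q.2)) (hP.comp (f := fun q : (X × Z) × Y => (q.1.1, q.2)) (by fun_prop)) ?_
    exact hle ⟨fun _ => True, Def.true, trivial, {m | P (m, y)}, hev, fun _ _ _ _ h _ => h⟩

theorem I.mapr {a : A} {b : X} (h : I a b) {g : X → Y} (hg : Co g) (hgb : Good (g b)) : I a (g b) := by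
  obtain ⟨p, -, hp⟩ := exists_coheir b
  exact I.of hgb ((h p hp).mapr hg)

end Abs

namespace Abs
open Filter

set_option linter.unusedSectionVars false
variable {𝕄 : Type w} [DSys 𝕄]
variable {X Y Z A B : Type w} [Srt 𝕄 X] [Srt 𝕄 Y] [Srt 𝕄 Z] [Srt 𝕄 A] [Srt 𝕄 B]

/-- compactness relative to a class of approximants -/
theorem satG {J : Type r} (good : X → Prop) (Θ : J → X → Prop) (hΘ : ∀ j, Def (Θ j))
    (h : ∀ s : Finset J, ∃ x, good x ∧ ∀ j ∈ s, Θ j x) :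
    ∃ x, (∀ j, Θ j x) ∧ ∀ Q : X → Prop, Def Q → (∀ x, good x → Q x) → Q x := by
  classical
  obtain ⟨x, hx⟩ := sat0 (ι := J ⊕ {Q : X → Prop // Def Q ∧ ∀ x, good x → Q x})
    (fun i => Sum.elim Θ (fun Q => Q.1) i) (by rintro (j | Q); exacts [hΘ j, Q.2.1]) (by
      intro s
      obtain ⟨x, hx, hx'⟩ := h (s.preimage Sum.inl Sum.inl_injective.injOn)
      refine ⟨x, ?_⟩
      rintro (j | Q) hi
      · exact hx' j (by simpa using hi)
      · exact Q.2.2 x hx)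
  exact ⟨x, fun j => hx (Sum.inl j), fun Q hQ h => hx (Sum.inr ⟨Q, hQ, h⟩)⟩

/-- the path through a tree given by first choices -/
def pth (u : ℕ → ℕ × ℕ) (i : ℕ) : List ℕ := (List.range i).map fun l => (u l).1

theorem pth_succ (u : ℕ → ℕ × ℕ) (i : ℕ) : pth u (i+1) = pth u i ++ [(u i).1] := by
  simp [pth, List.range_succ]

theorem pth_length (u : ℕ → ℕ × ℕ) (i : ℕ) : (pth u i).length = i := by simp [pth]

theorem pth_initial (u : ℕ → ℕ × ℕ) {i j : ℕ} (h : i ≤ j) : pth u i <+: pth u j := by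
  induction j, h using Nat.le_induction with
  | base => exact List.prefix_refl _
  | succ j _ ih => rw [pth_succ]; exact ih.trans (List.prefix_append _ _)

theorem pth_congr {u v : ℕ → ℕ × ℕ} {i : ℕ} (h : ∀ l < i, u l = v l) : pth u i = pth v i := by
  simp only [pth, List.map_inj_left, List.mem_range]
  intro l hl; rw [h l hl]

/-- the array along choices -/
def cOf (f : List ℕ → A) (u : ℕ → ℕ × ℕ) (i : ℕ) : A × A :=
  (f (pth u i ++ [(u i).1]), f (pth u i ++ [(u i).2]))

theorem cOf_exists (f : List ℕ → A)
    (t : Finset ((i : ℕ) × {Q : ((Fin 0 → A) × (Fin i → A × A)) × A → Prop // Def Q})) (W : Fin 0 → A) :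
    ∃ u : ℕ → ℕ × ℕ, (∀ i, (u i).1 < (u i).2) ∧ ∀ Q ∈ t,
      (Q.2.1 ((W, fun j => cOf f u j), (cOf f u Q.1).1) ↔ Q.2.1 ((W, fun j => cOf f u j), (cOf f u Q.1).2)) := by
  classical
  let ext : ∀ i : ℕ, (Fin i → ℕ × ℕ) → ℕ → ℕ × ℕ := fun i v l => if hl : l < i then v ⟨l, hl⟩ else (0, 0)
  obtain ⟨u, hu⟩ := exists_seq (X := ℕ × ℕ) (fun i v x => x.1 < x.2 ∧ ∀ Q ∈ t, ∀ hQ : Q.1 = i,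
      (Q.2.1 ((W, fun j => cOf f (ext i v) j), f (pth (ext i v) i ++ [x.1])) ↔
       Q.2.1 ((W, fun j => cOf f (ext i v) j), f (pth (ext i v) i ++ [x.2])))) (by
    intro i v
    let col : ℕ → (t → Prop) := fun j Q => Q.1.2.1 ((W, fun j => cOf f (ext i v) j), f (pth (ext i v) i ++ [j]))
    obtain ⟨x, y, hxy, hcol⟩ := Finite.exists_ne_map_eq_of_infinite col
    rcases lt_or_gt_of_ne hxy with h | h
    · exact ⟨(x, y), h, fun Q hQ _ => by simpa using congrFun hcol ⟨Q, hQ⟩⟩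
    · exact ⟨(y, x), h, fun Q hQ _ => by simpa using (congrFun hcol ⟨Q, hQ⟩).symm⟩)
  refine ⟨u, fun i => (hu i).1, fun Q hQ => ?_⟩
  have h1 := (hu Q.1).2 Q hQ rfl
  have h2 : ∀ l < Q.1, ext Q.1 (fun j => u j) l = u l := fun l hl => by simp [ext, hl]
  have h3 : ∀ j : Fin Q.1, cOf f (ext Q.1 (fun j => u j)) j = cOf f u j := by
    intro j
    simp only [cOf]
    rw [pth_congr (v := u) (fun l hl => h2 l (hl.trans j.2)), h2 j j.2]
  rw [pth_congr h2] at h1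
  simp only [h3] at h1
  exact h1

theorem S_tree {a : A} {b : B} (hb : Good b) (h : I a b) {p : IT A} (hp : IsCoheir p)
    (hpa : p.Ext a) (n : ℕ) :
    ∃ (f : List ℕ → A) (g : List ℕ → B) (a' : A), (∀ η, E (a', g η) (a, b)) ∧ I a' g ∧
      (∀ ν η, ν ≠ [] → ν <+: η → ν.length ≤ n → E (g η, f ν) (b, a)) ∧
      (∀ (ν : List ℕ) j0 j1, j0 < j1 → ν.length < n → p.R (f (ν ++ [j1])) (fun μ : List ℕ => f (ν ++ [j0] ++ μ))) := by
  classical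
  induction n with
  | zero =>
    refine ⟨fun _ => a, fun _ => b, a, fun _ => E.refl _, ?_, ?_, ?_⟩
    · exact I.mapr h (g := fun b => fun _ : List ℕ => b) (by fun_prop)
        (Good.tuple (ι := List ℕ) hb (v := fun _ => b) (fun _ => E.refl _) Co.id)
    · intro ν η h0 _ hl
      exact absurd (List.length_eq_zero_iff.1 (Nat.le_zero.1 hl)) h0
    · intro ν j0 j1 _ hl; omega
  | succ n ih =>
    obtain ⟨f, g, a', h1, h2, h3, h4⟩ := ih
    have haa' : E a a' := ((h1 []).map (f := fun q => q.1) (by fun_prop)).symm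
    let F : List ℕ → A := fun ν => if ν = [] then a' else f ν
    have hF0 : F [] = a' := by simp [F]
    have hF : ∀ ν, ν ≠ [] → F ν = f ν := fun ν hν => by simp [F, hν]
    obtain ⟨s, -, hs2, hs3⟩ := left_ext hp (hpa.of_E haa') (F, g)
    obtain ⟨u, hu⟩ := Mor.exists s (un : Un 𝕄)
    have hue : ∀ j, E (u j) (a', (F, g)) := fun j => hu.extE j hs2
    have hu0 : ∀ j, (u j).2.1 [] = (u j).1 := fun j =>
      (hue j).symm.eq_of (f := fun q : A × (List ℕ → A) × (List ℕ → B) => q.2.1 []) (g := fun q => q.1)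
        (by fun_prop) (by fun_prop) hF0
    have hg2 : Co (fun q : A × (List ℕ → A) × (List ℕ → B) => q.2.2) := by fun_prop
    have hind : Ind (s.map _ hg2) a' g := h2 _ (hs2.map hg2)
    obtain ⟨a'', hc1, hc2⟩ := chain hind (hu.map hg2)
    let f' : List ℕ → A := fun ν => match ν with
      | [] => a
      | j :: ν => (u j).2.1 ν
    let rs : (ℕ → List ℕ → B) → List ℕ → B := fun v η => match η with
      | [] => v 0 []
      | j :: η => v j η
    have hrs : Co rs := Co.pi fun η => by cases η <;> dsimp only [rs] <;> fun_prop
    have hG0 : ∀ η, E (a'', rs (fun j => (u j).2.2) η) (a, b) := by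
      intro η
      have : ∀ j η, E (a'', (u j).2.2 η) (a, b) := fun j η =>
        ((hc2 j).map (f := fun q : A × (List ℕ → B) => (q.1, q.2 η)) (by fun_prop)).trans (h1 η)
      cases η with
      | nil => exact this 0 []
      | cons j η => exact this j η
    refine ⟨f', rs (fun j => (u j).2.2), a'', hG0, ?_, ?_, ?_⟩
    · refine I.of ?_ (hc1.mapr hrs)
      exact Good.tuple (ι := List ℕ) hb (v := rs (fun j => (u j).2.2))
        (fun η => (hG0 η).map (f := fun q => q.2) (by fun_prop)) Co.id
    · intro ν η h0 hpre hl
      match ν, η, hpre, h0 with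
      | j :: ν, j' :: η, hpre, _ =>
        obtain ⟨rfl, hpre'⟩ := List.cons_prefix_cons.1 hpre
        have e1 := (hue j).map (f := fun q : A × (List ℕ → A) × (List ℕ → B) => (q.2.2 η, q.2.1 ν)) (by fun_prop)
        refine e1.trans ?_
        by_cases hν : ν = []
        · subst hν
          dsimp only
          rw [hF0]
          exact (h1 η).map (f := fun q => (q.2, q.1)) (by fun_prop)
        · dsimp only
          rw [hF ν hν]
          exact h3 ν η hν hpre' (by simpa using hl)
    · intro ν j0 j1 hj hl
      cases ν with
      | nil =>
        change p.R ((u j1).2.1 []) (fun μ => (u j0).2.1 μ)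
        rw [hu0]
        have := hs3 _ _ _ (hu j1)
        exact p.mono this (f := fun q : (Fin j1 → A × (List ℕ → A) × (List ℕ → B)) × Un 𝕄 => (q.1 ⟨j0, hj⟩).2.1) (by fun_prop)
      | cons j ν =>
        have hR := h4 ν j0 j1 hj (by simpa using hl)
        change p.R ((u j).2.1 (ν ++ [j1])) (fun μ => (u j).2.1 (ν ++ [j0] ++ μ))
        have e1 := (hue j).symm.map (f := fun q : A × (List ℕ → A) × (List ℕ → B) =>
          (q.2.1 (ν ++ [j1]), fun μ : List ℕ => q.2.1 (ν ++ [j0] ++ μ))) (by fun_prop)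
        refine p.closed hR ?_
        have e2 : (fun μ => F (ν ++ [j0] ++ μ)) = (fun μ => f (ν ++ [j0] ++ μ)) := funext fun μ => hF _ (by simp)
        dsimp only at e1
        rw [hF _ (by simp), e2] at e1
        exact e1

/-- symmetry -/
theorem S {a : A} {b : B} (ha : Good a) (hb : Good b) (h : I a b) : I b a := by
  classical
  obtain ⟨p, hp, hpa⟩ := exists_coheir a
  suffices Ind p b a from I.of ha this
  by_contra hc
  obtain ⟨P, hP, hPab, hd⟩ := exists_Dv hpa hc
  obtain ⟨k, hk⟩ := hd.finF hP
  refine AL ha hP (k := k) fun n => ?_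
  obtain ⟨f, g, a', h1, -, h3, h4⟩ := S_tree hb h hp hpa n
  let W : Fin 0 → A := fun i => i.elim0
  obtain ⟨c, hc1, hc2⟩ := satG (X := ℕ → A × A)
    (J := (i : ℕ) × {Q : ((Fin 0 → A) × (Fin i → A × A)) × A → Prop // Def Q})
    (fun c => ∃ u : ℕ → ℕ × ℕ, (∀ i, (u i).1 < (u i).2) ∧ c = cOf f u)
    (fun Q c => Q.2.1 ((W, fun j : Fin Q.1 => c j), (c Q.1).1) ↔ Q.2.1 ((W, fun j : Fin Q.1 => c j), (c Q.1).2))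
    (fun Q => by
      have hW : Co (fun _ : ℕ → A × A => W) := Co.pi fun i => i.elim0
      exact (Q.2.2.comp (f := fun c : ℕ → A × A => ((W, fun j : Fin Q.1 => c j), (c Q.1).1)) (by fun_prop)).iff
        (Q.2.2.comp (f := fun c : ℕ → A × A => ((W, fun j : Fin Q.1 => c j), (c Q.1).2)) (by fun_prop)))
    (fun s => by
      obtain ⟨u, hu1, hu2⟩ := cOf_exists f s W
      exact ⟨cOf f u, ⟨u, hu1, rfl⟩, hu2⟩)
  refine ⟨W, c, fun i => i.elim0, ?_, ?_, ?_, ?_⟩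
  · intro i hi
    refine E.symm fun Q hQ hQa => hc2 (fun c => Q (c i).1) (hQ.comp (f := fun c : ℕ → A × A => (c i).1) (by fun_prop)) ?_
    rintro _ ⟨u, hu, rfl⟩
    have := h3 (pth u (i+1)) (pth u (i+1)) (by rw [pth_succ]; simp) (List.prefix_refl _) (by rw [pth_length]; omega)
    rw [pth_succ] at this
    exact (this.map (f := fun q => q.2) (by fun_prop)).symm Q hQ hQa
  · intro i hi Q hQ hx
    exact (hc1 ⟨i, Q, hQ⟩).1 hx
  · have hdef : Def (fun c : ℕ → A × A => ∃ x, ∀ i ∈ Finset.range n, P (x, (c i).1)) := by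
      refine Def.ex (P := fun q : (ℕ → A × A) × B => ∀ i ∈ Finset.range n, P (q.2, (q.1 i).1)) ?_
      exact Def.ball _ fun i _ => hP.comp (f := fun q : (ℕ → A × A) × B => (q.2, (q.1 i).1)) (by fun_prop)
    obtain ⟨x, hx⟩ := hc2 _ hdef (by
      rintro _ ⟨u, hu, rfl⟩
      refine ⟨g (pth u n), fun i hi => ?_⟩
      have hi' := Finset.mem_range.1 hi
      have := h3 (pth u (i+1)) (pth u n) (by rw [pth_succ]; simp) (pth_initial u hi') (by rw [pth_length]; omega)
      rw [pth_succ] at this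
      exact this.symm P hP hPab)
    exact ⟨x, fun j => j.elim0, fun i hi => hx i (Finset.mem_range.2 hi)⟩
  · intro s hs hcard
    have hdef : Def (fun c : ℕ → A × A => ∃ x, ∀ i ∈ s, P (x, (c i).2)) := by
      refine Def.ex (P := fun q : (ℕ → A × A) × B => ∀ i ∈ s, P (q.2, (q.1 i).2)) ?_
      exact Def.ball _ fun i _ => hP.comp (f := fun q : (ℕ → A × A) × B => (q.2, (q.1 i).2)) (by fun_prop)
    have := hc2 _ hdef.not (by
      rintro _ ⟨u, hu, rfl⟩ ⟨x, hx⟩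
      have hM : MorF p (un : Un 𝕄) (fun l : Fin n => (cOf f u (n - 1 - l)).2) := by
        intro l
        have hR := h4 (pth u (n-1-l)) _ _ (hu (n-1-l)) (by rw [pth_length]; omega)
        have hex : ∀ j : Fin l, ∃ μ, (cOf f u (n-1-j)).2 = f (pth u (n-1-l) ++ [(u (n-1-l)).1] ++ μ) := by
          intro j
          obtain ⟨μ, hμ⟩ := pth_initial u (i := n-1-l+1) (j := n-1-j) (by omega)
          refine ⟨μ ++ [(u (n-1-j)).2], ?_⟩
          rw [cOf, ← hμ, pth_succ]
          simp only [List.append_assoc]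
        choose μ hμ using hex
        have := p.mono hR (f := fun q : List ℕ → A => ((fun j : Fin l => q (μ j)), (un : Un 𝕄))) (by fun_prop)
        simp only [← hμ] at this
        exact this
      refine hk n _ hM (Finset.univ.filter fun l : Fin n => n - 1 - l.1 ∈ s) ?_ ⟨x, fun i hi => hx _ (by simpa using hi)⟩
      have hle : s.card ≤ (Finset.univ.filter fun l : Fin n => n - 1 - l.1 ∈ s).card := by
        have hsub : s ⊆ (Finset.univ.filter fun l : Fin n => n - 1 - l.1 ∈ s).image (fun l => n - 1 - l.1) := by
          intro i hi
          have := hs i hi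
          refine Finset.mem_image.2 ⟨⟨n-1-i, by omega⟩, ?_, ?_⟩
          · simp only [Finset.mem_filter, Finset.mem_univ, true_and]
            have : n - 1 - (n - 1 - i) = i := by omega
            rwa [this]
          · dsimp only; omega
        exact (Finset.card_le_card hsub).trans Finset.card_image_le
      omega)
    rintro ⟨x, -, hx⟩
    exact this ⟨x, hx⟩

end Abs

namespace Abs
open Filter

set_option linter.unusedSectionVars false
variable {𝕄 : Type w} [DSys 𝕄]
variable {X Y Z A B : Type w} [Srt 𝕄 X] [Srt 𝕄 Y] [Srt 𝕄 Z] [Srt 𝕄 A] [Srt 𝕄 B]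

theorem WIT {a a' : A} {b : X} {c : Z} (ha : Good a) (hbc : ∀ b' c', E b' b → E c' c → Good (b', c'))
    {q : IT X} (hq : IsCoheir q) (hqb : q.Ext b) (e : E a a') (hab : I a b) (hac : I a' c) :
    ∃ a'' b'' c'', q.R b'' c'' ∧ E (a'', b'') (a, b) ∧ E (a'', c'') (a', c) ∧ I a'' (b'', c'') := by
  have hgb : Good b := (hbc b c (E.refl _) (E.refl _)).map (f := fun q => q.1) (by fun_prop)
  have hgc : Good c := (hbc b c (E.refl _) (E.refl _)).map (f := fun q => q.2) (by fun_prop)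
  obtain ⟨p, -, hpa⟩ := exists_coheir a
  have h1 := S ha hgb hab
  have h2 := S (ha.E e) hgc hac
  obtain ⟨c1, hc1⟩ := homog e.symm c
  have h3 : I c1 a := h2.E (hc1.map (f := fun q => (q.2, q.1)) (by fun_prop))
  obtain ⟨b', c', hb', hc', h4⟩ := join (h1 p hpa) (h3 p hpa)
  have eb : E b' b := hb'.map (f := fun q => q.1) (by fun_prop)
  have ec : E c' c := (hc'.map (f := fun q => q.1) (by fun_prop)).trans
    (hc1.map (f := fun q => q.2) (by fun_prop)).symm
  have h5 : I a (b', c') := S (hbc _ _ eb ec) ha (I.of ha h4)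
  obtain ⟨s, -, hs2, hs3⟩ := left_ext hq (hqb.of_E eb.symm) c'
  obtain ⟨u, hu⟩ := Mor.exists s (un : Un 𝕄)
  obtain ⟨a'', h6, h7⟩ := chain (h5 s hs2) hu
  have e1 : E (a'', (u 1).1) (a, b) :=
    ((h7 1).map (f := fun q : A × X × Z => (q.1, q.2.1)) (by fun_prop)).trans
      (hb'.map (f := fun q => (q.2, q.1)) (by fun_prop))
  have e2 : E (a'', (u 0).2) (a', c) :=
    (((h7 0).map (f := fun q : A × X × Z => (q.1, q.2.2)) (by fun_prop)).trans
      (hc'.map (f := fun q => (q.2, q.1)) (by fun_prop))).trans hc1.symm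
  refine ⟨a'', (u 1).1, (u 0).2, ?_, e1, e2, ?_⟩
  · exact q.mono (hs3 _ _ _ (hu 1)) (f := fun q : (Fin 1 → X × Z) × Un 𝕄 => (q.1 0).2) (by fun_prop)
  · have := h6.mapr (g := fun u : ℕ → X × Z => ((u 1).1, (u 0).2)) (by fun_prop)
    exact I.of (hbc _ _ (e1.map (f := fun q => q.2) (by fun_prop)) (e2.map (f := fun q => q.2) (by fun_prop))) this

/-- snoc -/
def sn {V : Type*} {n : ℕ} (v : Fin n → V) (x : V) : Fin (n+1) → V :=
  fun i => if h : i.1 < n then v ⟨i, h⟩ else x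

theorem sn_lt {V : Type*} {n : ℕ} (v : Fin n → V) (x : V) {i : ℕ} (h : i < n) (h') : sn v x ⟨i, h'⟩ = v ⟨i, h⟩ := by
  simp [sn, h]
theorem sn_last {V : Type*} {n : ℕ} (v : Fin n → V) (x : V) (h') : sn v x ⟨n, h'⟩ = x := by
  simp [sn]

@[fun_prop] theorem Co.sn {n : ℕ} {f : Z → Fin n → X} {g : Z → X} (hf : Co f) (hg : Co g) :
    Co (fun z => Abs.sn (f z) (g z)) := by
  refine Co.pi fun i => ?_
  by_cases hi : i.1 < n
  · simp only [Abs.sn, hi, dite_true]; fun_prop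
  · simp only [Abs.sn, hi, dite_false]; fun_prop

theorem sn_all {n : ℕ} {v : Fin n → X} {x : X} {C : X → Prop} (h : ∀ i, C (v i)) (h' : C x) (i) : C (sn v x i) := by
  unfold sn
  split_ifs
  · exact h _
  · assumption

/-- adding a realization on the left -/
theorem I.add {a : A} {b : X} (h : I a b) {q : IT Y} {z : Y} (hz : q.R z (a, b)) : I (a, z) b := by
  intro P hP
  obtain ⟨u, hu⟩ := Mor.exists P (un : Un 𝕄)
  obtain ⟨a', ha'⟩ := (h P hP).2 u hu
  obtain ⟨z', hz'⟩ := q.ex (a', u)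
  refine Ind.of_ex hu (a' := (a', z')) fun i => ?_
  have h1 := q.mono hz' (f := fun t : A × (ℕ → X) => (t.1, t.2 i)) (by fun_prop)
  exact (q.uniq h1 hz (ha' i)).map (f := fun t => ((t.2.1, t.1), t.2.2)) (by fun_prop)

theorem ZZ {a : A} {b : X} (ha : Good a) (hb : Good b) (hab : I a b) {p : IT A} (hp : IsCoheir p)
    (hpa : p.Ext a) {q : IT X} (hqb : q.Ext b) (n : ℕ) :
    ∃ (Y : Fin n → A) (Z : Fin n → X),
      (∀ m (hm : m < n), q.R (Z ⟨m, hm⟩) ((fun j : Fin m => Y ⟨j, j.2.trans hm⟩), fun j : Fin m => Z ⟨j, j.2.trans hm⟩)) ∧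
      (∀ m (hm : m < n), p.R (Y ⟨m, hm⟩) (fun j : Fin m => Y ⟨j, j.2.trans hm⟩)) ∧
      (∀ i j : Fin n, i ≤ j → E (Y j, Z i) (a, b)) ∧ I Z Y := by
  induction n with
  | zero =>
    refine ⟨fun i => i.elim0, fun i => i.elim0, fun m hm => absurd hm (by omega), fun m hm => absurd hm (by omega),
      fun i => i.elim0, fun P hP => ?_⟩
    obtain ⟨u, hu⟩ := Mor.exists P (un : Un 𝕄)
    refine Ind.of_ex hu (a' := fun i => i.elim0) fun i => ?_
    have : u i = fun i => i.elim0 := funext fun j => j.elim0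
    rw [this]
    exact E.refl _
  | succ n ih =>
    obtain ⟨Y, Z, h1, h2, h3, h4⟩ := ih
    obtain ⟨z, hz⟩ := q.ex (Y, Z)
    have h5 : I (sn Z z) Y := (h4.add (q := q) (z := z) (q.mono hz (f := fun t => (t.2, t.1)) (by fun_prop))).mapl
      (g := fun t : (Fin n → X) × X => sn t.1 t.2) (by fun_prop)
    have hMF : MorF q (un : Un 𝕄) (sn Z z) := by
      rintro ⟨m, hm⟩
      rcases Nat.lt_succ_iff_lt_or_eq.1 hm with hm' | rfl
      · have := q.mono (h1 m hm') (f := fun t : (Fin m → A) × (Fin m → X) => (t.2, (un : Un 𝕄))) (by fun_prop)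
        rw [sn_lt _ _ hm']
        convert this using 2
        funext j
        exact sn_lt _ _ (j.2.trans hm') _
      · have := q.mono hz (f := fun t => (t.2, (un : Un 𝕄))) (by fun_prop)
        rw [sn_last]
        convert this using 2
        funext j
        exact sn_lt _ _ j.2 _
    have hZb : ∀ i, E (sn Z z i) b := fun i => (hMF i).ext.E hqb
    obtain ⟨u, hu⟩ := Mor.exists q (un : Un 𝕄)
    obtain ⟨a0, h6, h7⟩ := chain (hab q hqb) hu
    have e1 := ((hu.fin (n+1)).uniq hMF (E.refl _)).map (f := fun t => t.1) (by fun_prop)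
    obtain ⟨a1, ha1⟩ := homog' e1 a0
    have hgZ : ∀ v : Fin (n+1) → X, (∀ i, E (v i) b) → Good v := fun v hv => Good.tuple hb hv Co.id
    have h8 : I a0 (fun i : Fin (n+1) => u i) := I.of (hgZ _ fun i => hu.extE _ hqb)
      (h6.mapr (g := fun u : ℕ → X => fun i : Fin (n+1) => u i) (by fun_prop))
    have ea1 : E a1 a := ((ha1.map (f := fun t => t.1) (by fun_prop)).symm).trans
      ((h7 0).map (f := fun t => t.1) (by fun_prop))
    have h9 : I (sn Z z) a1 := S (ha.E ea1.symm) (hgZ _ hZb) (h8.E ha1)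
    have hYa : ∀ i, E (Y i) a := fun i => (h2 i.1 i.2).ext.E hpa
    obtain ⟨Z', y', Y', k1, k2, k3, k4⟩ := WIT (a := sn Z z) (a' := sn Z z) (b := a1) (c := Y) (hgZ _ hZb) (by
      intro b' c' eb ec
      have := Good.tuple (ι := Fin (n+1)) ha (v := sn c' b') (f := fun v => (v ⟨n, by omega⟩, fun i : Fin n => v ⟨i, by omega⟩))
        (sn_all (C := fun x => E x a) (fun i => (ec.map (f := fun v : Fin n → A => v i) (by fun_prop)).trans (hYa i)) (eb.trans ea1)) (by fun_prop)
      convert this using 2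
      · simp [sn]
      · simp [sn]) hp (hpa.of_E ea1.symm) (E.refl _) h9 h5
    refine ⟨sn Y' y', Z', ?_, ?_, ?_, ?_⟩
    · intro m hm
      rcases Nat.lt_succ_iff_lt_or_eq.1 hm with hm' | rfl
      · have := q.closed (h1 m hm') (x' := Z' ⟨m, hm⟩) (y' := ((fun j : Fin m => Y' ⟨j, j.2.trans hm'⟩), fun j : Fin m => Z' ⟨j, j.2.trans hm⟩)) (by
          have := k3.symm.map (f := fun t : (Fin (n+1) → X) × (Fin n → A) =>
            (t.1 ⟨m, hm⟩, (fun j : Fin m => t.2 ⟨j, j.2.trans hm'⟩), fun j : Fin m => t.1 ⟨j, j.2.trans hm⟩)) (by fun_prop)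
          dsimp only at this
          rw [sn_lt _ _ hm'] at this
          have e2 : (fun j : Fin m => sn Z z ⟨j, j.2.trans hm⟩) = fun j : Fin m => Z ⟨j, j.2.trans hm'⟩ :=
            funext fun j => sn_lt _ _ (j.2.trans hm') _
          rw [e2] at this
          exact this)
        convert this using 2
        funext j
        exact sn_lt _ _ (j.2.trans hm') _
      · have := q.closed hz (x' := Z' ⟨m, hm⟩) (y' := (Y', fun j : Fin m => Z' ⟨j, j.2.trans hm⟩)) (by
          have := k3.symm.map (f := fun t : (Fin (m+1) → X) × (Fin m → A) =>
            (t.1 ⟨m, hm⟩, t.2, fun j : Fin m => t.1 ⟨j, j.2.trans hm⟩)) (by fun_prop)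
          dsimp only at this
          rw [sn_last] at this
          have e2 : (fun j : Fin m => sn Z z ⟨j, j.2.trans hm⟩) = Z :=
            funext fun j => sn_lt _ _ j.2 _
          rw [e2] at this
          exact this)
        convert this using 2
        funext j
        exact sn_lt _ _ j.2 _
    · intro m hm
      rcases Nat.lt_succ_iff_lt_or_eq.1 hm with hm' | rfl
      · have := p.closed (h2 m hm') ((k3.symm.map (f := fun t : (Fin (n+1) → X) × (Fin n → A) =>
            (t.2 ⟨m, hm'⟩, (fun j : Fin m => t.2 ⟨j, j.2.trans hm'⟩))) (by fun_prop)))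
        rw [sn_lt _ _ hm']
        convert this using 2
        exact sn_lt _ _ (Fin.is_lt _ |>.trans hm') _
      · rw [sn_last]
        convert k1 using 2
        exact sn_lt _ _ (Fin.is_lt _) _
    · rintro ⟨i, hi⟩ ⟨j, hj⟩ hij
      have hij' : i ≤ j := hij
      rcases Nat.lt_succ_iff_lt_or_eq.1 hj with hj' | rfl
      · have hi' : i < n := by omega
        have := k3.map (f := fun t : (Fin (n+1) → X) × (Fin n → A) => (t.2 ⟨j, hj'⟩, t.1 ⟨i, hi⟩)) (by fun_prop)
        dsimp only at this
        rw [sn_lt _ _ hi'] at this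
        rw [sn_lt _ _ hj']
        exact this.trans (h3 ⟨i, hi'⟩ ⟨j, hj'⟩ hij')
      · have t1 := k2.map (f := fun t : (Fin (j+1) → X) × A => (t.2, t.1 ⟨i, hi⟩)) (by fun_prop)
        have t2 := ha1.symm.map (f := fun t : A × (Fin (j+1) → X) => (t.1, t.2 ⟨i, hi⟩)) (by fun_prop)
        rw [sn_last]
        exact (t1.trans t2).trans (h7 i)
    · refine k4.mapr (g := fun t : A × (Fin n → A) => sn t.2 t.1) (by fun_prop) ?_
      refine Good.tuple ha (v := sn Y' y') (sn_all (C := fun x => E x a) (fun i => ?_) ?_) Co.id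
      · exact (k3.map (f := fun t : (Fin (n+1) → X) × (Fin n → A) => t.2 i) (by fun_prop)).trans (hYa i)
      · exact (k2.map (f := fun t => t.2) (by fun_prop)).trans ea1

end Abs

namespace Abs
open Filter

set_option linter.unusedSectionVars false
variable {𝕄 : Type w} [DSys 𝕄]
variable {X Y Z A B C : Type w} [Srt 𝕄 X] [Srt 𝕄 Y] [Srt 𝕄 Z] [Srt 𝕄 A] [Srt 𝕄 B] [Srt 𝕄 C]

/-- abstract NSOP3 -/
def NS3 (𝕄 : Type w) [DSys 𝕄] : Prop := ∀ (X : Type w) [Srt 𝕄 X] (R : X × X → Prop), Def R →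
  (∀ n, ∃ e : Fin n → X, ∀ i j : Fin n, i < j → R (e i, e j)) → ∃ x y z, R (x, y) ∧ R (y, z) ∧ R (z, x)

theorem ZZ_tail {q : IT X} {n : ℕ} {Y : Fin n → A} {Z : Fin n → X}
    (h : ∀ m (hm : m < n), q.R (Z ⟨m, hm⟩) ((fun j : Fin m => Y ⟨j, j.2.trans hm⟩), fun j : Fin m => Z ⟨j, j.2.trans hm⟩))
    (m : ℕ) (hm : m ≤ n) :
    MorF q (fun j : Fin m => Y ⟨j, by omega⟩) (fun l : Fin (n - m) => Z ⟨m + l, by omega⟩) := by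
  intro l
  exact q.mono (h (m + l) (by omega)) (f := fun t : (Fin (m+l) → A) × (Fin (m+l) → X) =>
    ((fun j : Fin l => t.2 ⟨m + j, by omega⟩), fun j : Fin m => t.1 ⟨j, by omega⟩)) (by fun_prop)

theorem MW (hN : NS3 𝕄) {a a' : A} {b : X} {c : C} (ha : Good a) (hb : Good b) (e : E a a') (hab : I a b)
    (hca : I c a') {q : IT X} (hq : q.Ext b) :
    ∃ a'' b'' c'', q.R b'' c'' ∧ E (a'', b'') (a, b) ∧ E (a'', c'') (a', c) := by
  classical
  obtain ⟨p, hp, hpa⟩ := exists_coheir a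
  obtain ⟨b0, hb0⟩ := q.ex c
  suffices ∀ (φ : A × X → Prop) (ψ : A × C → Prop) (θ : X × C → Prop), Def φ → Def ψ → Def θ → φ (a, b) →
      ψ (a', c) → θ (b0, c) → ∃ x y z, φ (x, y) ∧ ψ (x, z) ∧ θ (y, z) by
    obtain ⟨⟨a'', b'', c''⟩, h1⟩ := sat0 (X := A × X × C)
      (ι := {φ : A × X → Prop // Def φ ∧ φ (a, b)} ⊕ {ψ : A × C → Prop // Def ψ ∧ ψ (a', c)} ⊕ {θ : X × C → Prop // Def θ ∧ θ (b0, c)})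
      (fun i t => Sum.elim (fun φ => φ.1 (t.1, t.2.1)) (Sum.elim (fun ψ => ψ.1 (t.1, t.2.2)) (fun θ => θ.1 (t.2.1, t.2.2))) i)
      (by
        rintro (φ | ψ | θ)
        · exact φ.2.1.comp (f := fun t : A × X × C => (t.1, t.2.1)) (by fun_prop)
        · exact ψ.2.1.comp (f := fun t : A × X × C => (t.1, t.2.2)) (by fun_prop)
        · exact θ.2.1.comp (f := fun t : A × X × C => (t.2.1, t.2.2)) (by fun_prop))
      (by
        intro s
        obtain ⟨x, y, z, h1, h2, h3⟩ := this
          (fun t => ∀ φ ∈ s.preimage Sum.inl Sum.inl_injective.injOn, φ.1 t)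
          (fun t => ∀ φ ∈ s.preimage (Sum.inr ∘ Sum.inl) (Sum.inr_injective.comp Sum.inl_injective).injOn, φ.1 t)
          (fun t => ∀ φ ∈ s.preimage (Sum.inr ∘ Sum.inr) (Sum.inr_injective.comp Sum.inr_injective).injOn, φ.1 t)
          (Def.ball _ fun φ _ => φ.2.1) (Def.ball _ fun φ _ => φ.2.1) (Def.ball _ fun φ _ => φ.2.1)
          (fun φ _ => φ.2.2) (fun φ _ => φ.2.2) (fun φ _ => φ.2.2)
        refine ⟨(x, y, z), ?_⟩
        rintro (φ | ψ | θ) hi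
        · exact h1 φ (by simpa using hi)
        · exact h2 ψ (by simpa using hi)
        · exact h3 θ (by simpa using hi))
    refine ⟨a'', b'', c'', q.closed hb0 (fun θ hθ hx => h1 (.inr (.inr ⟨θ, hθ, hx⟩))),
      E.symm fun φ hφ hx => h1 (.inl ⟨φ, hφ, hx⟩), E.symm fun ψ hψ hx => h1 (.inr (.inl ⟨ψ, hψ, hx⟩))⟩
  intro φ ψ θ hφ hψ hθ hφ' hψ' hθ'
  obtain ⟨⟨y1, z1, c1⟩, ⟨y2, z2, c2⟩, ⟨y3, z3, c3⟩, h12, h23, h31⟩ := hN (A × X × C)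
    (fun t => φ (t.2.1, t.1.2.1) ∧ ψ (t.1.1, t.2.2.2) ∧ θ (t.2.2.1, t.1.2.2))
    ((hφ.comp (f := fun t : (A × X × C) × (A × X × C) => (t.2.1, t.1.2.1)) (by fun_prop)).and
      ((hψ.comp (f := fun t : (A × X × C) × (A × X × C) => (t.1.1, t.2.2.2)) (by fun_prop)).and
        (hθ.comp (f := fun t : (A × X × C) × (A × X × C) => (t.2.2.1, t.1.2.2)) (by fun_prop))))
    (by
      intro n
      obtain ⟨Y, Z, h1, h2, h3, -⟩ := ZZ ha hb hab hp hpa hq n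
      obtain ⟨u, hu⟩ := Mor.exists p (un : Un 𝕄)
      obtain ⟨c', hc'⟩ := (hca p (hpa.of_E e)).2 u hu
      have key : ∀ m : Fin n, ∃ cm : C, (∀ i : Fin n, i < m → E (cm, Y i) (c, a')) ∧ (∀ j : Fin n, m < j → q.R (Z j) cm) ∧ E c cm := by
        intro m
        have hY : MorF p (un : Un 𝕄) (fun j : Fin m => Y ⟨j, j.2.trans m.2⟩) := fun i =>
          p.mono (h2 i (i.2.trans m.2)) (f := fun t => (t, un)) (by fun_prop)
        obtain ⟨c1, hc1⟩ := homog' (((hu.fin m).uniq hY (E.refl _)).map (f := fun t => t.1) (by fun_prop)) c'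
        obtain ⟨w, hw⟩ := Mor.exists q (c1, fun j : Fin m => Y ⟨j, j.2.trans m.2⟩)
        have e1 := ((hw.mono (f := fun t => t.2) (by fun_prop)).fin (n - m)).uniq (ZZ_tail h1 m m.2.le) (E.refl _)
        obtain ⟨cm, hcm⟩ := homog' e1 c1
        refine ⟨cm, fun i hi => ?_, fun j hj => ?_, (((hcm.symm.map (f := fun t => t.1) (by fun_prop)).trans
          (hc1.symm.map (f := fun t => t.1) (by fun_prop))).trans ((hc' 0).map (f := fun t => t.1) (by fun_prop))).symm⟩
        · have hi' : i.1 < m.1 := hi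
          have t1 := hcm.symm.map (f := fun t : C × (Fin (n-m) → X) × (Fin m → A) => (t.1, t.2.2 ⟨i, hi'⟩)) (by fun_prop)
          have t2 := hc1.symm.map (f := fun t : C × (Fin m → A) => (t.1, t.2 ⟨i, hi'⟩)) (by fun_prop)
          exact (t1.trans t2).trans (hc' i)
        · have hj' : m.1 < j.1 := hj
          have t1 := q.mono (hw (j - m)) (f := fun t : (Fin (j-m) → X) × C × (Fin m → A) => t.2.1) (by fun_prop)
          have := q.closed t1 (hcm.map (f := fun t : C × (Fin (n-m) → X) × (Fin m → A) => (t.2.1 ⟨j - m, by omega⟩, t.1)) (by fun_prop))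
          dsimp only at this
          convert this using 2
          ext; simp; omega
      choose cc hcc1 hcc2 hcc3 using key
      refine ⟨fun i => (Y i, Z i, cc i), fun i j hij => ⟨?_, ?_, ?_⟩⟩
      · exact (h3 i j hij.le).symm φ hφ hφ'
      · exact ((hcc1 j i hij).map (f := fun t => (t.2, t.1)) (by fun_prop)).symm ψ hψ hψ'
      · exact q.uniq hb0 (hcc2 i j hij) (hcc3 i) θ hθ hθ')
  exact ⟨y1, z3, c2, h31.1, h12.2.1, h23.2.2⟩

theorem amalg (hN : NS3 𝕄) {a a' : A} {b : X} {c : Z} (ha : Good a) (hb : Good b) (hc : Good c) (e : E a a')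
    (hab : I a b) (hac : I a' c) (hbc : I b c) : ∃ a'', E (a'', b) (a, b) ∧ E (a'', c) (a', c) := by
  classical
  obtain ⟨p, hp, hpb⟩ := exists_coheir b
  obtain ⟨q, -, hqc⟩ := exists_coheir c
  suffices ∀ (φ : A × X → Prop) (ψ : A × Z → Prop) (θ : X × Z → Prop), Def φ → Def ψ → Def θ → φ (a, b) →
      ψ (a', c) → θ (b, c) → ∃ x y z, φ (x, y) ∧ ψ (x, z) ∧ θ (y, z) by
    obtain ⟨a'', h1⟩ := satX (X := A) (Y := X × Z)
      (ι := {φ : A × X → Prop // Def φ ∧ φ (a, b)} ⊕ {ψ : A × Z → Prop // Def ψ ∧ ψ (a', c)})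
      (fun i t => Sum.elim (fun φ => φ.1 (t.1, t.2.1)) (fun ψ => ψ.1 (t.1, t.2.2)) i)
      (by
        rintro (φ | ψ)
        · exact φ.2.1.comp (f := fun t : A × X × Z => (t.1, t.2.1)) (by fun_prop)
        · exact ψ.2.1.comp (f := fun t : A × X × Z => (t.1, t.2.2)) (by fun_prop)) (b, c)
      (by
        intro s
        have hd1 : Def (fun t : A × X => ∀ φ ∈ s.preimage Sum.inl Sum.inl_injective.injOn, φ.1 t) := Def.ball _ fun φ _ => φ.2.1
        have hd2 : Def (fun t : A × Z => ∀ φ ∈ s.preimage Sum.inr Sum.inr_injective.injOn, φ.1 t) := Def.ball _ fun φ _ => φ.2.1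
        have hd : Def (fun t : X × Z => ∃ x, (∀ φ ∈ s.preimage Sum.inl Sum.inl_injective.injOn, φ.1 (x, t.1)) ∧
            (∀ φ ∈ s.preimage Sum.inr Sum.inr_injective.injOn, φ.1 (x, t.2))) := by
          refine Def.ex (P := fun t : (X × Z) × A => (∀ φ ∈ s.preimage Sum.inl Sum.inl_injective.injOn, φ.1 (t.2, t.1.1)) ∧
            (∀ φ ∈ s.preimage Sum.inr Sum.inr_injective.injOn, φ.1 (t.2, t.1.2))) ?_
          exact (hd1.comp (f := fun t : (X × Z) × A => (t.2, t.1.1)) (by fun_prop)).and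
            (hd2.comp (f := fun t : (X × Z) × A => (t.2, t.1.2)) (by fun_prop))
        have hx : ∃ x, (∀ φ ∈ s.preimage Sum.inl Sum.inl_injective.injOn, φ.1 (x, b)) ∧
            (∀ φ ∈ s.preimage Sum.inr Sum.inr_injective.injOn, φ.1 (x, c)) := by
          by_contra hcon
          obtain ⟨x, y, z, h1, h2, h3⟩ := this _ _ _ hd1 hd2 hd.not (fun φ _ => φ.2.2) (fun φ _ => φ.2.2) hcon
          exact h3 ⟨x, h1, h2⟩
        obtain ⟨x, hx1, hx2⟩ := hx
        refine ⟨x, ?_⟩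
        rintro (φ | ψ) hi
        · exact hx1 φ (by simpa using hi)
        · exact hx2 ψ (by simpa using hi))
    exact ⟨a'', E.symm fun φ hφ hx => h1 (.inl ⟨φ, hφ, hx⟩), E.symm fun ψ hψ hx => h1 (.inr ⟨ψ, hψ, hx⟩)⟩
  -- cut amalgamation
  obtain ⟨v, hv⟩ := Mor.exists p (un : Un 𝕄)
  obtain ⟨a0, hva, hva'⟩ := chain (hab p hpb) hv
  obtain ⟨u, hu⟩ := Mor.exists q (un : Un 𝕄)
  obtain ⟨a1, hua, hua'⟩ := chain (hac q hqc) hu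
  have ea0 : E a0 a := (hva' 0).map (f := fun t => t.1) (by fun_prop)
  have ea1 : E a1 a := ((hua' 0).map (f := fun t => t.1) (by fun_prop)).trans e.symm
  have hgv : Good v := Good.tuple (ι := ℕ) hb (fun i => hv.extE i hpb) Co.id
  have hgu : Good u := Good.tuple (ι := ℕ) hc (fun i => hu.extE i hqc) Co.id
  have hva'' : I v a0 := S (ha.E ea0.symm) hgv (I.of hgv hva)
  obtain ⟨x0, u0, v0, hx1, hx2, hx3⟩ := MW hN (ha.E ea1.symm) hgu (ea1.trans ea0.symm) (I.of hgu hua) hva''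
    (q := q.pw) hu
  intro φ ψ θ hφ hψ hθ hφ' hψ' hθ'
  obtain ⟨⟨x1, y1, z1⟩, ⟨x2, y2, z2⟩, ⟨x3, y3, z3⟩, h12, h23, h31⟩ := hN (A × X × Z)
    (fun t => φ (t.2.1, t.1.2.1) ∧ ψ (t.1.1, t.2.2.2) ∧ θ (t.2.2.1, t.1.2.2))
    ((hφ.comp (f := fun t : (A × X × Z) × (A × X × Z) => (t.2.1, t.1.2.1)) (by fun_prop)).and
      ((hψ.comp (f := fun t : (A × X × Z) × (A × X × Z) => (t.1.1, t.2.2.2)) (by fun_prop)).and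
        (hθ.comp (f := fun t : (A × X × Z) × (A × X × Z) => (t.2.2.1, t.1.2.2)) (by fun_prop))))
    (by
      intro n
      obtain ⟨Y, Z', h1, h2, h3, -⟩ := ZZ hb hc hbc hp hpb hqc n
      have key : ∀ m : Fin n, ∃ x : A, (∀ i : Fin n, i < m → E (x, Y i) (a, b)) ∧ ∀ j : Fin n, m ≤ j → E (x, Z' j) (a', c) := by
        intro m
        have hY : MorF p (un : Un 𝕄) (fun j : Fin m => Y ⟨j, j.2.trans m.2⟩) := fun i =>
          p.mono (h2 i (i.2.trans m.2)) (f := fun t => (t, un)) (by fun_prop)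
        have hv0 : Mor p (un : Un 𝕄) v0 := hv.closed ((hx3.map (f := fun t => (t.2, (un : Un 𝕄))) (by fun_prop)).symm)
        have e0 := ((hv0.fin m).uniq hY (E.refl _)).map (f := fun t => t.1) (by fun_prop)
        have hu0 : Mor q (fun j : Fin m => v0 j) u0 := Mor.mono hx1 (f := fun v : ℕ → X => fun j : Fin m => v j) (by fun_prop)
        have e1 := (hu0.fin (n - m)).uniq (ZZ_tail h1 m m.2.le) e0
        obtain ⟨x, hx⟩ := homog' e1 x0
        refine ⟨x, fun i hi => ?_, fun j hj => ?_⟩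
        · have hi' : i.1 < m.1 := hi
          have t1 := hx.symm.map (f := fun t : A × (Fin (n-m) → Z) × (Fin m → X) => (t.1, t.2.2 ⟨i, hi'⟩)) (by fun_prop)
          exact (t1.trans (hx3.map (f := fun t : A × (ℕ → X) => (t.1, t.2 i)) (by fun_prop))).trans (hva' i)
        · have hj' : m.1 ≤ j.1 := hj
          have t1 := hx.symm.map (f := fun t : A × (Fin (n-m) → Z) × (Fin m → X) => (t.1, t.2.1 ⟨j - m, by omega⟩)) (by fun_prop)
          have := (t1.trans (hx2.map (f := fun t : A × (ℕ → Z) => (t.1, t.2 (j - m))) (by fun_prop))).trans (hua' (j-m))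
          have hjj : (⟨m + (j - m), by omega⟩ : Fin n) = j := by ext; simp; omega
          dsimp only at this
          rwa [hjj] at this
      choose xx hxx1 hxx2 using key
      refine ⟨fun i => (xx i, Y i, Z' i), fun i j hij => ⟨?_, ?_, ?_⟩⟩
      · exact (hxx1 j i hij).symm φ hφ hφ'
      · exact (hxx2 i j hij.le).symm ψ hψ hψ'
      · exact (h3 i j hij.le).symm θ hθ hθ')
  exact ⟨x1, y3, z2, h31.1, h12.2.1, h23.2.2⟩

end Abs

namespace Abs
open Filter

set_option linter.unusedSectionVars false
variable {𝕄 : Type w} [DSys 𝕄]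
variable {X Y Z A B C : Type w} [Srt 𝕄 X] [Srt 𝕄 Y] [Srt 𝕄 Z] [Srt 𝕄 A] [Srt 𝕄 B] [Srt 𝕄 C]

theorem Dv.bex {ι : Type r} (s : Finset ι) {p : IT X} {P : ι → A × X → Prop} (h : ∀ i ∈ s, Dv p (P i)) :
    Dv p (fun t => ∃ i ∈ s, P i t) := by
  classical
  rintro u hu ⟨a, ha⟩
  choose f hf hf' using ha
  have : ∃ i ∈ s, ∃ᶠ n in atTop, f n = i := by
    by_contra hc
    push Not at hc
    have h2 : ∀ᶠ n in atTop, ∀ i ∈ s, f n ≠ i :=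
      (Filter.eventually_all_finset s).2 fun i hi => by simpa [Filter.Frequently] using hc i hi
    obtain ⟨n, hn⟩ := h2.exists
    exact hn _ (hf n) rfl
  obtain ⟨i, hi, hfr⟩ := this
  obtain ⟨g, hg, hg'⟩ := Filter.extraction_of_frequently_atTop hfr
  exact h i hi _ (hu.sub hg) ⟨a, fun n => by have := hf' (g n); rwa [hg' n] at this⟩

theorem count_triple {N K : ℕ} (hN : 3 * K < N) (B1 B2 B3 : Fin N → Fin N → Fin N → Prop)
    (h1 : ∀ j k, ∀ s : Finset (Fin N), (∀ i ∈ s, B1 i j k) → s.card ≤ K)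
    (h2 : ∀ i k, ∀ s : Finset (Fin N), (∀ j ∈ s, B2 i j k) → s.card ≤ K)
    (h3 : ∀ i j, ∀ s : Finset (Fin N), (∀ k ∈ s, B3 i j k) → s.card ≤ K) :
    ∃ i j k, ¬ B1 i j k ∧ ¬ B2 i j k ∧ ¬ B3 i j k := by
  classical
  by_contra hc
  push Not at hc
  have e : ∀ i j k, 1 ≤ (if B1 i j k then 1 else 0) + (if B2 i j k then 1 else 0) + (if B3 i j k then 1 else 0) := by
    intro i j k
    have := hc i j k
    by_cases b1 : B1 i j k
    · simp [b1]; omega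
    · by_cases b2 : B2 i j k
      · simp [b2]; omega
      · simp [this b1 b2]
  have t : ∑ i : Fin N, ∑ j : Fin N, ∑ k : Fin N, 1 ≤ ∑ i : Fin N, ∑ j : Fin N, ∑ k : Fin N,
      ((if B1 i j k then 1 else 0) + (if B2 i j k then 1 else 0) + (if B3 i j k then 1 else 0)) :=
    Finset.sum_le_sum fun i _ => Finset.sum_le_sum fun j _ => Finset.sum_le_sum fun k _ => e i j k
  simp only [Finset.sum_add_distrib] at t
  have e1 : ∑ i : Fin N, ∑ j : Fin N, ∑ k : Fin N, (if B1 i j k then 1 else 0) ≤ N * (N * K) := by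
    rw [Finset.sum_comm]
    have : ∀ j : Fin N, ∑ i : Fin N, ∑ k : Fin N, (if B1 i j k then 1 else 0) ≤ N * K := fun j => by
      rw [Finset.sum_comm]
      refine (Finset.sum_le_sum (g := fun _ => K) fun k _ => ?_).trans (by simp)
      rw [Finset.sum_boole]
      exact h1 j k _ (by simp)
    exact (Finset.sum_le_sum fun j _ => this j).trans (by simp)
  have e2 : ∑ i : Fin N, ∑ j : Fin N, ∑ k : Fin N, (if B2 i j k then 1 else 0) ≤ N * (N * K) := by
    have : ∀ i : Fin N, ∑ j : Fin N, ∑ k : Fin N, (if B2 i j k then 1 else 0) ≤ N * K := fun i => by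
      rw [Finset.sum_comm]
      refine (Finset.sum_le_sum (g := fun _ => K) fun k _ => ?_).trans (by simp)
      rw [Finset.sum_boole]
      exact h2 i k _ (by simp)
    exact (Finset.sum_le_sum fun j _ => this j).trans (by simp)
  have e3 : ∑ i : Fin N, ∑ j : Fin N, ∑ k : Fin N, (if B3 i j k then 1 else 0) ≤ N * (N * K) := by
    have : ∀ i : Fin N, ∑ j : Fin N, ∑ k : Fin N, (if B3 i j k then 1 else 0) ≤ N * K := fun i => by
      refine (Finset.sum_le_sum (g := fun _ => K) fun k _ => ?_).trans (by simp)
      rw [Finset.sum_boole]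
      exact h3 i k _ (by simp)
    exact (Finset.sum_le_sum fun j _ => this j).trans (by simp)
  simp only [Finset.sum_const, Finset.card_univ, Fintype.card_fin, smul_eq_mul, mul_one] at t
  have hN0 : 0 < N := by omega
  have : N * (N * (3 * K)) < N * (N * N) := Nat.mul_lt_mul_of_pos_left (Nat.mul_lt_mul_of_pos_left hN hN0) hN0
  nlinarith

theorem blocks {a : A} {b : B} (ha : Good a) (hb : Good b) (h : I a b) {p : IT A} {q : IT B} (hp : p.Ext a) (hq : q.Ext b) :
    ∃ u v, Mor p (un : Un 𝕄) u ∧ Mor q (un : Un 𝕄) v ∧ I u v ∧ ∀ i j, E (u i, v j) (a, b) := by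
  obtain ⟨v, hv⟩ := Mor.exists q (un : Un 𝕄)
  obtain ⟨a', h1, h2⟩ := chain (h q hq) hv
  have ea : E a' a := (h2 0).map (f := fun t => t.1) (by fun_prop)
  have hgv : Good v := Good.tuple (ι := ℕ) hb (fun i => hv.extE i hq) Co.id
  have hS := S (ha.E ea.symm) hgv (I.of hgv h1)
  obtain ⟨u, hu⟩ := Mor.exists p (un : Un 𝕄)
  obtain ⟨v', h3, h4⟩ := chain (hS p (hp.of_E ea.symm)) hu
  have hgu : Good u := Good.tuple (ι := ℕ) ha (fun i => hu.extE i hp) Co.id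
  have ev : E v' v := (h4 0).map (f := fun t => t.1) (by fun_prop)
  refine ⟨u, v', hu, hv.closed (ev.symm.map (f := fun t => (t, (un : Un 𝕄))) (by fun_prop)),
    S (hgv.E ev.symm) hgu (I.of hgu h3), fun i j => ?_⟩
  exact ((h4 i).map (f := fun t : (ℕ → B) × A => (t.2, t.1 j)) (by fun_prop)).trans (h2 j)

theorem moreover (hN : NS3 𝕄) {a a' : A} {b : B} {c : C} (ha : Good a) (hb : Good b) (hc : Good c) (e : E a a')
    (hab : I a b) (hac : I a' c) (hbc : I b c) : ∃ a'', E (a'', b) (a, b) ∧ E (a'', c) (a', c) ∧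
      I (b, c) a'' ∧ I (b, a'') c ∧ I (c, a'') b := by
  classical
  obtain ⟨p, -, hp⟩ := exists_coheir a
  obtain ⟨q, -, hq⟩ := exists_coheir b
  obtain ⟨r, -, hr⟩ := exists_coheir c
  obtain ⟨v, w, hv, hw, hvw, hvw'⟩ := blocks hb hc hbc hq hr
  have hgv : Good v := Good.tuple (ι := ℕ) hb (fun i => hv.extE i hq) Co.id
  have hgw : Good w := Good.tuple (ι := ℕ) hc (fun i => hw.extE i hr) Co.id
  obtain ⟨u1, v1, hu1, hv1, huv, huv'⟩ := blocks ha hb hab hp hq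
  obtain ⟨u2, w2, hu2, hw2, huw, huw'⟩ := blocks (ha.E e) hc hac (hp.of_E e) hr
  obtain ⟨u3, hu3⟩ := homog' (hv1.E hv) u1
  obtain ⟨u4, hu4⟩ := homog' (hw2.E hw) u2
  have hm3 : Mor p (un : Un 𝕄) u3 := hu1.closed (hu3.map (f := fun t => (t.1, (un : Un 𝕄))) (by fun_prop))
  have hm4 : Mor p (un : Un 𝕄) u4 := hu2.closed (hu4.map (f := fun t => (t.1, (un : Un 𝕄))) (by fun_prop))
  have hgu : Good u3 := Good.tuple (ι := ℕ) ha (fun i => hm3.extE i hp) Co.id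
  obtain ⟨u, h1, h2⟩ := amalg hN hgu hgv hgw (hm3.E hm4) (huv.E hu3) (huw.E hu4) hvw
  have hu : Mor p (un : Un 𝕄) u := hm3.closed (h1.symm.map (f := fun t => (t.1, (un : Un 𝕄))) (by fun_prop))
  have huv1 : ∀ i j, E (u i, v j) (a, b) := fun i j =>
    ((h1.trans hu3.symm).map (f := fun t : (ℕ → A) × (ℕ → B) => (t.1 i, t.2 j)) (by fun_prop)).trans (huv' i j)
  have huw1 : ∀ i j, E (u i, w j) (a', c) := fun i j =>
    ((h2.trans hu4.symm).map (f := fun t : (ℕ → A) × (ℕ → C) => (t.1 i, t.2 j)) (by fun_prop)).trans (huw' i j)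
  obtain ⟨x, hx⟩ := satX (X := A) (Y := B × C)
    (ι := {P : A × B → Prop // Def P ∧ P (a, b)} ⊕ {P : A × C → Prop // Def P ∧ P (a', c)} ⊕
      {P : (B × C) × A → Prop // Def P ∧ Dv p P} ⊕ {P : (B × A) × C → Prop // Def P ∧ Dv r P} ⊕
      {P : (C × A) × B → Prop // Def P ∧ Dv q P})
    (fun i t => Sum.elim (fun P => P.1 (t.1, t.2.1)) (Sum.elim (fun P => P.1 (t.1, t.2.2))
      (Sum.elim (fun P => ¬ P.1 (t.2, t.1)) (Sum.elim (fun P => ¬ P.1 ((t.2.1, t.1), t.2.2))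
        (fun P => ¬ P.1 ((t.2.2, t.1), t.2.1))))) i)
    (by
      rintro (P | P | P | P | P)
      · exact P.2.1.comp (f := fun t : A × B × C => (t.1, t.2.1)) (by fun_prop)
      · exact P.2.1.comp (f := fun t : A × B × C => (t.1, t.2.2)) (by fun_prop)
      · exact (P.2.1.comp (f := fun t : A × B × C => (t.2, t.1)) (by fun_prop)).not
      · exact (P.2.1.comp (f := fun t : A × B × C => ((t.2.1, t.1), t.2.2)) (by fun_prop)).not
      · exact (P.2.1.comp (f := fun t : A × B × C => ((t.2.2, t.1), t.2.1)) (by fun_prop)).not)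
    (b, c)
    (by
      intro s
      let s1 := s.preimage (Sum.inr ∘ Sum.inr ∘ Sum.inl)
        (Sum.inr_injective.comp (Sum.inr_injective.comp Sum.inl_injective)).injOn
      let s2 := s.preimage (Sum.inr ∘ Sum.inr ∘ Sum.inr ∘ Sum.inl)
        (Sum.inr_injective.comp (Sum.inr_injective.comp (Sum.inr_injective.comp Sum.inl_injective))).injOn
      let s3 := s.preimage (Sum.inr ∘ Sum.inr ∘ Sum.inr ∘ Sum.inr)
        (Sum.inr_injective.comp (Sum.inr_injective.comp (Sum.inr_injective.comp Sum.inr_injective))).injOn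
      have d1 := Dv.bex s1 (p := p) (P := fun i => i.1) (fun i _ => i.2.2)
      have d2 := Dv.bex s2 (p := r) (P := fun i => i.1) (fun i _ => i.2.2)
      have d3 := Dv.bex s3 (p := q) (P := fun i => i.1) (fun i _ => i.2.2)
      have f1 : Def (fun t : (B × C) × A => ∃ i ∈ s1, i.1 t) :=
        (Def.ball s1 (P := fun i t => ¬ i.1 t) fun i _ => i.2.1.not).not.congr fun t => by push Not; rfl
      have f2 : Def (fun t : (B × A) × C => ∃ i ∈ s2, i.1 t) :=
        (Def.ball s2 (P := fun i t => ¬ i.1 t) fun i _ => i.2.1.not).not.congr fun t => by push Not; rfl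
      have f3 : Def (fun t : (C × A) × B => ∃ i ∈ s3, i.1 t) :=
        (Def.ball s3 (P := fun i t => ¬ i.1 t) fun i _ => i.2.1.not).not.congr fun t => by push Not; rfl
      obtain ⟨k1, hk1⟩ := d1.finF f1
      obtain ⟨k2, hk2⟩ := d2.finF f2
      obtain ⟨k3, hk3⟩ := d3.finF f3
      obtain ⟨i, j, k, g1, g2, g3⟩ := count_triple (N := 3 * (k1 + k2 + k3) + 1) (K := k1 + k2 + k3) (by omega)
        (fun i j k => ∃ P ∈ s1, P.1 ((v j, w k), u i)) (fun i j k => ∃ P ∈ s3, P.1 ((w k, u i), v j))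
        (fun i j k => ∃ P ∈ s2, P.1 ((v j, u i), w k))
        (fun j k t ht => by
          by_contra hcon
          exact hk1 _ _ (hu.fin _) t (by omega) ⟨_, ht⟩)
        (fun i k t ht => by
          by_contra hcon
          exact hk3 _ _ (hv.fin _) t (by omega) ⟨_, ht⟩)
        (fun i j t ht => by
          by_contra hcon
          exact hk2 _ _ (hw.fin _) t (by omega) ⟨_, ht⟩)
      obtain ⟨x, hx⟩ := homog' (hvw' j k) (u i)
      have t1 : E (x, b) (a, b) := (hx.symm.map (f := fun t : A × B × C => (t.1, t.2.1)) (by fun_prop)).trans (huv1 i j)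
      have t2 : E (x, c) (a', c) := (hx.symm.map (f := fun t : A × B × C => (t.1, t.2.2)) (by fun_prop)).trans (huw1 i k)
      refine ⟨x, ?_⟩
      rintro (P | P | P | P | P) hP
      · exact t1.symm _ P.2.1 P.2.2
      · exact t2.symm _ P.2.1 P.2.2
      · intro hcon
        exact g1 ⟨P, by simpa [s1] using hP, hx.symm _ (P.2.1.comp (f := fun t : A × B × C => (t.2, t.1)) (by fun_prop)) hcon⟩
      · intro hcon
        exact g3 ⟨P, by simpa [s2] using hP, hx.symm _ (P.2.1.comp (f := fun t : A × B × C => ((t.2.1, t.1), t.2.2)) (by fun_prop)) hcon⟩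
      · intro hcon
        exact g2 ⟨P, by simpa [s3] using hP, hx.symm _ (P.2.1.comp (f := fun t : A × B × C => ((t.2.2, t.1), t.2.1)) (by fun_prop)) hcon⟩)
  have t1 : E (x, b) (a, b) := E.symm fun P hP h => hx (.inl ⟨P, hP, h⟩)
  have t2 : E (x, c) (a', c) := E.symm fun P hP h => hx (.inr (.inl ⟨P, hP, h⟩))
  have ex : E x a := t1.map (f := fun t => t.1) (by fun_prop)
  refine ⟨x, t1, t2, I.of (ha.E ex.symm) (Ind.of_not_Dv (hp.of_E ex.symm) fun P hP h hd => ?_),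
    I.of hc (Ind.of_not_Dv hr fun P hP h hd => ?_), I.of hb (Ind.of_not_Dv hq fun P hP h hd => ?_)⟩
  · exact hx (.inr (.inr (.inl ⟨P, hP, hd⟩))) h
  · exact hx (.inr (.inr (.inr (.inl ⟨P, hP, hd⟩)))) h
  · exact hx (.inr (.inr (.inr (.inr ⟨P, hP, hd⟩)))) h

end Abs

namespace Abs
open Filter FirstOrder Language

set_option linter.unusedSectionVars false

/-- every formula has finite support -/
theorem fml_supp {L : FirstOrder.Language.{u, v}} {W : Type w} [L.Structure W] {γ : Type x}
    (θ : L.Formula γ) : ∃ (F : Finset γ) (θ' : L.Formula F),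
      ∀ v : γ → W, θ.Realize v ↔ θ'.Realize (fun i : F => v i) := by
  classical
  refine ⟨BoundedFormula.freeVarFinset θ, BoundedFormula.restrictFreeVar θ id, fun v => ?_⟩
  unfold Formula.Realize
  rw [BoundedFormula.realize_restrictFreeVar v]
  intro a; rfl

/-- existential quantification over arbitrarily many variables -/
theorem fml_ex {L : FirstOrder.Language.{u, v}} {W : Type w} [L.Structure W] [Nonempty W]
    {γ δ : Type x} (θ : L.Formula (γ ⊕ δ)) : ∃ χ : L.Formula γ, ∀ v : γ → W,
      χ.Realize v ↔ ∃ y, θ.Realize (Sum.elim v y) := by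
  classical
  obtain ⟨F, θ', h⟩ := fml_supp (W := W) θ
  let g : F → γ ⊕ F := fun i => match i.1 with
    | Sum.inl a => Sum.inl a
    | Sum.inr _ => Sum.inr i
  refine ⟨(θ'.relabel g).iExs F, fun v => ?_⟩
  rw [Formula.realize_iExs]
  simp only [Formula.realize_relabel, h]
  constructor
  · rintro ⟨e, he⟩
    refine ⟨fun b => if hb : Sum.inr b ∈ F then e ⟨_, hb⟩ else Classical.arbitrary W, ?_⟩
    convert he using 2 with i
    obtain ⟨i | i, hi⟩ := i
    · rfl
    · simp [g, hi]
  · rintro ⟨y, hy⟩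
    refine ⟨fun i => Sum.elim v y i.1, ?_⟩
    convert hy using 2 with i
    obtain ⟨i | i, hi⟩ := i <;> rfl

section
variable {L : FirstOrder.Language.{u, v}} {W : Type w} [L.Structure W] (N : L.ElementarySubstructure W)

/-- sets definable over `N` -/
def DefN {α : Type} (S : Set (α → W)) : Prop :=
  ∃ θ : L.Formula (N ⊕ α), ∀ v, v ∈ S ↔ θ.Realize (Sum.elim (fun n : N => (n : W)) v)

/-- countable saturation over `N` -/
def SatN : Prop := ∀ {α β : Type} [Countable α] [Countable β] (c : β → W)
    (F : Set (L.Formula (N ⊕ (α ⊕ β)))),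
    (∀ G : Finset (L.Formula (N ⊕ (α ⊕ β))), (∀ θ ∈ G, θ ∈ F) →
      ∃ x : α → W, ∀ θ ∈ G, θ.Realize (Sum.elim (fun n : N => (n : W)) (Sum.elim x c))) →
    ∃ x : α → W, ∀ θ ∈ F, θ.Realize (Sum.elim (fun n : N => (n : W)) (Sum.elim x c))

variable {N}
theorem DefN.pre {α β : Type} (f : α → β) {S : Set (α → W)} (h : DefN N S) :
    DefN N {x : β → W | x ∘ f ∈ S} := by
  obtain ⟨θ, h⟩ := h
  refine ⟨θ.relabel (Sum.map id f), fun v => ?_⟩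
  rw [Formula.realize_relabel]
  change v ∘ f ∈ S ↔ _
  rw [h]
  apply iff_of_eq; congr 1; funext i; cases i <;> rfl

theorem DefN.proj [Nonempty W] {α β : Type} {S : Set (α ⊕ β → W)} (h : DefN N S) :
    DefN N {x : α → W | ∃ y, Sum.elim x y ∈ S} := by
  obtain ⟨θ, h⟩ := h
  obtain ⟨χ, hχ⟩ := fml_ex (W := W) (γ := N ⊕ α) (δ := ULift.{w} β) (θ.relabel
    (Sum.elim (fun n => Sum.inl (Sum.inl n)) (Sum.elim (fun a => Sum.inl (Sum.inr a))
      (fun b => Sum.inr (ULift.up b)))))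
  refine ⟨χ, fun v => ?_⟩
  rw [hχ]
  simp only [Formula.realize_relabel]
  change (∃ y, Sum.elim v y ∈ S) ↔ _
  simp only [h]
  constructor
  · rintro ⟨y, hy⟩
    refine ⟨fun b => y b.down, ?_⟩
    convert hy using 1
    funext i; rcases i with i | i | i <;> rfl
  · rintro ⟨y, hy⟩
    refine ⟨fun b => y ⟨b⟩, ?_⟩
    convert hy using 1
    funext i; rcases i with i | i | i <;> rfl

theorem DefN.subst {α β : Type} {S : Set (α ⊕ β → W)} (m : α → W) (hm : ∀ i, m i ∈ N)
    (h : DefN N S) : DefN N {y : β → W | Sum.elim m y ∈ S} := by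
  obtain ⟨θ, h⟩ := h
  refine ⟨θ.relabel (Sum.elim Sum.inl (Sum.elim (fun a => Sum.inl ⟨m a, hm a⟩) Sum.inr)), fun v => ?_⟩
  rw [Formula.realize_relabel]
  change Sum.elim m v ∈ S ↔ _
  rw [h]
  apply iff_of_eq; congr 1; funext i; rcases i with i | i | i <;> rfl

theorem DefN.model [Nonempty W] {α : Type} {S : Set (α → W)} (h : DefN N S) (hS : S.Nonempty) :
    ∃ m ∈ S, ∀ i, m i ∈ N := by
  classical
  obtain ⟨θ, h⟩ := h
  obtain ⟨x, hx⟩ := hS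
  obtain ⟨F, θ', hF⟩ := fml_supp (W := W) θ
  let g : F → N ⊕ F := fun i => match i.1 with
    | Sum.inl a => Sum.inl a
    | Sum.inr _ => Sum.inr i
  have h1 : ((θ'.relabel g).iExs F).Realize (fun n : N => (n : W)) := by
    rw [Formula.realize_iExs]
    refine ⟨fun i => Sum.elim (fun n : N => (n : W)) x i.1, ?_⟩
    rw [Formula.realize_relabel]
    rw [h, hF] at hx
    convert hx using 2 with i
    obtain ⟨i | i, hi⟩ := i <;> rfl
  have h2 := N.subtype.map_formula ((θ'.relabel g).iExs F) id
  have h3 : ((θ'.relabel g).iExs F).Realize (id : N → N) := h2.1 h1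
  rw [Formula.realize_iExs] at h3
  obtain ⟨e, he⟩ := h3
  have h4 := (N.subtype.map_formula _ _).2 he
  rw [Formula.realize_relabel] at h4
  refine ⟨fun a => if ha : Sum.inr a ∈ F then (e ⟨_, ha⟩ : W) else
    ((Classical.arbitrary N : N) : W), ?_, fun a => ?_⟩
  · rw [h, hF]
    convert h4 using 2 with i
    obtain ⟨i | i, hi⟩ := i
    · rfl
    · simp [g, hi]
  · dsimp only; split_ifs
    · exact (e _).2
    · exact (Classical.arbitrary N : N).2

variable (N)
/-- the abstract system attached to a saturated structure with a small elementary substructure -/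
@[reducible] def mkDSys [Nonempty W] (hs : SatN N) : DSys W where
  D := fun S => DefN N S
  M := N
  univ := ⟨⊤, fun v => by simp⟩
  compl := fun {α S} h => by
    obtain ⟨θ, h⟩ := h
    exact ⟨θ.not, fun v => by rw [Formula.realize_not, ← h]; rfl⟩
  inter := fun {α S T} h h' => by
    obtain ⟨θ, h⟩ := h
    obtain ⟨θ', h'⟩ := h'
    exact ⟨θ ⊓ θ', fun v => by rw [Formula.realize_inf, ← h, ← h']; rfl⟩
  diag := fun {α} i j => ⟨Term.equal (Term.var (Sum.inr i)) (Term.var (Sum.inr j)), fun v => by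
    rw [Formula.realize_equal]; rfl⟩
  pre := fun f _ h => h.pre f
  proj := fun h => h.proj
  subst := fun m hm h => h.subst m hm
  model := fun h hS => h.model hS
  fs := fun {α S} h => by
    classical
    obtain ⟨θ, h⟩ := h
    obtain ⟨F, θ', hF⟩ := fml_supp (W := W) θ
    refine ⟨F.preimage Sum.inr Sum.inr_injective.injOn, fun x y e hx => ?_⟩
    rw [h, hF] at hx ⊢
    convert hx using 2 with i
    obtain ⟨i | i, hi⟩ := i
    · rfl
    · exact (e i (by simpa using hi)).symm
  sat := fun {α β} _ _ c F hF hG => by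
    classical
    obtain ⟨x, hx⟩ := hs (α := α) c {θ | {v | θ.Realize (Sum.elim (fun n : N => (n : W)) v)} ∈ F} fun G hG' => by
      obtain ⟨x, hx⟩ := hG (G.image fun θ => {v | θ.Realize (Sum.elim (fun n : N => (n : W)) v)}) (by
        intro S hS
        obtain ⟨θ, hθ, rfl⟩ := Finset.mem_image.1 hS
        exact hG' θ hθ)
      exact ⟨x, fun θ hθ => hx _ (Finset.mem_image_of_mem _ hθ)⟩
    refine ⟨x, fun S hS => ?_⟩
    obtain ⟨θ, h⟩ := hF S hS
    have : S = {v | θ.Realize (Sum.elim (fun n : N => (n : W)) v)} := Set.ext h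
    rw [h]
    exact hx θ (by change _ ∈ F; rwa [← this])
end

end Abs

namespace Abs
open Filter

set_option linter.unusedSectionVars false
variable {𝕄 : Type w} [DSys 𝕄]
variable {X Y Z A B C : Type w} [Srt 𝕄 X] [Srt 𝕄 Y] [Srt 𝕄 Z] [Srt 𝕄 A] [Srt 𝕄 B] [Srt 𝕄 C]

theorem Co.snoc {n : ℕ} : Co (fun q : X × (Fin n → X) => (Fin.snoc q.2 q.1 : Fin (n+1) → X)) := by
  refine Co.pi fun i => ?_
  induction i using Fin.lastCases with
  | last => simpa using Co.fst'
  | cast i =>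
    simp only [Fin.snoc_castSucc]
    fun_prop

/-- finite coheir sequences inherit properties of the averaged sequence -/
theorem avg_seq {c : ℕ → X} (hc : ∀ i, MP (c i)) (p : IT X)
    (hp : p = coheir ((hyperfilter ℕ).map c) (by
      change ∀ᶠ i in (hyperfilter ℕ : Filter ℕ), MP (c i); exact Eventually.of_forall hc)) {n : ℕ} :
    ∀ (Q : (Fin n → X) → Prop), Def Q → (∀ f : Fin n → ℕ, Q (fun j => c (f j))) →
    ∀ u : Fin n → X, (∀ m (hm : m < n), p.R (u ⟨m, hm⟩) (fun j : Fin m => u ⟨j, j.2.trans hm⟩)) → Q u := by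
  induction n with
  | zero =>
    intro Q _ h u _
    have : u = fun j : Fin 0 => c (Fin.elim0 j) := funext fun j => j.elim0
    rw [this]; exact h _
  | succ n ih =>
    intro Q hQ h u hu
    have hR := hu n (by omega)
    rw [hp] at hR
    have hQ' : Def (fun q : X × (Fin n → X) => Q (Fin.snoc q.2 q.1)) := hQ.comp Co.snoc
    have h1 := hR (fun q : X × (Fin n → X) => Q (Fin.snoc q.2 q.1)) hQ' (by
      change ∀ᶠ i in (hyperfilter ℕ : Filter ℕ), Q (Fin.snoc (fun j : Fin n => u ⟨j, j.2.trans (by omega)⟩) (c i))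
      refine Eventually.of_forall fun i => ?_
      refine ih (fun v => Q (Fin.snoc v (c i))) (hQ'.subst (hc i)) (fun f => ?_) _ (fun m hm => hu m (by omega))
      convert h (Fin.snoc f i) using 2 with j
      induction j using Fin.lastCases <;> simp)
    convert h1 using 2
    funext j
    induction j using Fin.lastCases with
    | last => simp; rfl
    | cast j => simp; rfl

/-- selecting two branches agreeing on finitely many predicates -/
theorem pigeon (θ : ℕ → X → Prop) (T : List Bool → X) (ν : List Bool) (i : ℕ) :
    ∃ α β : ℕ, α < β ∧ ∀ k ≤ i, (θ k (T (ν ++ List.replicate α false ++ [true])) ↔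
      θ k (T (ν ++ List.replicate β false ++ [true]))) := by
  classical
  let F : ℕ → (Fin (i+1) → Prop) := fun α k => θ k (T (ν ++ List.replicate α false ++ [true]))
  obtain ⟨a, b, hab, h⟩ := Finite.exists_ne_map_eq_of_infinite F
  rcases lt_or_gt_of_ne hab with h' | h'
  · exact ⟨a, b, h', fun k hk => iff_of_eq (congrFun h ⟨k, by omega⟩)⟩
  · exact ⟨b, a, h', fun k hk => iff_of_eq (congrFun h ⟨k, by omega⟩).symm⟩

theorem VVabs (hG : ∀ x : X, Good x) (θ : ℕ → X → Prop)
    (hθ : ∀ P : X → Prop, Def P → ∃ i, ∀ x, P x ↔ θ i x)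
    (K : ∀ k, (Fin k → X) → Prop) (hK : ∀ k, Def (K k))
    (T : List Bool → X) (hT : ∀ η, MP (T η))
    (hP : ∀ (σ : List Bool) (k : ℕ) (f : Fin k → List Bool), (∀ j, f j <+: σ) → K k (fun j => T (f j)))
    (hC : ∀ η₁ η₂ : List Bool, (η₁ ++ [false]) <+: η₂ → ¬ K 2 ![T (η₁ ++ [true]), T η₂]) (n : ℕ) :
    ∃ Y Z : Fin n → X, (∀ m : ℕ, K n (fun i => if (i : ℕ) < m then Y i else Z i)) ∧
      ∀ i j : Fin n, i ≤ j → ¬ K 2 ![Y j, Z i] := by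
  classical
  choose α β hαβ hag using pigeon (X := X) θ T
  let ν : ℕ → List Bool := fun i => Nat.rec [] (fun i l => l ++ List.replicate (β l i) false ++ [true]) i
  have hν : ∀ i, ν (i+1) = ν i ++ List.replicate (β (ν i) i) false ++ [true] := fun i => rfl
  have hν1 : ∀ i, ν i <+: ν (i+1) := fun i => by
    rw [hν, List.append_assoc]; exact List.prefix_append _ _
  have hνm : ∀ i j, i ≤ j → ν i <+: ν j := fun i j h => by
    induction h with
    | refl => exact List.prefix_rfl
    | step _ ih => exact ih.trans (hν1 _)
  let c0 : ℕ → X := fun i => T (ν (i+1))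
  let c1 : ℕ → X := fun i => T (ν i ++ List.replicate (α (ν i) i) false ++ [true])
  have hc0 : ∀ i, MP (c0 i) := fun i => hT _
  have hc1 : ∀ i, MP (c1 i) := fun i => hT _
  have hU0 : ∀ᶠ m in (((hyperfilter ℕ).map c0 : Ultrafilter X) : Filter X), MP m := by
    change ∀ᶠ i in (hyperfilter ℕ : Filter ℕ), MP (c0 i); exact Eventually.of_forall hc0
  have hU1 : ∀ᶠ m in (((hyperfilter ℕ).map c1 : Ultrafilter X) : Filter X), MP m := by
    change ∀ᶠ i in (hyperfilter ℕ : Filter ℕ), MP (c1 i); exact Eventually.of_forall hc1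
  have hge : ∀ k : ℕ, ∀ᶠ i in (hyperfilter ℕ : Filter ℕ), k ≤ i := fun k => by
    have : (hyperfilter ℕ : Filter ℕ) ≤ atTop := by
      rw [← Nat.cofinite_eq_atTop]; exact hyperfilter_le_cofinite
    exact this (eventually_ge_atTop k)
  let p := coheir _ hU0
  let q := coheir _ hU1
  have hpq : ∀ b, p.Ext b → q.Ext b := by
    intro b hb P hP hev
    refine hb P hP ?_
    have hev' : ∀ᶠ i in (hyperfilter ℕ : Filter ℕ), P (c1 i, un) := hev
    change ∀ᶠ i in (hyperfilter ℕ : Filter ℕ), P (c0 i, un)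
    obtain ⟨k, hk⟩ := hθ (fun x => P (x, un)) (hP.comp (f := fun x : X => (x, (un : Un 𝕄))) (by fun_prop))
    filter_upwards [hev', hge k] with i hi hki
    rw [hk] at hi ⊢
    exact (hag (ν i) i k hki).1 hi
  obtain ⟨b0, hb0⟩ := p.ex (un : Un 𝕄)
  obtain ⟨b1, hb1⟩ := q.ex b0
  have hb0' : q.Ext b0 := hpq b0 hb0
  have hb1p : p.Ext b1 := IT.Ext.of_E hb0 (hb0'.E hb1.ext)
  have hco : Co (fun z : X × X => (![z.1, z.2] : Fin 2 → X)) := by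
    refine Co.pi fun i => ?_
    fin_cases i
    · exact Co.fst'
    · exact Co.snd'
  have hK2 : Def (fun z : X × X => K 2 ![z.1, z.2]) := (hK 2).comp hco
  have hneg : ¬ K 2 ![b1, b0] := by
    refine hb1 (fun z : X × X => ¬ K 2 ![z.1, z.2]) hK2.not ?_
    change ∀ᶠ i in (hyperfilter ℕ : Filter ℕ), ¬ K 2 ![c1 i, b0]
    refine Eventually.of_forall fun i => ?_
    have hd : Def (fun z : X => ¬ K 2 ![c1 i, z]) := hK2.not.subst (hc1 i)
    refine hb0' (fun z : X × Un 𝕄 => ¬ K 2 ![c1 i, z.1]) (hd.comp (f := fun z : X × Un 𝕄 => z.1) (by fun_prop)) ?_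
    change ∀ᶠ j in (hyperfilter ℕ : Filter ℕ), ¬ K 2 ![c1 i, c1 j]
    filter_upwards [hge (i+1)] with j hj
    refine hC _ _ ?_
    have h1 : ν (i+1) <+: ν j ++ List.replicate (α (ν j) j) false ++ [true] := by
      refine (hνm _ _ hj).trans ?_
      rw [List.append_assoc]; exact List.prefix_append _ _
    refine List.IsPrefix.trans ?_ h1
    rw [hν]
    obtain ⟨d, hd⟩ := Nat.exists_eq_add_of_lt (hαβ (ν i) i)
    refine ⟨List.replicate d false ++ [true], ?_⟩
    rw [hd, show α (ν i) i + d + 1 = α (ν i) i + (1 + d) by ring, List.replicate_add, List.replicate_add]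
    simp [List.append_assoc]
  have hI : I b1 b0 := by
    intro r hr
    refine ⟨hr, fun u hu => ?_⟩
    obtain ⟨a', ha'⟩ := q.ex u
    refine ⟨a', fun i => ?_⟩
    exact q.uniq (q.mono ha' (f := fun u : ℕ → X => u i) (by fun_prop)) hb1 (hu.extE i hr)
  obtain ⟨Y, Z, h1, h2, h3, -⟩ := ZZ (hG b1) (hG b0) hI ⟨_, hU0, rfl⟩ hb1p (q := p) hb0 n
  refine ⟨Y, Z, fun m => ?_, fun i j hij hk => ?_⟩
  · refine avg_seq hc0 p rfl (K n) (hK n) (fun f => ?_) _ (fun l hl => ?_)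
    · refine hP (ν ((Finset.univ.sup f) + 1)) n (fun j => ν (f j + 1)) fun j => ?_
      exact hνm _ _ (Nat.succ_le_succ (Finset.le_sup (f := f) (Finset.mem_univ j)))
    · by_cases hlm : l < m
      · simp only [hlm, if_true]
        convert h2 l hl using 2 with j
        rw [if_pos (j.2.trans hlm)]
      · simp only [hlm, if_false]
        refine p.mono (h1 l hl) (f := fun z : (Fin l → X) × (Fin l → X) =>
          fun j : Fin l => if (j : ℕ) < m then z.1 j else z.2 j) (Co.pi fun j => ?_)
        by_cases hj : (j : ℕ) < m
        · simp only [hj, if_true]; fun_prop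
        · simp only [hj, if_false]; fun_prop
  · exact hneg ((h3 i j hij) (fun z : X × X => K 2 ![z.1, z.2]) hK2 hk)

end Abs

namespace Abs
open Filter FirstOrder Language

set_option linter.unusedSectionVars false

/-- countable ultrapower -/
abbrev UP (V : Type w) : Type w := (hyperfilter ℕ : Filter ℕ).Product (fun _ => V)

/-- class of a sequence -/
noncomputable def upc {V : Type w} (f : ℕ → V) : UP V := (f : UP V)

theorem upc_surj {V : Type w} (z : UP V) : ∃ f : ℕ → V, upc f = z := Quotient.exists_rep z

theorem upc_realize {L : FirstOrder.Language.{u, v}} {V : Type w} [L.Structure V] [Nonempty V] {β : Type x}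
    (φ : L.Formula β) (f : β → ℕ → V) :
    (φ.Realize fun i => upc (f i)) ↔ ∀ᶠ j in (hyperfilter ℕ : Filter ℕ), φ.Realize fun i => f i j :=
  Ultraproduct.realize_formula_cast (u := hyperfilter ℕ) (M := fun _ => V) φ f

/-- countable saturation of countable-index ultrapowers -/
theorem ultra_sat {L : FirstOrder.Language.{u, v}} [Countable L.Symbols] {V : Type w} [L.Structure V] [Nonempty V]
    (N : L.ElementarySubstructure (UP V)) (hN : Countable N) :
    SatN N := by
  classical
  intro α β _ _ c F hF
  have hW : Nonempty (UP V) := inferInstance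
  rcases F.eq_empty_or_nonempty with rfl | hne
  · exact ⟨fun _ => Classical.arbitrary _, fun θ h => absurd h (by simp)⟩
  have hcF : F.Countable := Set.to_countable F
  obtain ⟨θ, rfl⟩ := hcF.exists_eq_range hne
  choose rep hrep using upc_surj (V := V)
  let G : ℕ → ℕ → Prop := fun k j => ∃ x : α → V, ∀ i < k,
    (θ i).Realize (Sum.elim (fun n : N => rep n j) (Sum.elim x (fun b => rep (c b) j)))
  have key : ∀ (i : ℕ) (x : α → ℕ → V), ((θ i).Realize (Sum.elim (fun n : N => (n : UP V))
      (Sum.elim (fun a => upc (x a)) c)) ↔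
      ∀ᶠ j in (hyperfilter ℕ : Filter ℕ), (θ i).Realize (Sum.elim (fun n : N => rep n j) (Sum.elim (fun a => x a j) (fun b => rep (c b) j)))) := by
    intro i x
    have := upc_realize (θ i)
      (Sum.elim (fun n : N => rep n) (Sum.elim (fun a => x a) (fun b => rep (c b))))
    have ez : (fun z => upc ((Sum.elim (fun n : N => rep n) (Sum.elim (fun a => x a) (fun b => rep (c b)))) z)) =
        Sum.elim (fun n : N => (n : UP V)) (Sum.elim (fun a => upc (x a)) c) := by
      funext z; rcases z with z | z | z
      · exact hrep _
      · rfl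
      · exact hrep _
    rw [ez] at this
    rw [this]
    refine iff_of_eq (congrArg (fun P : ℕ → Prop => ∀ᶠ j in (hyperfilter ℕ : Filter ℕ), P j) ?_)
    funext j
    congr 1
    funext z; rcases z with z | z | z <;> rfl
  have hG : ∀ k, ∀ᶠ j in (hyperfilter ℕ : Filter ℕ), G k j := by
    intro k
    obtain ⟨x, hx⟩ := hF ((Finset.range k).image θ) (by
      intro t ht
      obtain ⟨i, -, rfl⟩ := Finset.mem_image.1 ht
      exact ⟨i, rfl⟩)
    have h1 : ∀ i ∈ Finset.range k, ∀ᶠ j in (hyperfilter ℕ : Filter ℕ),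
        (θ i).Realize (Sum.elim (fun n : N => rep n j) (Sum.elim (fun a => rep (x a) j) (fun b => rep (c b) j))) := by
      intro i hi
      refine (key i (fun a => rep (x a))).1 ?_
      simp only [hrep]
      exact hx (θ i) (Finset.mem_image_of_mem _ hi)
    filter_upwards [(Filter.eventually_all_finset _).2 h1] with j hj
    exact ⟨fun a => rep (x a) j, fun i hi => hj i (by simpa using hi)⟩
  have hch : ∀ j, ∃ x : α → V, ∀ i < Nat.findGreatest (fun k => G k j) j,
      (θ i).Realize (Sum.elim (fun n : N => rep n j) (Sum.elim x (fun b => rep (c b) j))) := by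
    intro j
    have h0 : G 0 j := ⟨fun _ => Classical.arbitrary V, fun i hi => absurd hi (by omega)⟩
    exact Nat.findGreatest_spec (P := fun k => G k j) (Nat.zero_le j) h0
  choose x hx using hch
  refine ⟨fun a => upc (fun j => x j a), ?_⟩
  rintro _ ⟨i, rfl⟩
  refine (key i (fun a j => x j a)).2 ?_
  have hge : ∀ᶠ j in (hyperfilter ℕ : Filter ℕ), i + 1 ≤ j := by
    have : (hyperfilter ℕ : Filter ℕ) ≤ atTop := by
      rw [← Nat.cofinite_eq_atTop]; exact hyperfilter_le_cofinite
    exact this (eventually_ge_atTop (i+1))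
  filter_upwards [hG (i+1), hge] with j hj hij
  exact hx j i (Nat.le_findGreatest (P := fun k => G k j) hij hj)

/-- split finite support -/
theorem fml_split {L : FirstOrder.Language.{u, v}} {W : Type w} [L.Structure W] {α : Type x} {β : Type y}
    (θ : L.Formula (α ⊕ β)) : ∃ (k m : ℕ) (r : Fin k → α) (s : Fin m → β) (θ' : L.Formula (Fin k ⊕ Fin m)),
      Function.Injective r ∧ Function.Injective s ∧
      ∀ (x : α → W) (y : β → W), θ.Realize (Sum.elim x y) ↔ θ'.Realize (Sum.elim (fun i => x (r i)) (fun i => y (s i))) := by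
  classical
  obtain ⟨F, θ', h⟩ := fml_supp (W := W) θ
  let r : Fin F.toLeft.card → α := fun i => (F.toLeft.equivFin.symm i).1
  let s : Fin F.toRight.card → β := fun i => (F.toRight.equivFin.symm i).1
  let g : F → Fin F.toLeft.card ⊕ Fin F.toRight.card := fun i => match i with
    | ⟨Sum.inl a, ha⟩ => Sum.inl (F.toLeft.equivFin ⟨a, by simpa using ha⟩)
    | ⟨Sum.inr a, ha⟩ => Sum.inr (F.toRight.equivFin ⟨a, by simpa using ha⟩)
  refine ⟨_, _, r, s, θ'.relabel g, ?_, ?_, fun x y => ?_⟩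
  · exact Subtype.val_injective.comp (Equiv.injective _)
  · exact Subtype.val_injective.comp (Equiv.injective _)
  · rw [h, Formula.realize_relabel]
    apply iff_of_eq; congr 1
    funext i
    obtain ⟨i | i, hi⟩ := i <;> simp [g, r, s]

theorem ofFn_initial {σ : ℕ → Bool} {i n : ℕ} (h : i ≤ n) :
    List.ofFn (fun j : Fin i => σ j) <+: List.ofFn (fun j : Fin n => σ j) := by
  obtain ⟨d, rfl⟩ := Nat.exists_eq_add_of_le h
  rw [List.ofFn_add]
  exact List.prefix_append _ _

/-- no SOP1 pattern implies all tuples are good -/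
theorem good_of_no_pattern {L : FirstOrder.Language.{u, v}} {W : Type w} [L.Structure W] [Nonempty W]
    (N : L.ElementarySubstructure W) (hs : SatN N) (hp : ¬ SOP1PatternIn L W) {X : Type w} [Srt W X] (b : X) :
    @Good W (mkDSys N hs) X _ b := by
  letI := mkDSys N hs
  rintro ⟨ι, _, A, _, φ, T, ⟨θ, hθ⟩, -, h1, h2⟩
  apply hp
  obtain ⟨k, m, r, s, θ', hr, hs', h⟩ := fml_split (W := W) (α := Srt.idx A) (β := N ⊕ ι × Srt.idx X)
    (θ.relabel (Sum.elim (fun n => Sum.inr (Sum.inl n)) (Sum.elim Sum.inl (fun z => Sum.inr (Sum.inr z)))))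
  have key : ∀ (x : A) (t : ι → X), φ (x, t) ↔ θ'.Realize (Sum.elim (fun i => Srt.eqv x (r i))
      (fun i => (Sum.elim (fun n : N => (n : W)) (fun z : ι × Srt.idx X => Srt.eqv (t z.1) z.2)) (s i))) := by
    intro x t
    rw [← h, Formula.realize_relabel]
    have := hθ (Srt.eqv (x, t))
    simp only [Equiv.symm_apply_apply, Set.mem_setOf_eq] at this
    rw [this]
    apply iff_of_eq; congr 1
    funext z; rcases z with z | z | z <;> rfl
  have fill : ∀ xx : Fin k → W, ∃ x : A, (fun i => Srt.eqv x (r i)) = xx := by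
    intro xx
    refine ⟨Srt.eqv.symm (Function.extend r xx fun _ => Classical.arbitrary W), ?_⟩
    funext i
    simp [hr.extend_apply]
  refine ⟨k, m, θ', fun η i => (Sum.elim (fun n : N => (n : W)) (fun z : ι × Srt.idx X => Srt.eqv (T η z.1) z.2)) (s i), ?_, ?_⟩
  · intro σ S
    obtain ⟨x, hx⟩ := h1 (List.ofFn fun j : Fin (S.sup id) => σ j)
    refine ⟨fun i => Srt.eqv x (r i), fun i hi => ?_⟩
    exact (key _ _).1 (hx _ (ofFn_initial (Finset.le_sup (f := id) hi)))
  · rintro η₁ η₂ hη ⟨xx, hx1, hx2⟩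
    obtain ⟨x, rfl⟩ := fill xx
    exact h2 η₁ η₂ hη ⟨x, (key _ _).2 hx1, (key _ _).2 hx2⟩

/-- countable elementary substructures -/
theorem exists_ctbl_sub {L : FirstOrder.Language.{0, 0}} [Countable L.Symbols] {W : Type w} [L.Structure W]
    (s : Set W) (hs : s.Countable) : ∃ N : L.ElementarySubstructure W, s ⊆ N ∧ Countable N := by
  by_cases hW : Countable W
  · exact ⟨⊤, fun _ _ => trivial, inferInstance⟩
  · have hc : L.card ≤ Cardinal.aleph0 := Cardinal.mk_le_aleph0_iff.2 inferInstance
    have h4 : Cardinal.aleph0 < Cardinal.mk W := by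
      rw [← not_le, Cardinal.mk_le_aleph0_iff]; exact hW
    obtain ⟨S, h1, h2⟩ := exists_elementarySubstructure_card_eq L s (Cardinal.aleph0.{0}) le_rfl
      (by simpa using (Cardinal.le_aleph0_iff_set_countable.2 hs)) (by simpa using hc) (by simpa using h4.le)
    refine ⟨S, h1, ?_⟩
    have : Cardinal.mk S = Cardinal.aleph0 := by simpa using h2
    exact Cardinal.mk_le_aleph0_iff.1 this.le

/-- language for a hypergraph sequence on `n`-tuples -/
def kLang (n : ℕ) : FirstOrder.Language.{0, 0} :=
  ⟨fun _ => Empty, fun m => Σ k : ℕ, (Fin k × Fin n → Fin m)⟩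

instance (n : ℕ) : Countable (kLang n).Symbols := by
  have h1 : ∀ l, Countable ((kLang n).Functions l) := fun l => inferInstanceAs (Countable Empty)
  have h2 : ∀ l, Countable ((kLang n).Relations l) := fun l =>
    inferInstanceAs (Countable (Σ k : ℕ, (Fin k × Fin n → Fin l)))
  unfold Language.Symbols
  infer_instance

/-- its structure -/
@[reducible] def kStr {V : Type w} {n : ℕ} (K : ∀ k, (Fin k → Fin n → V) → Prop) : (kLang n).Structure V where
  funMap := fun f => Empty.elim f
  RelMap := fun R w => K R.1 (fun j t => w (R.2 (j, t)))

/-- its basic relation -/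
def kRel (n k : ℕ) : (kLang n).Relations (k * n) := (⟨k, finProdFinEquiv⟩ : Σ k' : ℕ, (Fin k' × Fin n → Fin (k * n)))

/-- its basic formula -/
def kForm (n k : ℕ) : (kLang n).Formula (Fin k × Fin n) :=
  Relations.formula (kRel n k) (fun q => Term.var (finProdFinEquiv.symm q))

theorem kForm_realize {V : Type w} {n : ℕ} (K : ∀ k, (Fin k → Fin n → V) → Prop) (k : ℕ) (v : Fin k × Fin n → V) :
    @Formula.Realize (kLang n) V (kStr K) _ (kForm n k) v ↔ K k (fun j t => v (j, t)) := by
  letI := kStr K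
  unfold kForm
  rw [Formula.realize_rel]
  change K k (fun j t => v (finProdFinEquiv.symm (finProdFinEquiv (j, t)))) ↔ _
  simp only [Equiv.symm_apply_apply]

theorem VV {V : Type w} [Nonempty V] {n : ℕ} (K : ∀ k, (Fin k → Fin n → V) → Prop)
    (H : letI := kStr K
      ¬ SOP1PatternIn (kLang n) (UP V))
    (T : List Bool → Fin n → V)
    (hP : ∀ (σ : List Bool) (k : ℕ) (f : Fin k → List Bool), (∀ j, f j <+: σ) → K k (fun j => T (f j)))
    (hC : ∀ η₁ η₂ : List Bool, (η₁ ++ [false]) <+: η₂ → ¬ K 2 ![T (η₁ ++ [true]), T η₂]) (m : ℕ) :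
    ∃ Y Z : Fin m → Fin n → V, (∀ l ≤ m, K m (fun i => if (i : ℕ) < l then Y i else Z i)) ∧
      ∀ i j : Fin m, i ≤ j → ¬ K 2 ![Y j, Z i] := by
  letI := kStr K
  let W := UP V
  let cast : (ℕ → V) → W := upc
  have hsurj : ∀ z : W, ∃ f : ℕ → V, cast f = z := fun z => upc_surj z
  choose rep hrep using hsurj
  obtain ⟨N, hsN, hN⟩ := exists_ctbl_sub (L := kLang n) (W := W)
    (Set.range fun q : List Bool × Fin n => cast fun _ => T q.1 q.2) (Set.countable_range _)
  have hs : SatN N := ultra_sat N hN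
  letI := mkDSys N hs
  let X := Tup W (Fin n)
  let K' : ∀ k, (Fin k → X) → Prop := fun k v => (kForm n k).Realize (fun q : Fin k × Fin n => (v q.1 q.2 : W))
  have los : ∀ k (v : Fin k → Fin n → ℕ → V), K' k (fun j t => cast (v j t)) ↔
      ∀ᶠ i in (hyperfilter ℕ : Filter ℕ), K k (fun j t => v j t i) := by
    intro k v
    have := upc_realize (kForm n k)
      (fun q : Fin k × Fin n => v q.1 q.2)
    simp only [kForm_realize] at this
    exact this
  have los2 : ∀ (f g : Fin n → ℕ → V), K' 2 ![(fun t => cast (f t) : Fin n → W), (fun t => cast (g t) : Fin n → W)] ↔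
      ∀ᶠ i in (hyperfilter ℕ : Filter ℕ), K 2 ![fun t => f t i, fun t => g t i] := by
    intro f g
    have := los 2 ![f, g]
    have q1 : (![(fun t => cast (f t) : Fin n → W), (fun t => cast (g t) : Fin n → W)] : Fin 2 → Fin n → W) =
        fun j t => cast ((![f, g] : Fin 2 → Fin n → ℕ → V) j t) := by
      funext j; fin_cases j <;> rfl
    have q2 : ∀ i, (![fun t => f t i, fun t => g t i] : Fin 2 → Fin n → V) =
        fun j t => (![f, g] : Fin 2 → Fin n → ℕ → V) j t i := by
      intro i; funext j; fin_cases j <;> rfl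
    simp only [q2]
    rw [← this, ← q1]; exact Iff.rfl
  obtain ⟨θ, hθ⟩ := exists_surjective_nat ((kLang n).Formula (N ⊕ Fin n))
  obtain ⟨Y, Z, h1, h2⟩ := VVabs (X := X) (fun x => good_of_no_pattern N hs H x)
    (fun i x => (θ i).Realize (Sum.elim (fun n : N => (n : W)) (fun t => x t)))
    (by
      rintro P ⟨χ, hχ⟩
      obtain ⟨i, rfl⟩ := hθ χ
      exact ⟨i, fun x => hχ x⟩)
    K' (fun k => ⟨(kForm n k).relabel Sum.inr, fun v => by
      rw [Formula.realize_relabel]; rfl⟩)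
    (fun η t => cast fun _ => T η t) (fun η t => hsN ⟨(η, t), rfl⟩)
    (fun σ k f hf => (los k (fun j t _ => T (f j) t)).2 (Eventually.of_forall fun _ => hP σ k f hf))
    (fun η₁ η₂ h hK => by
      have := (los2 _ _).1 hK
      obtain ⟨i, hi⟩ := this.exists
      exact hC _ _ h hi) m
  have e1 : ∀ l ≤ m, ∀ᶠ i in (hyperfilter ℕ : Filter ℕ),
      K m (fun j => if (j : ℕ) < l then (fun t => rep (Y j t) i) else (fun t => rep (Z j t) i)) := by
    intro l _
    have h := (los m (fun j t => if (j : ℕ) < l then rep (Y j t) else rep (Z j t))).1 (by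
      have q1 : (fun (j : Fin m) t => cast ((if (j : ℕ) < l then rep (Y j t) else rep (Z j t)))) =
          fun j : Fin m => if (j : ℕ) < l then Y j else Z j := by
        funext j t
        by_cases hj : (j : ℕ) < l
        · simp only [hj, if_true, hrep]
        · simp only [hj, if_false, hrep]
      exact q1 ▸ h1 l)
    filter_upwards [h] with i hi
    have q2 : (fun j : Fin m => if (j : ℕ) < l then (fun t => rep (Y j t) i) else (fun t => rep (Z j t) i)) =
        fun (j : Fin m) t => (if (j : ℕ) < l then rep (Y j t) else rep (Z j t)) i := by
      funext j t
      by_cases hj : (j : ℕ) < l <;> simp only [hj, if_true, if_false]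
    rw [q2]; exact hi
  have e2 : ∀ i j : Fin m, i ≤ j → ∀ᶠ l in (hyperfilter ℕ : Filter ℕ),
      ¬ K 2 ![fun t => rep (Y j t) l, fun t => rep (Z i t) l] := by
    intro i j hij
    rw [Ultrafilter.eventually_not, ← los2]
    simp only [hrep]
    exact h2 i j hij
  have e1' : ∀ᶠ i in (hyperfilter ℕ : Filter ℕ), ∀ l ∈ Finset.range (m+1),
      K m (fun j => if (j : ℕ) < l then (fun t => rep (Y j t) i) else (fun t => rep (Z j t) i)) :=
    (Filter.eventually_all_finset _).2 fun l hl => e1 l (by simp at hl; omega)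
  have e2' : ∀ᶠ l in (hyperfilter ℕ : Filter ℕ), ∀ i j : Fin m, i ≤ j →
      ¬ K 2 ![fun t => rep (Y j t) l, fun t => rep (Z i t) l] := by
    rw [Filter.eventually_all]; intro i
    rw [Filter.eventually_all]; intro j
    by_cases hij : i ≤ j
    · filter_upwards [e2 i j hij] with l hl _ using hl
    · exact Eventually.of_forall fun l h => absurd h hij
  obtain ⟨i, hi1, hi2⟩ := (e1'.and e2').exists
  exact ⟨fun j t => rep (Y j t) i, fun j t => rep (Z j t) i, fun l hl => hi1 l (by simp; omega), hi2⟩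

end Abs

namespace Abs
open Filter FirstOrder Language

set_option linter.unusedSectionVars false

theorem pattern_lhom {L : FirstOrder.Language.{u, v}} {L' : FirstOrder.Language.{x, y}} {W : Type w}
    [L.Structure W] [L'.Structure W] (g : L →ᴸ L') [g.IsExpansionOn W] (h : SOP1PatternIn L W) :
    SOP1PatternIn L' W := by
  obtain ⟨k, n, φ, bt, h1, h2⟩ := h
  refine ⟨k, n, g.onFormula φ, bt, ?_, ?_⟩
  · simpa only [LHom.realize_onFormula] using h1
  · simpa only [LHom.realize_onFormula] using h2

theorem pattern_equiv {L : FirstOrder.Language.{u, v}} {W : Type w} {W' : Type r}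
    [L.Structure W] [L.Structure W'] (e : W ≃[L] W') (h : SOP1PatternIn L W) :
    SOP1PatternIn L W' := by
  obtain ⟨k, n, φ, bt, h1, h2⟩ := h
  have key : ∀ (xx : Fin k → W) (t : Fin n → W), φ.Realize (Sum.elim (e ∘ xx) (e ∘ t)) ↔ φ.Realize (Sum.elim xx t) := by
    intro xx t
    rw [← StrongHomClass.realize_formula e φ, Sum.comp_elim]
  refine ⟨k, n, φ, fun η => e ∘ bt η, ?_, ?_⟩
  · intro σ S
    obtain ⟨xx, hx⟩ := h1 σ S
    exact ⟨e ∘ xx, fun i hi => (key _ _).2 (hx i hi)⟩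
  · rintro η₁ η₂ hη ⟨xx, hx1, hx2⟩
    have : xx = e ∘ (e.symm ∘ xx) := by funext i; simp
    rw [this] at hx1 hx2
    exact h2 η₁ η₂ hη ⟨e.symm ∘ xx, (key _ _).1 hx1, (key _ _).1 hx2⟩

theorem noPattern_UP {L' : FirstOrder.Language.{x, y}} {V : Type z} [L'.Structure V] [Nonempty V]
    (h : IsNSOP1Th L' V) : ¬ SOP1PatternIn L' (UP V) := by
  intro hp
  apply h
  let e : UP V ≃ ULift.{max x y} (UP V) := Equiv.ulift.symm
  letI : L'.Structure (ULift.{max x y} (UP V)) := e.inducedStructure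
  let e' : UP V ≃[L'] ULift.{max x y} (UP V) := e.inducedStructureEquiv
  refine ⟨ULift.{max x y} (UP V), e.inducedStructure, ?_, pattern_equiv e' hp⟩
  ext φ
  rw [mem_completeTheory, mem_completeTheory]
  rw [← StrongHomClass.realize_sentence e' φ, Ultraproduct.sentence_realize]
  simp

theorem noPattern_k {L' : FirstOrder.Language.{x, y}} {V : Type z} [L'.Structure V] [Nonempty V]
    (h : IsNSOP1Th L' V) {n : ℕ} (K : ∀ k, (Fin k → Fin n → V) → Prop)
    (ρ : ∀ k l, (Fin k × Fin n → Fin l) → L'.Relations l)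
    (hρ : ∀ k l f (w : Fin l → V), Structure.RelMap (ρ k l f) w ↔ K k (fun j t => w (f (j, t)))) :
    letI := kStr K
    ¬ SOP1PatternIn (kLang n) (UP V) := by
  letI := kStr K
  let g : kLang n →ᴸ L' := ⟨fun {_} f => Empty.elim f, fun {l} R => ρ R.1 l R.2⟩
  haveI : g.IsExpansionOn V := ⟨fun f => Empty.elim f, fun R w => propext (hρ _ _ _ w)⟩
  haveI : g.IsExpansionOn (UP V) := by
    refine ⟨fun f => Empty.elim f, fun {l} R w => ?_⟩
    obtain ⟨f, rfl⟩ : ∃ f : Fin l → ℕ → V, w = fun i => upc (f i) := by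
      choose f hf using fun i => upc_surj (w i)
      exact ⟨f, funext fun i => (hf i).symm⟩
    have h1 := upc_realize (V := V) (Relations.formula R (fun i => Term.var i)) f
    have h2 := upc_realize (V := V) (Relations.formula (g.onRelation R) (fun i => Term.var i)) f
    simp only [Formula.realize_rel, Term.realize_var, LHom.map_onRelation] at h1 h2
    exact propext (h2.trans h1.symm)
  intro hp
  exact noPattern_UP h (pattern_lhom g hp)

end Abs

namespace Abs
open Filter FirstOrder Language

set_option linter.unusedSectionVars false

section bridge
variable {L : FirstOrder.Language.{u, v}} {𝕄 : Type w} [L.Structure 𝕄] [DSys 𝕄]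

/-- the system is that of sets definable over `N` -/
def IsDS (N : L.ElementarySubstructure 𝕄) : Prop :=
  (∀ {α : Type} (S : Set (α → 𝕄)), DSys.D S ↔ DefN N S) ∧ DSys.M (𝕄 := 𝕄) = (N : Set 𝕄)

variable {N : L.ElementarySubstructure 𝕄}

theorem pf_def (hD : IsDS N) {X : Type w} [Srt 𝕄 X] (φ : ParamFormula L 𝕄 (Srt.idx X)) (hφ : φ.ParamsIn (N : Set 𝕄)) :
    Def (fun x : X => φ.Realize (Srt.eqv x)) := by
  refine (hD.1 _).2 ⟨φ.toFormula.relabel (Sum.elim Sum.inr (fun p => Sum.inl ⟨φ.params p, hφ p⟩)), fun v => ?_⟩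
  rw [Formula.realize_relabel]
  change φ.Realize (Srt.eqv (Srt.eqv.symm v)) ↔ _
  rw [Equiv.apply_symm_apply]
  unfold ParamFormula.Realize
  apply iff_of_eq; congr 1
  funext i; rcases i with i | i <;> rfl

theorem def_pf (hD : IsDS N) {X : Type w} [Srt 𝕄 X] {P : X → Prop} (hP : Def P) :
    ∃ φ : ParamFormula L 𝕄 (Srt.idx X), φ.ParamsIn (N : Set 𝕄) ∧ ∀ x, P x ↔ φ.Realize (Srt.eqv x) := by
  obtain ⟨θ, h⟩ := (hD.1 _).1 hP
  obtain ⟨k, m, r, s, θ', -, -, h'⟩ := fml_split (W := 𝕄) θ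
  refine ⟨⟨Fin k, θ'.relabel (Sum.elim Sum.inr (fun i => Sum.inl (s i))), fun i => (r i : 𝕄)⟩, fun i => (r i).2, fun x => ?_⟩
  have := h (Srt.eqv x)
  simp only [Set.mem_setOf_eq, Equiv.symm_apply_apply] at this
  rw [this, h']
  unfold ParamFormula.Realize
  rw [Formula.realize_relabel]
  apply iff_of_eq; congr 1
  funext i; rcases i with i | i <;> rfl

theorem Def.coordEq {Z : Type w} [Srt 𝕄 Z] (i j : Srt.idx Z) : Def (fun z : Z => Srt.eqv z i = Srt.eqv z j) := by
  unfold Def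
  simpa using DSys.diag (𝕄 := 𝕄) i j

theorem good_P (hD : IsDS N) (hN3 : NS3 𝕄) {nv : ℕ} (P : Set (ParamFormula L 𝕄 (Fin nv)))
    (hP : ∀ φ ∈ P, φ.ParamsIn (N : Set 𝕄)) (hInt : IsNSOP1Th (pLang L 𝕄 (N : Set 𝕄) nv) (PRealizations L 𝕄 P))
    {m : ℕ} (a : Fin m → Fin nv → 𝕄) (ha : ∀ j, RealizesPType L 𝕄 P (a j)) :
    Good (X := Tup 𝕄 (Fin m × Fin nv)) (flat a) := by
  classical
  rintro ⟨ι, _, A, _, φ, T, hφ, hE, h1, h2⟩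
  have hT : ∀ η i j, RealizesPType L 𝕄 P (fun s => T η i (j, s)) := by
    intro η i j χ hχ
    have hd := (pf_def hD (X := Tup 𝕄 (Fin nv)) χ (hP χ hχ)).comp
      (f := fun t : Tup 𝕄 (Fin m × Fin nv) => (fun s => t (j, s) : Tup 𝕄 (Fin nv))) ⟨fun s => (j, s), fun _ _ => rfl⟩
    exact (hE η i).symm _ hd (ha j χ hχ)
  obtain ⟨F, hF⟩ := hφ.fs
  let F' : Finset (ι × Fin m) := F.toRight.image (fun q : ι × (Fin m × Fin nv) => (q.1, q.2.1))
  let n := F'.card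
  let rr : Fin n → ι × Fin m := fun t => (F'.equivFin.symm t).1
  have hrr : ∀ q ∈ F', ∃ t, rr t = q := fun q hq => ⟨F'.equivFin ⟨q, hq⟩, by simp [rr]⟩
  let V0 := Fin n → Tup 𝕄 (Fin nv)
  let res : (ι → Tup 𝕄 (Fin m × Fin nv)) → V0 := fun t k s => t (rr k).1 ((rr k).2, s)
  let ψ : A × V0 → Prop := fun q => ∃ t' : ι → Tup 𝕄 (Fin m × Fin nv), φ (q.1, t') ∧ ∀ k s, q.2 k s = res t' k s
  have hψ : Def ψ := by
    have : Def (fun z : (A × V0) × (ι → Tup 𝕄 (Fin m × Fin nv)) => φ (z.1.1, z.2) ∧ ∀ k s, z.1.2 k s = res z.2 k s) := by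
      refine Def.and (hφ.comp (f := fun z : (A × V0) × (ι → Tup 𝕄 (Fin m × Fin nv)) => (z.1.1, z.2)) (by fun_prop)) ?_
      refine Def.all fun k => Def.all fun s => ?_
      exact Def.coordEq (Z := (A × V0) × (ι → Tup 𝕄 (Fin m × Fin nv))) (Sum.inl (Sum.inr (k, s))) (Sum.inr ((rr k).1, ((rr k).2, s)))
    exact this.ex
  have key : ∀ x t, φ (x, t) ↔ ψ (x, res t) := by
    intro x t
    constructor
    · intro h; exact ⟨t, h, fun _ _ => rfl⟩
    · rintro ⟨t', h, h'⟩
      refine hF (x, t') (x, t) ?_ h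
      intro i hi
      rcases i with i | ⟨i, j, s⟩
      · rfl
      · obtain ⟨k, hk⟩ := hrr (i, j) (Finset.mem_image.2 ⟨(i, (j, s)), by simpa using hi, rfl⟩)
        have := h' k s
        change t (rr k).1 ((rr k).2, s) = t' (rr k).1 ((rr k).2, s) at this
        rw [hk] at this
        exact this.symm
  let V := PRealizations L 𝕄 P
  let T' : List Bool → Fin n → V := fun η k => ⟨fun s => T η (rr k).1 ((rr k).2, s), hT _ _ _⟩
  by_cases hV : Nonempty V
  swap
  · obtain ⟨x, hx⟩ := h1 [false]
    refine h2 [] [false] (by simp) ⟨x, hx _ List.prefix_rfl, ?_⟩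
    rw [key]
    have := (key x _).1 (hx _ List.prefix_rfl)
    have e : res (T ([] ++ [true])) = res (T [false]) := funext fun k => absurd ⟨T' [] k⟩ hV
    rw [e]
    exact this
  let K : ∀ k, (Fin k → Fin n → V) → Prop := fun k v => ∃ x : A, ∀ j, ψ (x, fun t => ((v j t).1 : Tup 𝕄 (Fin nv)))
  have hK : ∀ k l (f : Fin k × Fin n → Fin l), ∃ R : (pLang L 𝕄 (N : Set 𝕄) nv).Relations l,
      ∀ w : Fin l → V, Structure.RelMap R w ↔ K k (fun j t => w (f (j, t))) := by
    intro k l f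
    have hd : Def (fun w : Tup 𝕄 (Fin l × Fin nv) => ∃ x : A, ∀ j : Fin k, ψ (x, fun t => (fun s => w (f (j, t), s) : Tup 𝕄 (Fin nv)))) := by
      have : Def (fun z : Tup 𝕄 (Fin l × Fin nv) × A => ∀ j : Fin k, ψ (z.2, fun t => (fun s => z.1 (f (j, t), s) : Tup 𝕄 (Fin nv)))) := by
        refine Def.all fun j => ?_
        refine hψ.comp (f := fun z : Tup 𝕄 (Fin l × Fin nv) × A => ((z.2, fun t s => z.1 (f (j, t), s)) : A × V0)) ?_
        refine Co.mk (by fun_prop) ?_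
        exact ⟨fun s : Fin n × Fin nv => Sum.inl (f (j, s.1), s.2), fun _ _ => rfl⟩
      exact this.ex
    obtain ⟨χ, hχ, hχ'⟩ := def_pf hD hd
    exact ⟨⟨χ, hχ⟩, fun w => (hχ' (fun q => (w q.1).1 q.2)).symm⟩
  choose ρ hρ using hK
  have H := noPattern_k hInt K ρ hρ
  have hVV := VV K H T' (by
      intro σ k f hf
      obtain ⟨x, hx⟩ := h1 σ
      exact ⟨x, fun j => (key x _).1 (hx _ (hf j))⟩) (by
      rintro η₁ η₂ hη ⟨x, hx⟩
      exact h2 η₁ η₂ hη ⟨x, (key x _).2 (hx 1), (key x _).2 (hx 0)⟩)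
  let R : (A × V0 × V0) × (A × V0 × V0) → Prop := fun q =>
    (ψ (q.2.1, q.1.2.1) ∧ ψ (q.1.1, q.2.2.2)) ∧ ¬ ∃ x, ψ (x, q.2.2.1) ∧ ψ (x, q.1.2.2)
  have hR : Def R := by
    refine Def.and (Def.and ?_ ?_) (Def.not ?_)
    · exact hψ.comp (f := fun q : (A × V0 × V0) × (A × V0 × V0) => (q.2.1, q.1.2.1)) (by fun_prop)
    · exact hψ.comp (f := fun q : (A × V0 × V0) × (A × V0 × V0) => (q.1.1, q.2.2.2)) (by fun_prop)
    · refine Def.ex (P := fun z : ((A × V0 × V0) × (A × V0 × V0)) × A => ψ (z.2, z.1.2.2.1) ∧ ψ (z.2, z.1.1.2.2)) ?_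
      refine Def.and ?_ ?_
      · exact hψ.comp (f := fun z : ((A × V0 × V0) × (A × V0 × V0)) × A => (z.2, z.1.2.2.1)) (by fun_prop)
      · exact hψ.comp (f := fun z : ((A × V0 × V0) × (A × V0 × V0)) × A => (z.2, z.1.1.2.2)) (by fun_prop)
  obtain ⟨e1, e2, e3, ⟨⟨p1, p2⟩, p3⟩, ⟨⟨q1, q2⟩, q3⟩, ⟨r1, r2⟩, r3⟩ := hN3 _ R hR (by
    intro l
    obtain ⟨Y, Z, hYZ, hn⟩ := hVV l
    have : ∀ i : Fin l, ∃ x : A, ∀ j : Fin l, ψ (x, fun t => (((if (j : ℕ) < (i : ℕ) then Y j else Z j) t).1 : Tup 𝕄 (Fin nv))) :=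
      fun i => hYZ i i.2.le
    choose X hX using this
    refine ⟨fun i => (X i, (fun t => (Y i t).1), (fun t => (Z i t).1)), fun i j hij => ⟨⟨?_, ?_⟩, ?_⟩⟩
    · have := hX j i
      rwa [if_pos (Fin.lt_def.1 hij)] at this
    · have := hX i j
      rwa [if_neg (by have := Fin.lt_def.1 hij; omega)] at this
    · rintro ⟨x, hx1, hx2⟩
      refine hn i j hij.le ⟨x, fun k => ?_⟩
      fin_cases k
      · exact hx1
      · exact hx2)
  exact p3 ⟨e3.1, q1, r2⟩
end bridge

end Abs

namespace Abs
open Filter FirstOrder Language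

set_option linter.unusedSectionVars false

section klf
variable {𝕄 : Type w} [DSys 𝕄] {X Y Z A B : Type w} [Srt 𝕄 X] [Srt 𝕄 Y] [Srt 𝕄 Z] [Srt 𝕄 A] [Srt 𝕄 B]

/-- Kim lemma for formulas -/
theorem KLf {b : X} (hb : Good b) {p q : IT X} {P : A × X → Prop} (hP : Def P) (hp : p.Ext b) (hq : q.Ext b)
    (hd : Dv q P) : Dv p P := by
  classical
  by_contra hc
  obtain ⟨k, hk⟩ := hd.finF hP
  obtain ⟨u, hu⟩ := Mor.exists (p.tensor q) (un : Un 𝕄)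
  have hu1 : Mor p (un : Un 𝕄) (fun i => (u i).1) := fun i => p.mono (hu i).1
    (f := fun z : X × (Fin i → X × X) × Un 𝕄 => ((fun j : Fin i => (z.2.1 j).1), z.2.2)) (by fun_prop)
  have hu2 : Mor q (un : Un 𝕄) (fun i => (u i).2) := fun i => q.mono (hu i).2
    (f := fun z : (Fin i → X × X) × Un 𝕄 => ((fun j : Fin i => (z.1 j).2), z.2)) (by fun_prop)
  refine AL hb hP (k := k) fun n => ⟨fun i => i.elim0, fun i => u (n - 1 - i), fun i => i.elim0,
    fun i _ => hu1.extE _ hp, ?_, ?_, ?_⟩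
  · intro i hi
    have hm := (hu.shift (n - i)).fin i
    have hlt : n - 1 - i < n - i := by omega
    have h1 : MorF (p.tensor q) (u (n-1-i)).1 (fun j : Fin i => u (n - i + j)) := fun j =>
      IT.mono _ (hm j) (f := fun z : (Fin j → X × X) × (Fin (n-i) → X × X) × Un 𝕄 => (z.1, (z.2.1 ⟨n-1-i, hlt⟩).1)) (by fun_prop)
    have h2 : MorF (p.tensor q) (u (n-1-i)).2 (fun j : Fin i => u (n - i + j)) := fun j =>
      IT.mono _ (hm j) (f := fun z : (Fin j → X × X) × (Fin (n-i) → X × X) × Un 𝕄 => (z.1, (z.2.1 ⟨n-1-i, hlt⟩).2)) (by fun_prop)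
    have e := h1.uniq h2 ((hu1.extE _ hp).trans (hu2.extE _ hq).symm)
    have := e.map (f := fun z : (Fin i → X × X) × X =>
      ((((fun j => j.elim0) : Fin 0 → X), fun j : Fin i => z.1 ⟨i - 1 - j, by omega⟩), z.2)) (by
        refine Co.mk (Co.mk (Co.pi fun j => j.elim0) (by fun_prop)) (by fun_prop))
    have hj : ∀ j : Fin i, n - 1 - j.1 = n - i + (i - 1 - j.1) := fun j => by omega
    simp only [hj]
    exact this
  · obtain ⟨a', ha'⟩ := Dv.not hP hc hu1
    exact ⟨a', fun j => j.elim0, fun i _ => ha' _⟩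
  · rintro s hs hcard ⟨x, -, hx⟩
    rcases Nat.eq_zero_or_pos n with rfl | hn
    · have : s = ∅ := Finset.eq_empty_of_forall_notMem fun i hi => by simpa using hs i hi
      subst this
      exact hk 0 _ (hu2.fin 0) ∅ (by simp at hcard ⊢; omega) ⟨x, by simp⟩
    refine hk n _ (hu2.fin n) (s.image fun i => ⟨n-1-i, by omega⟩) ?_ ⟨x, ?_⟩
    · rw [Finset.card_image_of_injOn]
      · omega
      · intro i hi j hj hij
        have h1 := hs i hi
        have h2 := hs j hj
        simp only [Fin.mk.injEq] at hij
        omega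
    · intro i hi
      obtain ⟨j, hj, rfl⟩ := Finset.mem_image.1 hi
      exact hx j hj
end klf

section gt
variable {L : FirstOrder.Language.{u, v}} {𝕄 : Type w} [L.Structure 𝕄]

theorem pf_not_realize {α : Type x} (φ : ParamFormula L 𝕄 α) (v : α → 𝕄) : φ.not.Realize v ↔ ¬ φ.Realize v := Iff.rfl

theorem pf_subst_realize {α : Type x} {γ : Type} (φ : ParamFormula L 𝕄 (α ⊕ γ)) (c : γ → 𝕄) (v : α → 𝕄) :
    (φ.subst c).Realize v ↔ φ.Realize (Sum.elim v c) := by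
  unfold ParamFormula.Realize ParamFormula.subst
  rw [Formula.realize_relabel]
  apply iff_of_eq; congr 1
  funext i; rcases i with (i | i) | i <;> rfl

/-- renaming the variables -/
def pmap {α : Type x} {β : Type y} (f : α → β) (φ : ParamFormula L 𝕄 α) : ParamFormula L 𝕄 β :=
  ⟨φ.Params, φ.toFormula.relabel (Sum.map f id), φ.params⟩

theorem pmap_realize {α : Type x} {β : Type y} (f : α → β) (φ : ParamFormula L 𝕄 α) (v : β → 𝕄) :
    (pmap f φ).Realize v ↔ φ.Realize (v ∘ f) := by
  unfold ParamFormula.Realize pmap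
  rw [Formula.realize_relabel]
  apply iff_of_eq; congr 1
  funext i; rcases i with i | i <;> rfl

theorem gt_mem_of {α : Type x} (p : GlobalType L 𝕄 α) {φ ψ : ParamFormula L 𝕄 α} (h : p.Mem φ)
    (hi : ∀ v, φ.Realize v → ψ.Realize v) : p.Mem ψ := by
  classical
  refine (p.complete ψ).resolve_right fun hn => ?_
  obtain ⟨v, hv⟩ := p.consistent {φ, ψ.not} (by
    intro χ hχ
    simp only [Finset.mem_insert, Finset.mem_singleton] at hχ
    rcases hχ with rfl | rfl
    · exact h
    · exact hn)
  exact hv ψ.not (by simp) (hi v (hv φ (by simp)))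

/-- restriction of a global type along a map of variables -/
def gres {α : Type x} {β : Type y} (p : GlobalType L 𝕄 β) (f : α → β) : GlobalType L 𝕄 α where
  Mem φ := p.Mem (pmap f φ)
  consistent S hS := by
    classical
    obtain ⟨v, hv⟩ := p.consistent (S.image (pmap f)) (by
      intro χ hχ
      obtain ⟨φ, hφ, rfl⟩ := Finset.mem_image.1 hχ
      exact hS φ hφ)
    exact ⟨v ∘ f, fun φ hφ => (pmap_realize f φ v).1 (hv _ (Finset.mem_image_of_mem _ hφ))⟩
  complete φ := by
    rcases p.complete (pmap f φ) with h | h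
    · exact Or.inl h
    · refine Or.inr (gt_mem_of p h fun v hv => ?_)
      rw [pmap_realize]
      rw [pf_not_realize, pmap_realize] at hv
      exact hv

theorem gres_inv {α : Type x} {β : Type y} {p : GlobalType L 𝕄 β} {A : Set 𝕄} (h : p.InvariantOver A) (f : α → β) :
    (gres p f).InvariantOver A := fun P ψ b b' hb => h P (ψ.relabel (Sum.map f id)) b b' hb

theorem real_mono {α : Type x} {p : GlobalType L 𝕄 α} {A B : Set 𝕄} {a : α → 𝕄} (h : p.RealizesOver B a) (hAB : A ⊆ B) :
    p.RealizesOver A a := fun φ hφ hA => h φ hφ fun i => hAB (hA i)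

theorem gres_real {α : Type x} {β : Type y} {p : GlobalType L 𝕄 β} {A : Set 𝕄} {a : β → 𝕄} (h : p.RealizesOver A a) (f : α → β) :
    (gres p f).RealizesOver A (a ∘ f) := fun φ hφ hA => (pmap_realize f φ a).1 (h _ hφ hA)

theorem gres_mor {α : Type x} {β : Type y} {p : GlobalType L 𝕄 β} {A : Set 𝕄} {b : ℕ → β → 𝕄} (h : p.IsMorleyOver A b) (f : α → β) :
    (gres p f).IsMorleyOver A (fun i => b i ∘ f) := fun i => by
  refine real_mono (gres_real (h i) f) ?_
  refine Set.union_subset_union_right _ ?_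
  exact Set.iUnion₂_mono fun j _ => Set.range_comp_subset_range _ _

theorem inv_mor_res {α : Type x} {β : Type y} {A : Set 𝕄} {b : ℕ → β → 𝕄} (h : IsInvMorleyOver L 𝕄 A b) (f : α → β) :
    IsInvMorleyOver L 𝕄 A (fun i => b i ∘ f) := by
  obtain ⟨p, h1, h2⟩ := h
  exact ⟨gres p f, gres_inv h1 f, gres_mor h2 f⟩

variable [DSys 𝕄] {N : L.ElementarySubstructure 𝕄}
variable {X Y Z A B : Type w} [Srt 𝕄 X] [Srt 𝕄 Y] [Srt 𝕄 Z] [Srt 𝕄 A] [Srt 𝕄 B]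

variable (N) in
/-- tuples of coordinates and of constants -/
def CF {γ : Type x} (g : Z → γ → 𝕄) : Prop :=
  ∀ i, (∃ n : N, ∀ z, g z i = n) ∨ ∃ j : Srt.idx Z, ∀ z, g z i = Srt.eqv z j

theorem def_real (hD : IsDS N) {γ : Type x} (ψ : L.Formula γ) {g : Z → γ → 𝕄} (hg : CF N g) :
    Def (fun z => ψ.Realize (g z)) := by
  have : ∀ i, ∃ k : N ⊕ Srt.idx Z, ∀ z, g z i = Sum.elim (fun n : N => (n : 𝕄)) (Srt.eqv z) k := by
    intro i
    rcases hg i with ⟨n, hn⟩ | ⟨j, hj⟩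
    · exact ⟨Sum.inl n, hn⟩
    · exact ⟨Sum.inr j, hj⟩
  choose k hk using this
  refine (hD.1 _).2 ⟨ψ.relabel k, fun v => ?_⟩
  rw [Formula.realize_relabel]
  apply iff_of_eq
  change ψ.Realize (g (Srt.eqv.symm v)) = _
  congr 1
  funext i
  rw [hk]; simp

theorem CF.ofParams (y : Y) {γ : Type x} {c : γ → 𝕄} (h : ∀ i, c i ∈ (N : Set 𝕄) ∪ Set.range (Srt.eqv y)) :
    ∃ g : Y → γ → 𝕄, CF N g ∧ g y = c := by
  have : ∀ i, ∃ g : Y → 𝕄, ((∃ n : N, ∀ z, g z = n) ∨ ∃ j : Srt.idx Y, ∀ z, g z = Srt.eqv z j) ∧ g y = c i := by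
    intro i
    rcases h i with h | ⟨j, hj⟩
    · exact ⟨fun _ => c i, Or.inl ⟨⟨c i, h⟩, fun _ => rfl⟩, rfl⟩
    · exact ⟨fun z => Srt.eqv z j, Or.inr ⟨j, fun _ => rfl⟩, hj⟩
  choose g hg hg' using this
  exact ⟨fun z i => g i z, hg, funext hg'⟩

theorem CF.const {γ : Type x} {c : γ → 𝕄} (h : ∀ i, c i ∈ (N : Set 𝕄)) : CF (Z := Z) N (fun _ => c) :=
  fun i => Or.inl ⟨⟨c i, h i⟩, fun _ => rfl⟩
theorem CF.eqv : CF (Z := Z) N (fun z => Srt.eqv z) := fun i => Or.inr ⟨i, fun _ => rfl⟩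
theorem CF.sum {γ : Type x} {δ : Type y} {g : Z → γ → 𝕄} {h : Z → δ → 𝕄} (hg : CF N g) (hh : CF N h) :
    CF N (fun z => Sum.elim (g z) (h z)) := fun i => match i with
  | Sum.inl i => hg i
  | Sum.inr i => hh i
theorem CF.comp {γ : Type x} {g : Y → γ → 𝕄} (hg : CF N g) {f : Z → Y} (hf : Co f) : CF N (fun z => g (f z)) := by
  obtain ⟨r, hr⟩ := hf
  intro i
  rcases hg i with ⟨n, hn⟩ | ⟨j, hj⟩
  · exact Or.inl ⟨n, fun z => hn _⟩
  · exact Or.inr ⟨r j, fun z => (hj _).trans (hr _ _)⟩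

theorem E.tp (hD : IsDS N) {z z' : Z} (e : E z z') {γ : Type x} {g : Z → γ → 𝕄} (hg : CF N g) :
    TpEq L 𝕄 (N : Set 𝕄) (g z) (g z') := fun χ hχ =>
  e.iff (def_real hD χ.toFormula (hg.sum (CF.const hχ)))

theorem E.of_tp (hD : IsDS N) {z z' : Z} (e : TpEq L 𝕄 (N : Set 𝕄) (Srt.eqv z) (Srt.eqv z')) : E z z' := by
  intro P hP hz
  obtain ⟨φ, hφ, h⟩ := def_pf hD hP
  rw [h] at hz ⊢
  exact (e φ hφ).1 hz

theorem E.tpOver (hD : IsDS N) {a a' : A} {b : X} (e : E (a, b) (a', b)) :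
    TpEq L 𝕄 ((N : Set 𝕄) ∪ Set.range (Srt.eqv b)) (Srt.eqv a) (Srt.eqv a') := by
  intro φ hφ
  obtain ⟨g, hg, hgb⟩ := CF.ofParams b hφ
  have := e.iff (def_real hD φ.toFormula (Z := A × X) (g := fun z => Sum.elim (Srt.eqv z.1) (g z.2))
    ((CF.eqv.comp Co.fst').sum (hg.comp Co.snd')))
  simp only [hgb] at this
  exact this

/-- the invariant type attached to a global type -/
def ITof (hD : IsDS N) (p : GlobalType L 𝕄 (Srt.idx X)) (hp : p.InvariantOver (N : Set 𝕄)) : IT X where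
  R x y := p.RealizesOver ((N : Set 𝕄) ∪ Set.range (Srt.eqv y)) (Srt.eqv x)
  ex := by
    intro Y _ y
    let ι := {φ : ParamFormula L 𝕄 (Srt.idx X) // p.Mem φ ∧ φ.ParamsIn ((N : Set 𝕄) ∪ Set.range (Srt.eqv y))}
    have := fun φ : ι => CF.ofParams (N := N) y φ.2.2
    choose g hg hgy using this
    obtain ⟨x, hx⟩ := satX (X := X) (Y := Y) (ι := ι) (fun φ q => φ.1.toFormula.Realize (Sum.elim (Srt.eqv q.1) (g φ q.2)))
      (fun φ => def_real hD _ ((CF.eqv.comp Co.fst').sum ((hg φ).comp Co.snd'))) y (by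
        classical
        intro s
        obtain ⟨v, hv⟩ := p.consistent (s.image fun φ => φ.1) (by
          intro χ hχ
          obtain ⟨φ, hφ, rfl⟩ := Finset.mem_image.1 hχ
          exact φ.2.1)
        refine ⟨Srt.eqv.symm v, fun φ hφ => ?_⟩
        have := hv φ.1 (Finset.mem_image_of_mem _ hφ)
        simp only [hgy, Equiv.apply_symm_apply]
        exact this)
    refine ⟨x, fun φ h1 h2 => ?_⟩
    have := hx ⟨φ, h1, h2⟩
    simp only [hgy] at this
    exact this
  uniq := by
    intro Y _ x x' y y' h h' e P hP hxy
    obtain ⟨φ, hφ, hφ'⟩ := def_pf hD hP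
    have hin : ∀ y : Y, (φ.subst (Srt.eqv y)).ParamsIn ((N : Set 𝕄) ∪ Set.range (Srt.eqv y)) := by
      rintro y (i | i)
      · exact Or.inr ⟨i, rfl⟩
      · exact Or.inl (hφ i)
    have key : ∀ x y, P (x, y) ↔ (φ.subst (Srt.eqv y)).Realize (Srt.eqv x) := by
      intro x y
      rw [pf_subst_realize, hφ', eqv_pair]
    rw [key] at hxy ⊢
    rcases p.complete (φ.subst (Srt.eqv y)) with hm | hm
    · refine h' _ ?_ (hin y')
      refine (hp _ _ _ _ ?_).1 hm
      exact e.tp hD (CF.eqv.sum (CF.const hφ))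
    · exact absurd hxy (h _ hm (hin y))
  closed := by
    intro Y _ x x' y y' h e φ hm hφ
    obtain ⟨g, hg, hgy⟩ := CF.ofParams y' hφ
    have ey : E y y' := e.map Co.snd'
    have hm' : p.Mem ⟨φ.Params, φ.toFormula, g y⟩ := by
      refine (hp _ _ _ _ (ey.tp hD hg)).2 ?_
      rw [hgy]; exact hm
    have := h _ hm' (by
      intro i
      rcases hg i with ⟨n, hn⟩ | ⟨j, hj⟩
      · exact Or.inl ((hn y).symm ▸ n.2 : g y i ∈ (N : Set 𝕄))
      · exact Or.inr ⟨j, (hj _).symm⟩)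
    have := e _ (def_real hD φ.toFormula (Z := X × Y) (g := fun z => Sum.elim (Srt.eqv z.1) (g z.2))
      ((CF.eqv.comp Co.fst').sum (hg.comp Co.snd'))) this
    simp only [hgy] at this
    exact this
  mono := by
    intro Y Z _ _ x y f h hf
    obtain ⟨r, hr⟩ := hf
    refine real_mono h (Set.union_subset_union_right _ ?_)
    rintro _ ⟨i, rfl⟩
    exact ⟨r i, (hr _ _).symm⟩

theorem ITof_mor (hD : IsDS N) {p : GlobalType L 𝕄 (Srt.idx X)} (hp : p.InvariantOver (N : Set 𝕄))
    {b : ℕ → Srt.idx X → 𝕄} (hb : p.IsMorleyOver (N : Set 𝕄) b) :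
    Mor (ITof hD p hp) (un : Un 𝕄) (fun i => (Srt.eqv (X := X)).symm (b i)) := by
  intro i
  change p.RealizesOver _ (Srt.eqv (Srt.eqv.symm (b i)))
  rw [Equiv.apply_symm_apply]
  refine real_mono (hb i) (Set.union_subset_union_right _ ?_)
  rintro _ ⟨k, rfl⟩
  rcases k with ⟨j, k⟩ | k
  · refine Set.mem_iUnion₂.2 ⟨j.1, j.2, k, ?_⟩
    change _ = Srt.eqv (Srt.eqv.symm (b j)) k
    rw [Equiv.apply_symm_apply]
  · exact (k : Empty).elim
end gt

end Abs

namespace Abs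
open Filter FirstOrder Language

set_option linter.unusedSectionVars false

section conc
variable {L : FirstOrder.Language.{u, v}} {𝕄 : Type w} [L.Structure 𝕄]

theorem mor_const {α : Type x} {A : Set 𝕄} {b : ℕ → α → 𝕄} (h : IsInvMorleyOver L 𝕄 A b) {k : α} (hk : b 0 k ∈ A) (i : ℕ) :
    b i k = b 0 k := by
  obtain ⟨p, -, hb⟩ := h
  let φ : ParamFormula L 𝕄 α := ⟨Unit, Term.equal (Term.var (Sum.inl k)) (Term.var (Sum.inr ())), fun _ => b 0 k⟩
  have hφ : ∀ v, φ.Realize v ↔ v k = b 0 k := by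
    intro v
    change Formula.Realize (Term.equal _ _) _ ↔ _
    rw [Formula.realize_equal]
    rfl
  rcases p.complete φ with h | h
  · exact (hφ _).1 (hb i φ h fun _ => Or.inl hk)
  · exact absurd ((hφ _).2 rfl) (hb 0 φ.not h fun _ => Or.inl hk)

theorem not_cd {γ : Type x} {A B : Set 𝕄} {a : γ → 𝕄} (h : IndConant L 𝕄 A B a) {φ : ParamFormula L 𝕄 γ}
    (h1 : φ.ParamsIn (A ∪ B)) (h2 : φ.Realize a) : ¬ φ.ConantDividesOver A := fun hd =>
  h φ h1 h2 ⟨1, fun _ => φ, fun _ => hd, fun _ hx => ⟨0, hx⟩⟩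

theorem hex_of {γ : Type x} {A B : Set 𝕄} {a : γ → 𝕄} (h : IndConant L 𝕄 A B a) (α : Type) (d : α → 𝕄) :
    ∃ e : ℕ → α → 𝕄, e 0 = d ∧ IsInvMorleyOver L 𝕄 A e := by
  by_contra hc
  push Not at hc
  refine h ⟨Empty, ⊤, fun i => i.elim⟩ (fun i => i.elim) (Formula.realize_top.2 trivial) ⟨1, fun _ => ⟨α, ⊤, d⟩, fun _ e he1 he2 _ => hc e he1 he2, fun _ _ => ⟨0, Formula.realize_top.2 trivial⟩⟩

theorem conant_univ {γ : Type x} {A B : Set 𝕄} (hA : A = Set.univ) (a : γ → 𝕄) : IndConant L 𝕄 A B a := by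
  subst hA
  rintro φ - hφ ⟨k, ψ, hd, hi⟩
  obtain ⟨j, hj⟩ := hi a hφ
  refine hd j (fun _ => (ψ j).params) rfl ?_ fun s => ⟨a, fun _ _ => hj⟩
  refine ⟨⟨fun φ => φ.Realize (ψ j).params, fun S hS => ⟨_, hS⟩, fun φ => Classical.em _⟩, ?_, ?_⟩
  · intro P χ b b' h
    have : b = b' := by
      funext i
      have := h ⟨Unit, Term.equal (Term.var (Sum.inl i)) (Term.var (Sum.inr ())), fun _ => b i⟩ (fun _ => trivial)
      have := this.1 (by
        change Formula.Realize (Term.equal _ _) _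
        rw [Formula.realize_equal]; rfl)
      change Formula.Realize (Term.equal _ _) _ at this
      rw [Formula.realize_equal] at this
      exact this.symm
    rw [this]
  · intro i φ h _
    exact h

theorem tp_univ {γ : Type x} {b b' : γ → 𝕄} (h : TpEq L 𝕄 (Set.univ : Set 𝕄) b b') : b = b' := by
  funext i
  have := h ⟨Unit, Term.equal (Term.var (Sum.inl i)) (Term.var (Sum.inr ())), fun _ => b i⟩ (fun _ => trivial)
  have := this.1 (by
    change Formula.Realize (Term.equal _ _) _
    rw [Formula.realize_equal]; rfl)
  change Formula.Realize (Term.equal _ _) _ at this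
  rw [Formula.realize_equal] at this
  exact this.symm

variable {N : L.ElementarySubstructure 𝕄}

theorem model_inf [Nonempty 𝕄] (hN : (N : Set 𝕄) ≠ Set.univ) : Infinite N := by
  classical
  by_contra hf
  rw [not_infinite_iff_finite] at hf
  have := Fintype.ofFinite N
  obtain ⟨z, hz⟩ := (Set.ne_univ_iff_exists_notMem _).1 hN
  have hd : DefN N {x : Unit → 𝕄 | x () ∉ (N : Set 𝕄)} := by
    refine ⟨BoundedFormula.iInf (α := N ⊕ Unit) (n := 0) fun n : N =>
      BoundedFormula.not (Term.equal (Term.var (Sum.inr ())) (Term.var (Sum.inl n)) : L.Formula (N ⊕ Unit)), fun v => ?_⟩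
    unfold Formula.Realize
    rw [BoundedFormula.realize_iInf]
    constructor
    · intro h n hn
      have hn : Formula.Realize (Term.equal (Term.var (Sum.inr ())) (Term.var (Sum.inl n)) : L.Formula (N ⊕ Unit)) (Sum.elim (fun n : N => (n : 𝕄)) v) := hn
      rw [Formula.realize_equal] at hn
      have hn : v () = n := hn
      exact h (hn ▸ n.2)
    · intro h hv
      refine h ⟨v (), hv⟩ ?_
      change Formula.Realize (Term.equal (Term.var (Sum.inr ())) (Term.var (Sum.inl _)) : L.Formula (N ⊕ Unit)) (Sum.elim (fun n : N => (n : 𝕄)) v)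
      rw [Formula.realize_equal]
      rfl
  obtain ⟨m, hm, hm'⟩ := hd.model ⟨fun _ => z, hz⟩
  exact hm (hm' ())

theorem sat_of [Nonempty 𝕄] (κ : Cardinal.{w}) [hκ : IsMonster L 𝕄 κ] (hN : (N : Set 𝕄) ≠ Set.univ)
    (hs : Cardinal.mk ↥(N : Set 𝕄) < κ) : SatN N := by
  classical
  intro α β _ _ c F hF
  have hinf := model_inf hN
  have h0 : Cardinal.aleph0 ≤ Cardinal.mk ↥(N : Set 𝕄) := Cardinal.aleph0_le_mk N
  have hα : Cardinal.mk (ULift.{w} α) < κ := lt_of_le_of_lt (Cardinal.mk_le_aleph0) (lt_of_le_of_lt h0 hs)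
  have hA : Cardinal.mk ↥((N : Set 𝕄) ∪ Set.range c) < κ := by
    refine lt_of_le_of_lt ((Cardinal.mk_union_le _ _).trans ?_) hs
    have hc : Cardinal.mk ↥(Set.range c) ≤ Cardinal.aleph0 := by
      have := (Set.countable_range c).to_subtype
      exact Cardinal.mk_le_aleph0
    exact Cardinal.add_le_of_le h0 le_rfl (hc.trans h0)
  have key : ∀ θ : L.Formula (N ⊕ (α ⊕ β)), ∃ φ : ParamFormula L 𝕄 (ULift.{w} α), φ.ParamsIn ((N : Set 𝕄) ∪ Set.range c) ∧
      ∀ x : ULift.{w} α → 𝕄, φ.Realize x ↔ θ.Realize (Sum.elim (fun n : N => (n : 𝕄)) (Sum.elim (fun i => x ⟨i⟩) c)) := by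
    intro θ
    obtain ⟨k, m, r, s, θ', -, -, h⟩ := fml_split (W := 𝕄) (α := ULift.{w} α) (β := N ⊕ β) (θ.relabel
      (Sum.elim (fun n => Sum.inr (Sum.inl n)) (Sum.elim (fun a => Sum.inl ⟨a⟩) (fun b => Sum.inr (Sum.inr b)))))
    refine ⟨⟨Fin m, θ'.relabel (Sum.map r id), fun i => Sum.elim (fun n : N => (n : 𝕄)) c (s i)⟩, fun i => ?_, fun x => ?_⟩
    · change Sum.elim (fun n : N => (n : 𝕄)) c (s i) ∈ _
      rcases s i with n | b
      · exact Or.inl n.2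
      · exact Or.inr ⟨b, rfl⟩
    · have := h x (Sum.elim (fun n : N => (n : 𝕄)) c)
      rw [Formula.realize_relabel] at this
      unfold ParamFormula.Realize
      rw [Formula.realize_relabel]
      refine Iff.trans (iff_of_eq ?_) (this.symm.trans (iff_of_eq ?_))
      · congr 1
        funext i; rcases i with i | i <;> rfl
      · congr 1
        funext i; rcases i with i | i | i <;> rfl
  choose f hf hf' using key
  obtain ⟨x, hx⟩ := hκ.saturated (α := ULift.{w} α) ((N : Set 𝕄) ∪ Set.range c) (f '' F) hα hA (by
    rintro _ ⟨θ, -, rfl⟩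
    exact hf θ) (by
    intro S₀ hS
    choose g hg hg' using hS
    obtain ⟨x, hx⟩ := hF (S₀.attach.image fun φ : S₀ => g φ.1 φ.2) (by
      intro θ hθ
      obtain ⟨φ, -, rfl⟩ := Finset.mem_image.1 hθ
      exact hg _ _)
    refine ⟨fun i => x i.down, fun φ hφ => ?_⟩
    rw [← hg' φ hφ, hf']
    exact hx _ (Finset.mem_image_of_mem (fun φ : S₀ => g φ.1 φ.2) (Finset.mem_attach S₀ ⟨φ, hφ⟩)))
  exact ⟨fun i => x ⟨i⟩, fun θ hθ => (hf' θ x).1 (hx _ ⟨θ, hθ, rfl⟩)⟩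

variable [DSys 𝕄]

theorem NS3_of (hD : IsDS N) (h : IsNSOP3 L 𝕄) : NS3 𝕄 := by
  classical
  intro X _ R hR hch
  obtain ⟨φ, -, hφ⟩ := def_pf hD hR
  obtain ⟨k, m, r, s, θ', -, -, hθ⟩ := fml_split (W := 𝕄) φ.toFormula
  let G : Finset (Srt.idx X) := Finset.univ.image fun i : Fin k => Sum.elim id id (r i)
  let σ : Fin G.card → Srt.idx X := fun i => (G.equivFin.symm i).1
  have hσ : Function.Injective σ := Subtype.val_injective.comp (G.equivFin.symm.injective)
  let τ : Fin k → Fin G.card := fun i => G.equivFin ⟨Sum.elim id id (r i), Finset.mem_image_of_mem _ (Finset.mem_univ i)⟩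
  have hτ : ∀ i, σ (τ i) = Sum.elim id id (r i) := fun i => by simp [σ, τ]
  let g : Fin k → Fin G.card ⊕ Fin G.card := fun i => if (r i).isLeft then Sum.inl (τ i) else Sum.inr (τ i)
  let R' : ParamFormula L 𝕄 (Fin G.card ⊕ Fin G.card) := ⟨Fin m, θ'.relabel (Sum.map g id), fun i => φ.params (s i)⟩
  have key : ∀ x y : X, R (x, y) ↔ R'.Realize (Sum.elim (fun i => Srt.eqv x (σ i)) (fun i => Srt.eqv y (σ i))) := by
    intro x y
    rw [hφ]
    unfold ParamFormula.Realize
    rw [hθ, Formula.realize_relabel]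
    apply iff_of_eq
    congr 1
    funext i
    rcases i with i | i
    · change Srt.eqv (x, y) (r i) = Sum.elim (fun i => Srt.eqv x (σ i)) (fun i => Srt.eqv y (σ i)) (g i)
      have h1 := hτ i
      dsimp only [g]
      rcases hr : r i with j | j
      · simp only [hr] at h1 ⊢
        simp [h1, eqv_pair]
      · simp only [hr] at h1 ⊢
        simp [h1, eqv_pair]
    · rfl
  obtain ⟨e, he⟩ := sat0 (X := ℕ → X) (ι := {q : ℕ × ℕ // q.1 < q.2}) (fun q x => R (x q.1.1, x q.1.2))
    (fun q => hR.comp (f := fun x : ℕ → X => (x q.1.1, x q.1.2)) (by fun_prop)) (by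
      intro t
      let n := t.sup fun q => q.1.2
      obtain ⟨e, he⟩ := hch (n + 1)
      refine ⟨fun i => e ⟨min i n, by omega⟩, fun q hq => he _ _ ?_⟩
      have h1 : q.1.2 ≤ n := Finset.le_sup (f := fun q : {q : ℕ × ℕ // q.1 < q.2} => q.1.2) hq
      have h2 := q.2
      rw [Fin.lt_def]
      simp only
      omega)
  by_contra hc
  refine h ⟨G.card, R', fun i j => Srt.eqv (e i) (σ j), fun i j hij => (key _ _).1 (he ⟨(i, j), hij⟩), ?_⟩
  rintro ⟨x1, x2, x3, h12, h23, h31⟩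
  have lift : ∀ u : Fin G.card → 𝕄, ∃ x : X, (fun i => Srt.eqv x (σ i)) = u := fun u =>
    ⟨Srt.eqv.symm (Function.extend σ u (Srt.eqv (e 0))), funext fun i => by simp [hσ.extend_apply]⟩
  obtain ⟨y1, rfl⟩ := lift x1
  obtain ⟨y2, rfl⟩ := lift x2
  obtain ⟨y3, rfl⟩ := lift x3
  exact hc ⟨y1, y2, y3, (key _ _).2 h12, (key _ _).2 h23, (key _ _).2 h31⟩

variable {X Y Z A B : Type w} [Srt 𝕄 X] [Srt 𝕄 Y] [Srt 𝕄 Z] [Srt 𝕄 A] [Srt 𝕄 B]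

theorem I_of (hD : IsDS N) {a : A} {b : X} (hb : Good b)
    (h : IndConant L 𝕄 (N : Set 𝕄) (Set.range (Srt.eqv b)) (Srt.eqv a)) : I a b := by
  intro p hp
  refine Ind.of_not_Dv hp fun P hP hab hd => ?_
  obtain ⟨χ, hχ, hχ'⟩ := def_pf hD hP
  have hnd := not_cd h (φ := χ.subst (Srt.eqv b)) (by
    rintro (i | i)
    · exact Or.inr ⟨i, rfl⟩
    · exact Or.inl (hχ i)) (by
    rw [pf_subst_realize, ← eqv_pair]
    exact (hχ' _).1 hab)
  unfold ParamFormula.ConantDividesOver at hnd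
  push Not at hnd
  obtain ⟨e, he0, hinv, hcon⟩ := hnd
  have hcst : ∀ i k, e i (Sum.inr k) = χ.params k := by
    intro i k
    have h0 : e 0 (Sum.inr k) = χ.params k := by rw [he0]; rfl
    rw [mor_const hinv (k := Sum.inr k) (by rw [h0]; exact hχ k), h0]
  obtain ⟨p0, hp0, hm⟩ := hinv
  have hu := ITof_mor (X := X) hD (gres_inv hp0 Sum.inl) (gres_mor hm Sum.inl)
  have hu0 : (Srt.eqv (X := X)).symm (e 0 ∘ Sum.inl) = b := by
    rw [he0]
    exact Srt.eqv.symm_apply_apply b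
  have hq := hu.ext 0
  rw [hu0] at hq
  refine KLf hb hP hq hp hd _ hu ?_
  obtain ⟨x, hx⟩ := satX (X := A) (Y := ℕ → X) (fun (i : ℕ) z => P (z.1, z.2 i))
    (fun i => hP.comp (f := fun z : A × (ℕ → X) => (z.1, z.2 i)) (by fun_prop))
    (fun i => (Srt.eqv (X := X)).symm (e i ∘ Sum.inl)) (by
      intro s
      obtain ⟨xx, hxx⟩ := hcon s
      refine ⟨Srt.eqv.symm xx, fun i hi => ?_⟩
      have h1 := hxx i hi
      rw [hχ', eqv_pair, Equiv.apply_symm_apply, Equiv.apply_symm_apply, ← pf_subst_realize]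
      have : e i = Sum.elim (e i ∘ Sum.inl) χ.params := by
        funext k
        rcases k with k | k
        · rfl
        · exact hcst i k
      change (χ.subst (Srt.eqv b)).toFormula.Realize (Sum.elim xx (e i)) at h1
      rw [this] at h1
      exact h1)
  exact ⟨x, hx⟩

theorem conant_of_I (hD : IsDS N) (hex : ∀ (α : Type) (d : α → 𝕄), ∃ e : ℕ → α → 𝕄, e 0 = d ∧ IsInvMorleyOver L 𝕄 (N : Set 𝕄) e)
    {c : A} {b : X} (h : I c b) : IndConant L 𝕄 (N : Set 𝕄) (Set.range (Srt.eqv b)) (Srt.eqv c) := by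
  classical
  rintro φ hφ hc ⟨k, ψ, hψ, himp⟩
  obtain ⟨e, he0, p, hp, hm⟩ := hex ((Σ j, (ψ j).Params) ⊕ Srt.idx X) (Sum.elim (fun q => (ψ q.1).params q.2) (Srt.eqv b))
  have hinc := fun j => hψ j (fun i => e i ∘ (fun q => Sum.inl ⟨j, q⟩)) (by rw [he0]; rfl) (inv_mor_res ⟨p, hp, hm⟩ _)
  have hsp := fun j => fml_split (W := 𝕄) (ψ j).toFormula
  choose k' m r s θ hr hs hθ using hsp
  let T := Tup 𝕄 (Σ j : Fin k, Fin (m j))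
  let f : (Σ j : Fin k, Fin (m j)) ⊕ Srt.idx X → (Σ j, (ψ j).Params) ⊕ Srt.idx X := Sum.map (fun q => ⟨q.1, s q.1 q.2⟩) id
  have hu := ITof_mor (X := T × X) hD (gres_inv hp f) (gres_mor hm f)
  set u : ℕ → T × X := fun i => (Srt.eqv (X := T × X)).symm (e i ∘ f) with hudef
  set q := ITof (X := T × X) hD (gres p f) (gres_inv hp f) with hqdef
  have hu0 : (u 0).2 = b := by
    apply Srt.eqv.injective
    funext i
    have : Srt.eqv (u 0) (Sum.inr i) = (e 0 ∘ f) (Sum.inr i) := by rw [hudef]; simp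
    rw [← eqv_pair_inr (X := T) (Y := X) (u 0).1]
    exact this.trans (by rw [he0]; rfl)
  have hu1 : ∀ i j t, (u i).1 ⟨j, t⟩ = e i (Sum.inl ⟨j, s j t⟩) := by
    intro i j t
    have : Srt.eqv (u i) (Sum.inl ⟨j, t⟩) = (e i ∘ f) (Sum.inl ⟨j, t⟩) := by rw [hudef]; simp
    exact this
  let P : Fin k → A × (T × X) → Prop := fun j z =>
    (θ j).Realize (Sum.elim (fun i => Srt.eqv z.1 (r j i)) (fun t => z.2.1 ⟨j, t⟩))
  have hP : ∀ j, Def (P j) := fun j => def_real hD (θ j) (CF.sum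
    (fun i => Or.inr ⟨Sum.inl (r j i), fun _ => rfl⟩) (fun t => Or.inr ⟨Sum.inr (Sum.inl ⟨j, t⟩), fun _ => rfl⟩))
  have hPψ : ∀ j i (x : A), P j (x, u i) ↔ (ψ j).toFormula.Realize (Sum.elim (Srt.eqv x) (e i ∘ (fun q => Sum.inl ⟨j, q⟩))) := by
    intro j i x
    rw [hθ]
    simp only [P, hu1]
    rfl
  obtain ⟨g, hg, hgb⟩ := CF.ofParams (N := N) b hφ
  let Q : A × X → Prop := fun z => φ.toFormula.Realize (Sum.elim (Srt.eqv z.1) (g z.2))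
  have hQ : Def Q := def_real hD _ ((CF.eqv.comp Co.fst').sum (hg.comp Co.snd'))
  have hQc : Q (c, b) := by
    change φ.toFormula.Realize (Sum.elim (Srt.eqv c) (g b))
    rw [hgb]; exact hc
  let V : T × X → Prop := fun z => ¬ ∃ x : A, Q (x, z.2) ∧ ∀ j, ¬ P j (x, z)
  have hV : Def V := by
    refine Def.not (Def.ex (P := fun z : (T × X) × A => Q (z.2, z.1.2) ∧ ∀ j, ¬ P j (z.2, z.1)) ?_)
    refine Def.and (hQ.comp (f := fun z : (T × X) × A => (z.2, z.1.2)) (by fun_prop)) ?_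
    exact Def.all fun j => ((hP j).comp (f := fun z : (T × X) × A => (z.2, z.1)) (by fun_prop)).not
  have hV0 : V (u 0) := by
    rintro ⟨x, hx, hxj⟩
    rw [hu0] at hx
    change φ.toFormula.Realize (Sum.elim (Srt.eqv x) (g b)) at hx
    rw [hgb] at hx
    obtain ⟨j, hj⟩ := himp (Srt.eqv x) hx
    refine hxj j ((hPψ j 0 x).2 ?_)
    rw [he0]
    exact hj
  have hVi : ∀ i, V (u i) := fun i => (hu.extE i (hu.ext 0)).symm _ hV hV0
  have hmap := hu.map (g := fun z : T × X => z.2) (by fun_prop)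
  have hext := hmap.ext 0
  simp only [hu0] at hext
  obtain ⟨c', hc'⟩ := (h _ hext).2 _ hmap
  have hJ : ∀ i, ∃ j, P j (c', u i) := by
    intro i
    by_contra hn
    push Not at hn
    exact hVi i ⟨c', (hc' i).symm _ hQ hQc, hn⟩
  choose J hJ using hJ
  obtain ⟨j, hj⟩ := Finite.exists_infinite_fiber J
  have hinf : (setOf fun i => J i = j).Infinite := Set.infinite_coe_iff.1 hj
  have hsub := hu.sub (Nat.nth_strictMono hinf)
  obtain ⟨d, hd⟩ := homog' (hsub.E hu) c'
  refine hinc j fun t => ⟨Srt.eqv d, fun i _ => (hPψ j i d).1 ?_⟩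
  refine hd.map (f := fun z : A × (ℕ → T × X) => (z.1, z.2 i)) (by fun_prop) _ (hP j) ?_
  have h1 := hJ (Nat.nth (fun i => J i = j) i)
  have h2 : J (Nat.nth (fun i => J i = j) i) = j := Nat.nth_mem_of_infinite hinf i
  rw [h2] at h1
  exact h1
end conc

end Abs

namespace Abs
open Filter FirstOrder Language

set_option linter.unusedSectionVars false

section fin
variable {L : FirstOrder.Language.{u, v}} {𝕄 : Type w} [L.Structure 𝕄]

theorem conant_pair [DSys 𝕄] {N : L.ElementarySubstructure 𝕄} {X A B : Type w} [Srt 𝕄 X] [Srt 𝕄 A] [Srt 𝕄 B]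
    (hD : IsDS N) (hex : ∀ (α : Type) (d : α → 𝕄), ∃ e : ℕ → α → 𝕄, e 0 = d ∧ IsInvMorleyOver L 𝕄 (N : Set 𝕄) e)
    {c : A} {d : B} {b : X} (h : I (c, d) b) :
    IndConant L 𝕄 (N : Set 𝕄) (Set.range (Srt.eqv b)) (Sum.elim (Srt.eqv c) (Srt.eqv d)) := by
  have := conant_of_I hD hex h
  rw [eqv_pair] at this
  exact this

theorem final (κ : Cardinal.{w}) [IsMonster L 𝕄 κ]
    (M : L.ElementarySubstructure 𝕄) (hMsmall : Cardinal.mk ↥(M : Set 𝕄) < κ)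
    (hNSOP3 : IsNSOP3 L 𝕄)
    {nv₁ nv₂ nv₃ : ℕ}
    (P₁ : Set (ParamFormula L 𝕄 (Fin nv₁))) (P₂ : Set (ParamFormula L 𝕄 (Fin nv₂)))
    (P₃ : Set (ParamFormula L 𝕄 (Fin nv₃)))
    (hP₁ : ∀ φ ∈ P₁, φ.ParamsIn (M : Set 𝕄)) (hP₂ : ∀ φ ∈ P₂, φ.ParamsIn (M : Set 𝕄))
    (hP₃ : ∀ φ ∈ P₃, φ.ParamsIn (M : Set 𝕄))
    (hInt₁ : IsNSOP1Th (pLang L 𝕄 (M : Set 𝕄) nv₁) (PRealizations L 𝕄 P₁))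
    (hInt₂ : IsNSOP1Th (pLang L 𝕄 (M : Set 𝕄) nv₂) (PRealizations L 𝕄 P₂))
    (hInt₃ : IsNSOP1Th (pLang L 𝕄 (M : Set 𝕄) nv₃) (PRealizations L 𝕄 P₃))
    {m₁ m₂ m₃ : ℕ}
    (a₁ a₁' : Fin m₁ → Fin nv₁ → 𝕄) (a₂ : Fin m₂ → Fin nv₂ → 𝕄) (a₃ : Fin m₃ → Fin nv₃ → 𝕄)
    (ha₁ : ∀ j, RealizesPType L 𝕄 P₁ (a₁ j))
    (ha₂ : ∀ j, RealizesPType L 𝕄 P₂ (a₂ j)) (ha₃ : ∀ j, RealizesPType L 𝕄 P₃ (a₃ j))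
    (heq : TpEq L 𝕄 (M : Set 𝕄) (flat a₁) (flat a₁'))
    (h12 : IndConant L 𝕄 (M : Set 𝕄) (Set.range (flat a₂)) (flat a₁))
    (h13 : IndConant L 𝕄 (M : Set 𝕄) (Set.range (flat a₃)) (flat a₁'))
    (h23 : IndConant L 𝕄 (M : Set 𝕄) (Set.range (flat a₃)) (flat a₂)) :
    ∃ a₁'' : Fin m₁ → Fin nv₁ → 𝕄,
      TpEq L 𝕄 ((M : Set 𝕄) ∪ Set.range (flat a₂)) (flat a₁'') (flat a₁) ∧
      TpEq L 𝕄 ((M : Set 𝕄) ∪ Set.range (flat a₃)) (flat a₁'') (flat a₁') ∧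
      IndConant L 𝕄 (M : Set 𝕄) (Set.range (flat a₁'')) (Sum.elim (flat a₂) (flat a₃)) ∧
      IndConant L 𝕄 (M : Set 𝕄) (Set.range (flat a₃)) (Sum.elim (flat a₂) (flat a₁'')) ∧
      IndConant L 𝕄 (M : Set 𝕄) (Set.range (flat a₂)) (Sum.elim (flat a₃) (flat a₁'')) := by
  by_cases hM : (M : Set 𝕄) = Set.univ
  · refine ⟨a₁, fun _ _ => Iff.rfl, fun φ _ => ?_, conant_univ hM _, conant_univ hM _, conant_univ hM _⟩
    rw [hM] at heq
    rw [tp_univ heq]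
  have hne : Nonempty 𝕄 := by
    obtain ⟨z, -⟩ := (Set.ne_univ_iff_exists_notMem _).1 hM
    exact ⟨z⟩
  have hs : SatN M := sat_of κ hM hMsmall
  letI : DSys 𝕄 := mkDSys M hs
  have hD : IsDS M := ⟨fun _ => Iff.rfl, rfl⟩
  have hN3 : NS3 𝕄 := NS3_of hD hNSOP3
  have g1 := good_P hD hN3 P₁ hP₁ hInt₁ a₁ ha₁
  have g2 := good_P hD hN3 P₂ hP₂ hInt₂ a₂ ha₂
  have g3 := good_P hD hN3 P₃ hP₃ hInt₃ a₃ ha₃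
  have e : E (X := Tup 𝕄 (Fin m₁ × Fin nv₁)) (flat a₁) (flat a₁') := E.of_tp hD heq
  have i12 := I_of (A := Tup 𝕄 (Fin m₁ × Fin nv₁)) (a := flat a₁) hD g2 h12
  have i13 := I_of (A := Tup 𝕄 (Fin m₁ × Fin nv₁)) (a := flat a₁') hD g3 h13
  have i23 := I_of (A := Tup 𝕄 (Fin m₂ × Fin nv₂)) (a := flat a₂) hD g3 h23
  obtain ⟨a, e1, e2, j1, j2, j3⟩ := moreover hN3 g1 g2 g3 e i12 i13 i23
  have hex := hex_of h12
  refine ⟨fun i j => a (i, j), E.tpOver hD e1, E.tpOver hD e2,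
    conant_pair hD hex j1, conant_pair hD hex j2, conant_pair hD hex j3⟩
end fin

end Abs

/-- the independence theorem for internally NSOP₁ types in NSOP₃
theories, with the "moreover" clause. -/
theorem statement_1
    (L : FirstOrder.Language.{u, v}) (𝕄 : Type w) [L.Structure 𝕄]
    (κ : Cardinal.{w}) [IsMonster L 𝕄 κ]
    (M : L.ElementarySubstructure 𝕄) (hMsmall : Cardinal.mk ↥(M : Set 𝕄) < κ)
    (hNSOP3 : IsNSOP3 L 𝕄)
    {nv₁ nv₂ nv₃ : ℕ}
    (P₁ : Set (ParamFormula L 𝕄 (Fin nv₁))) (P₂ : Set (ParamFormula L 𝕄 (Fin nv₂)))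
    (P₃ : Set (ParamFormula L 𝕄 (Fin nv₃)))
    (hP₁ : ∀ φ ∈ P₁, φ.ParamsIn (M : Set 𝕄)) (hP₂ : ∀ φ ∈ P₂, φ.ParamsIn (M : Set 𝕄))
    (hP₃ : ∀ φ ∈ P₃, φ.ParamsIn (M : Set 𝕄))
    (hInt₁ : IsNSOP1Th (pLang L 𝕄 (M : Set 𝕄) nv₁) (PRealizations L 𝕄 P₁))
    (hInt₂ : IsNSOP1Th (pLang L 𝕄 (M : Set 𝕄) nv₂) (PRealizations L 𝕄 P₂))
    (hInt₃ : IsNSOP1Th (pLang L 𝕄 (M : Set 𝕄) nv₃) (PRealizations L 𝕄 P₃))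
    {m₁ m₂ m₃ : ℕ}
    (a₁ a₁' : Fin m₁ → Fin nv₁ → 𝕄) (a₂ : Fin m₂ → Fin nv₂ → 𝕄) (a₃ : Fin m₃ → Fin nv₃ → 𝕄)
    (ha₁ : ∀ j, RealizesPType L 𝕄 P₁ (a₁ j)) (ha₁' : ∀ j, RealizesPType L 𝕄 P₁ (a₁' j))
    (ha₂ : ∀ j, RealizesPType L 𝕄 P₂ (a₂ j)) (ha₃ : ∀ j, RealizesPType L 𝕄 P₃ (a₃ j))
    (heq : TpEq L 𝕄 (M : Set 𝕄) (flat a₁) (flat a₁'))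
    (h12 : IndConant L 𝕄 (M : Set 𝕄) (Set.range (flat a₂)) (flat a₁))
    (h13 : IndConant L 𝕄 (M : Set 𝕄) (Set.range (flat a₃)) (flat a₁'))
    (h23 : IndConant L 𝕄 (M : Set 𝕄) (Set.range (flat a₃)) (flat a₂)) :
    ∃ a₁'' : Fin m₁ → Fin nv₁ → 𝕄,
      TpEq L 𝕄 ((M : Set 𝕄) ∪ Set.range (flat a₂)) (flat a₁'') (flat a₁) ∧
      TpEq L 𝕄 ((M : Set 𝕄) ∪ Set.range (flat a₃)) (flat a₁'') (flat a₁') ∧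
      IndConant L 𝕄 (M : Set 𝕄) (Set.range (flat a₁'')) (Sum.elim (flat a₂) (flat a₃)) ∧
      IndConant L 𝕄 (M : Set 𝕄) (Set.range (flat a₃)) (Sum.elim (flat a₂) (flat a₁'')) ∧
      IndConant L 𝕄 (M : Set 𝕄) (Set.range (flat a₂)) (Sum.elim (flat a₃) (flat a₁'')) := by
  exact Abs.final κ M hMsmall hNSOP3 P₁ P₂ P₃ hP₁ hP₂ hP₃ hInt₁ hInt₂ hInt₃ a₁ a₁' a₂ a₃
    ha₁ ha₂ ha₃ heq h12 h13 h23

end NSOP3Paper
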